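/- Let X ⊂ ℂ^N be a local real-analytic subvariety such that every point p ∈ X_reg has a neighborhood U with X ∩ U a complex manifold. Then X is a local complex analytic subvariety. -/

import Mathlib

/- Common definitions: real-analytic and complex-analytic subvarieties of ℂ^N,
Levi-flat hypervarieties, CR submanifolds, Segre varieties, etc. -/

open Complex Set Topology Filter
open scoped ENNReal

noncomputable section

abbrev CN (N : ℕ) := Fin N → ℂ

/-- `X` is a (relatively closed) real-analytic subvariety of the open set `U ⊆ ℂ^N`. -/
def IsRealSubvariety (N : ℕ) (U X : Set (CN N)) : Prop :=
  X ⊆ U ∧ closure X ∩ U ⊆ X ∧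
    ∀ p ∈ U, ∃ V : Set (CN N), IsOpen V ∧ p ∈ V ∧ V ⊆ U ∧
      ∃ (k : ℕ) (f : Fin k → CN N → ℝ),
        (∀ i, AnalyticOn ℝ (f i) V) ∧ X ∩ V = {z ∈ V | ∀ i, f i z = 0}

/-- `X` is a (relatively closed) complex-analytic subvariety of the open set `U ⊆ ℂ^N`. -/
def IsComplexSubvariety (N : ℕ) (U X : Set (CN N)) : Prop :=
  X ⊆ U ∧ closure X ∩ U ⊆ X ∧
    ∀ p ∈ U, ∃ V : Set (CN N), IsOpen V ∧ p ∈ V ∧ V ⊆ U ∧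
      ∃ (k : ℕ) (f : Fin k → CN N → ℂ),
        (∀ i, AnalyticOn ℂ (f i) V) ∧ X ∩ V = {z ∈ V | ∀ i, f i z = 0}

/-- `X` is a real-analytic subvariety of the (not necessarily open) set `V`. -/
def IsRealSubvarietyIn (N : ℕ) (V X : Set (CN N)) : Prop :=
  X ⊆ V ∧ closure X ∩ V ⊆ X ∧
    ∀ p ∈ V, ∃ W : Set (CN N), IsOpen W ∧ p ∈ W ∧
      ∃ (k : ℕ) (f : Fin k → CN N → ℝ),
        (∀ i, AnalyticOn ℝ (f i) W) ∧ X ∩ W = {z ∈ V ∩ W | ∀ i, f i z = 0}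

/-- `X` is a complex-analytic subvariety of the (not necessarily open) set `V`. -/
def IsComplexSubvarietyIn (N : ℕ) (V X : Set (CN N)) : Prop :=
  X ⊆ V ∧ closure X ∩ V ⊆ X ∧
    ∀ p ∈ V, ∃ W : Set (CN N), IsOpen W ∧ p ∈ W ∧
      ∃ (k : ℕ) (f : Fin k → CN N → ℂ),
        (∀ i, AnalyticOn ℂ (f i) W) ∧ X ∩ W = {z ∈ V ∩ W | ∀ i, f i z = 0}

/-- Near `p`, `X` is a real-analytic submanifold of ℂ^N of real dimension `d`,
cut out by `2N - d` real-analytic functions with linearly independent differentials. -/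
def IsSubmanifoldAtDim (N d : ℕ) (X : Set (CN N)) (p : CN N) : Prop :=
  ∃ (V : Set (CN N)) (f : Fin (2 * N - d) → CN N → ℝ),
    IsOpen V ∧ p ∈ V ∧ (∀ i, AnalyticOn ℝ (f i) V) ∧
    (∀ z ∈ V, LinearIndependent ℝ fun i => fderiv ℝ (f i) z) ∧
    X ∩ V = {z ∈ V | ∀ i, f i z = 0}

/-- Near `p`, `X` is a complex submanifold of ℂ^N of complex dimension `d`. -/
def IsCxSubmanifoldAtDim (N d : ℕ) (X : Set (CN N)) (p : CN N) : Prop :=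
  ∃ (V : Set (CN N)) (f : Fin (N - d) → CN N → ℂ),
    IsOpen V ∧ p ∈ V ∧ (∀ i, AnalyticOn ℂ (f i) V) ∧
    (∀ z ∈ V, LinearIndependent ℂ fun i => fderiv ℂ (f i) z) ∧
    X ∩ V = {z ∈ V | ∀ i, f i z = 0}

/-- Points near which `X` is a real-analytic submanifold of some dimension. -/
def regPts (N : ℕ) (X : Set (CN N)) : Set (CN N) :=
  {p ∈ X | ∃ d, IsSubmanifoldAtDim N d X p}

/-- The singular set `X_s` of a real-analytic subvariety. -/
def singSet (N : ℕ) (X : Set (CN N)) : Set (CN N) := X \ regPts N X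

/-- `H*`: the points near which `H` is a nonsingular real-analytic hypersurface. -/
def hypStar (N : ℕ) (H : Set (CN N)) : Set (CN N) :=
  {p ∈ H | IsSubmanifoldAtDim N (2 * N - 1) H p}

/-- Near `p` the hypersurface `H` is given by `Im f = 0` for a holomorphic `f` with
nonvanishing differential (the local model of a nonsingular Levi-flat hypersurface). -/
def IsLeviFlatHypAt (N : ℕ) (H : Set (CN N)) (p : CN N) : Prop :=
  ∃ (V : Set (CN N)) (f : CN N → ℂ),
    IsOpen V ∧ p ∈ V ∧ AnalyticOn ℂ f V ∧ (∀ z ∈ V, fderiv ℂ f z ≠ 0) ∧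
    H ∩ V = {z ∈ V | (f z).im = 0}

/-- A Levi-flat real-hypervariety `H` of the open set `U`: a relatively closed
real-analytic subvariety of real dimension `2N - 1` whose regular hypersurface
part `H*` is Levi-flat. -/
def IsLeviFlatHypervariety (N : ℕ) (U H : Set (CN N)) : Prop :=
  IsOpen U ∧ IsRealSubvariety N U H ∧ dimH H = ((2 * N - 1 : ℕ) : ℝ≥0∞) ∧
    ∀ p ∈ hypStar N H, IsLeviFlatHypAt N H p

/-- Near `p`, in suitable local holomorphic coordinates `Φ`, the set `M` is given by
`Im z₁ = ⋯ = Im z_j = 0`, `z_{j+1} = ⋯ = z_k = 0`: `M` is a Levi-flat CR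
submanifold at `p`. -/
def IsLeviFlatCRAt (N : ℕ) (M : Set (CN N)) (p : CN N) : Prop :=
  ∃ (V : Set (CN N)) (Φ : CN N → CN N) (j k : ℕ),
    j ≤ k ∧ k ≤ N ∧ IsOpen V ∧ p ∈ V ∧
    AnalyticOn ℂ Φ V ∧ InjOn Φ V ∧
    (∀ z ∈ V, Function.Bijective ⇑(fderiv ℂ Φ z)) ∧
    M ∩ V = {z ∈ V | (∀ i : Fin N, (i : ℕ) < j → (Φ z i).im = 0) ∧
      ∀ i : Fin N, j ≤ (i : ℕ) → (i : ℕ) < k → Φ z i = 0}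

/-- The holomorphic part `∂r` of the differential of a real function `r` at `z`,
as a complex-valued form: `∂r(v) = dr(v) - i · dr(i·v)` (up to a factor `2`). -/
def delForm (N : ℕ) (r : CN N → ℝ) (z : CN N) : CN N → ℂ := fun v =>
  Complex.ofReal (fderiv ℝ r z v) -
    Complex.I * Complex.ofReal (fderiv ℝ r z (Complex.I • v))

/-- `M` is a generic submanifold near `p`: locally cut out by real-analytic
`r₁, …, r_k` with `∂r₁, …, ∂r_k` linearly independent. -/
def IsGenericSubmanifoldAt (N : ℕ) (M : Set (CN N)) (p : CN N) : Prop :=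
  ∃ (V : Set (CN N)) (k : ℕ) (r : Fin k → CN N → ℝ),
    IsOpen V ∧ p ∈ V ∧ (∀ i, AnalyticOn ℝ (r i) V) ∧
    (∀ z ∈ V, LinearIndependent ℝ fun i => fderiv ℝ (r i) z) ∧
    (∀ z ∈ V, LinearIndependent ℂ fun i => delForm N (r i) z) ∧
    M ∩ V = {z ∈ V | ∀ i, r i z = 0}

/-- Near `p`, in suitable local holomorphic coordinates, `M` is `{Im z₁ = Im z₂ = 0}`:
the local model of a generic Levi-flat submanifold of real dimension `2N - 2`. -/
def IsGenericLeviFlat2At (N : ℕ) (M : Set (CN N)) (p : CN N) : Prop :=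
  ∃ (V : Set (CN N)) (Φ : CN N → CN N),
    IsOpen V ∧ p ∈ V ∧ AnalyticOn ℂ Φ V ∧ InjOn Φ V ∧
    (∀ z ∈ V, Function.Bijective ⇑(fderiv ℂ Φ z)) ∧
    M ∩ V = {z ∈ V | ∀ i : Fin N, (i : ℕ) < 2 → (Φ z i).im = 0}

/-- The complex-tangent (CR) vectors to `M` at `p`. -/
def crTangent (N : ℕ) (M : Set (CN N)) (p : CN N) : Set (CN N) :=
  {v | v ∈ tangentConeAt ℝ M p ∧ Complex.I • v ∈ tangentConeAt ℝ M p}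

/-- The CR dimension of `M` at `p`. -/
def crDim (N : ℕ) (M : Set (CN N)) (p : CN N) : ℕ :=
  Module.finrank ℂ (Submodule.span ℂ (crTangent N M p))

/-- `M` is a real-analytic CR submanifold: a real-analytic submanifold with
constant CR dimension. -/
def IsCRSubmanifold (N : ℕ) (M : Set (CN N)) : Prop :=
  (∃ d, ∀ p ∈ M, IsSubmanifoldAtDim N d M p) ∧ ∃ m, ∀ p ∈ M, crDim N M p = m

/-- Coordinatewise complex conjugation. -/
def conjPt (N : ℕ) (z : CN N) : CN N := fun i => starRingEnd ℂ (z i)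

/-- `R` is the complexification `r(z, w̄)` of the real-analytic function `r` on `U`:
it is holomorphic on `U × *U` (where `*U` is the conjugate of `U`) and `R(z, z̄) = r(z)`. -/
def IsComplexification (N : ℕ) (U : Set (CN N)) (r : CN N → ℝ)
    (R : CN N → CN N → ℂ) : Prop :=
  AnalyticOn ℂ (fun zw : CN N × CN N => R zw.1 zw.2) (U ×ˢ (conjPt N '' U)) ∧
    ∀ z ∈ U, R z (conjPt N z) = Complex.ofReal (r z)

/-- The Segre variety `Σ_p(U, r) = {z ∈ U : r(z, p̄) = 0}`, for `R` the
complexification of `r`. -/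
def segreSet (N : ℕ) (U : Set (CN N)) (R : CN N → CN N → ℂ) (p : CN N) : Set (CN N) :=
  {z ∈ U | R z (conjPt N p) = 0}

/-- `p` is a Segre-degenerate singularity of `H`: for every local defining function `r` of
`H` at `p`, the function `z ↦ r(z, p̄)` vanishes identically near `p`. -/
def IsSegreDegenerateAt (N : ℕ) (H : Set (CN N)) (p : CN N) : Prop :=
  ∀ (V : Set (CN N)) (r : CN N → ℝ) (R : CN N → CN N → ℂ),
    IsOpen V → p ∈ V → AnalyticOn ℝ r V → IsComplexification N V r R →
    H ∩ V = {z ∈ V | r z = 0} → ∀ᶠ z in nhds p, R z (conjPt N p) = 0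

/-- `Σ'`: the union of all complex subvarieties of `V` of complex dimension `N - 1`
contained in `H`. -/
def sigmaPrime (N : ℕ) (H V : Set (CN N)) : Set (CN N) :=
  ⋃₀ {W | IsComplexSubvariety N V W ∧ W ⊆ H ∧ dimH W = ((2 * N - 2 : ℕ) : ℝ≥0∞)}

/-- `p` is a leaf-degenerate point of `H`: the germ `Σ'_p(H)` is not a complex variety of
dimension `N - 1`, i.e. there is no single complex subvariety `W ∋ p` of dimension `N - 1`
inside `H` containing all complex hypervarieties of `H` near `p`. -/
def IsLeafDegenerateAt (N : ℕ) (H : Set (CN N)) (p : CN N) : Prop :=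
  ¬∃ (V W : Set (CN N)), IsOpen V ∧ p ∈ V ∧ p ∈ W ∧ W ⊆ H ∧
    IsComplexSubvariety N V W ∧ dimH W = ((2 * N - 2 : ℕ) : ℝ≥0∞) ∧
    ∀ V' : Set (CN N), IsOpen V' → V' ⊆ V → sigmaPrime N H V' ⊆ W

/-- An irreducible complex subvariety of `U`. -/
def IsIrreducibleCxSubvariety (N : ℕ) (U W : Set (CN N)) : Prop :=
  IsComplexSubvariety N U W ∧ W.Nonempty ∧
    ∀ W₁ W₂ : Set (CN N), IsComplexSubvariety N U W₁ → IsComplexSubvariety N U W₂ →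
      W = W₁ ∪ W₂ → W = W₁ ∨ W = W₂

/-- The germ of the real-analytic variety `H` at `p` is irreducible: in any decomposition
of `H` near `p` into two real-analytic subvarieties, one of them contains `H` near `p`. -/
def IsIrreducibleGermAt (N : ℕ) (H : Set (CN N)) (p : CN N) : Prop :=
  ∀ V H₁ H₂ : Set (CN N), IsOpen V → p ∈ V →
    IsRealSubvariety N V H₁ → IsRealSubvariety N V H₂ → H ∩ V = H₁ ∪ H₂ →
    ∃ V' : Set (CN N), IsOpen V' ∧ p ∈ V' ∧ (H ∩ V' ⊆ H₁ ∨ H ∩ V' ⊆ H₂)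

/-- `M` is minimal at `p`: every (real-analytic) CR submanifold of `M` through `p` with
the same CR dimension contains a neighborhood of `p` in `M`. -/
def IsMinimalAt (N : ℕ) (M : Set (CN N)) (p : CN N) : Prop :=
  ∀ M' : Set (CN N), p ∈ M' → M' ⊆ M →
    (∃ d, ∀ q ∈ M', IsSubmanifoldAtDim N d M' q) →
    (∀ q ∈ M', crDim N M' q = crDim N M p) →
    ∃ V : Set (CN N), IsOpen V ∧ p ∈ V ∧ M ∩ V ⊆ M'

/-- `O` is (a representative of) the local CR orbit of `M` at `p`, of dimension `d`:
the smallest CR submanifold of `M` through `p` of the same CR dimension as `M` at `p`. -/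
def IsCROrbitAt (N d : ℕ) (M O : Set (CN N)) (p : CN N) : Prop :=
  p ∈ O ∧ O ⊆ M ∧ (∀ q ∈ O, IsSubmanifoldAtDim N d O q) ∧
    (∀ q ∈ O, crDim N O q = crDim N M p) ∧
    ∀ O' : Set (CN N), p ∈ O' → O' ⊆ M →
      (∃ d', ∀ q ∈ O', IsSubmanifoldAtDim N d' O' q) →
      (∀ q ∈ O', crDim N O' q = crDim N M p) →
      ∃ V : Set (CN N), IsOpen V ∧ p ∈ V ∧ O ∩ V ⊆ O'

/-- `r` generates the ideal of germs at `p` of real-analytic functions vanishing on `H`. -/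
def GeneratesVanishingIdealAt (N : ℕ) (H V : Set (CN N)) (r : CN N → ℝ) (p : CN N) :
    Prop :=
  (∀ z ∈ H ∩ V, r z = 0) ∧
    ∀ (V' : Set (CN N)) (g : CN N → ℝ), IsOpen V' → p ∈ V' → AnalyticOn ℝ g V' →
      (∀ z ∈ H ∩ V', g z = 0) →
      ∃ (V'' : Set (CN N)) (q : CN N → ℝ), IsOpen V'' ∧ p ∈ V'' ∧ V'' ⊆ V ∩ V' ∧
        AnalyticOn ℝ q V'' ∧ ∀ z ∈ V'', g z = q z * r z

/-- The exterior derivative of a one-form `ω`, evaluated at `z` on `(u, v)`. -/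
def oneFormD (N : ℕ) (ω : CN N → (CN N →L[ℂ] ℂ)) (z u v : CN N) : ℂ :=
  fderiv ℂ ω z u v - fderiv ℂ ω z v u

/-- `(ω ∧ dω)(u, v, w)` at `z`; its vanishing is complete integrability of `ω`. -/
def integrabilityWedge (N : ℕ) (ω : CN N → (CN N →L[ℂ] ℂ)) (z u v w : CN N) : ℂ :=
  ω z u * oneFormD N ω z v w - ω z v * oneFormD N ω z u w + ω z w * oneFormD N ω z u v

open scoped BoundedContinuousFunction in
/-- The series with values in bounded sequences whose `k`-th coordinate is the rescaled series
of the `k`-th Taylor coefficient in the last variable. -/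
def coeffSeries {E : Type*} [NormedAddCommGroup E] [NormedSpace ℝ E]
    (q : ℕ → FormalMultilinearSeries ℝ E ℝ) (B : ℕ → ℝ) (hB : ∀ k n, ‖q k n‖ ≤ B n) :
    FormalMultilinearSeries ℝ E (ℕ →ᵇ ℝ) := fun n =>
  MultilinearMap.mkContinuous
    { toFun := fun v => BoundedContinuousFunction.ofNormedAddCommGroupDiscrete
        (fun k => q k n v) (B n * ∏ i, ‖v i‖) (fun k =>
          ((q k n).le_opNorm v).trans (by gcongr; exact hB k n))
      map_update_add' := fun v i x y => by
        ext k; simp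
      map_update_smul' := fun v i x y => by
        ext k; simp }
    (B n) (fun v => (BoundedContinuousFunction.norm_le (by
        have := (norm_nonneg _).trans (hB 0 n); positivity)).2 fun k =>
          ((q k n).le_opNorm v).trans (by gcongr; exact hB k n))

theorem norm_coeffSeries_le {E : Type*} [NormedAddCommGroup E] [NormedSpace ℝ E]
    (q : ℕ → FormalMultilinearSeries ℝ E ℝ) (B : ℕ → ℝ) (hB : ∀ k n, ‖q k n‖ ≤ B n) (n : ℕ) :
    ‖coeffSeries q B hB n‖ ≤ B n :=
  MultilinearMap.mkContinuous_norm_le _ ((norm_nonneg _).trans (hB 0 n)) _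

open scoped BoundedContinuousFunction in
/-- Uniformly bounded families of power series sum to an analytic map into bounded sequences. -/
theorem exists_analyticAt_bounded_of_series {E : Type*} [NormedAddCommGroup E] [NormedSpace ℝ E]
    (q : ℕ → FormalMultilinearSeries ℝ E ℝ) (C a : ℝ) (ha : 0 < a)
    (hB : ∀ k n, ‖q k n‖ ≤ C * a ^ n) :
    ∃ F : E → (ℕ →ᵇ ℝ), AnalyticAt ℝ F 0 ∧
      ∀ᶠ x in 𝓝 (0 : E), ∀ k, HasSum (fun n => q k n fun _ => x) (F x k) := by
  let Q := coeffSeries q (fun n => C * a ^ n) hB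
  have hrad : (0 : ℝ≥0∞) < Q.radius := by
    refine lt_of_lt_of_le ?_ (Q.le_radius_of_bound C (r := Real.toNNReal a⁻¹) fun n => ?_)
    · exact ENNReal.coe_pos.2 (Real.toNNReal_pos.2 (inv_pos.2 ha))
    · rw [Real.coe_toNNReal _ (inv_pos.2 ha).le]
      calc ‖Q n‖ * (a⁻¹) ^ n ≤ (C * a ^ n) * (a⁻¹) ^ n := by
            gcongr; exact norm_coeffSeries_le _ _ _ _
        _ = C := by rw [mul_assoc, ← mul_pow, mul_inv_cancel₀ ha.ne', one_pow, mul_one]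
  have hQ := Q.hasFPowerSeriesOnBall hrad
  refine ⟨Q.sum, hQ.analyticAt, ?_⟩
  filter_upwards [Metric.eball_mem_nhds (0 : E) hrad] with x hx k
  have h1 := hQ.hasSum hx
  rw [zero_add] at h1
  exact h1.mapL (BoundedContinuousFunction.evalCLM ℝ k)

theorem norm_changeOriginSeries_le {E F : Type*} [NormedAddCommGroup E] [NormedSpace ℝ E]
    [NormedAddCommGroup F] [NormedSpace ℝ F] (p : FormalMultilinearSeries ℝ E F) (k l : ℕ) :
    ‖p.changeOriginSeries k l‖ ≤ 2 ^ (k + l) * ‖p (k + l)‖ := by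
  refine (norm_sum_le (Finset.univ : Finset {s : Finset (Fin (k + l)) // s.card = l})
    (fun s => p.changeOriginSeriesTerm k l s s.2)).trans ?_
  simp only [FormalMultilinearSeries.norm_changeOriginSeriesTerm, Finset.sum_const, nsmul_eq_mul]
  gcongr
  have : Fintype.card {s : Finset (Fin (k + l)) // s.card = l} ≤ 2 ^ (k + l) := by
    refine (Fintype.card_subtype_le _).trans ?_
    simp
  rw [Finset.card_univ]
  exact_mod_cast this

open scoped BoundedContinuousFunction in
/-- Taylor coefficients in the last variable form an analytic map into bounded sequences. -/
theorem exists_analyticAt_coeff {E : Type*} [NormedAddCommGroup E] [NormedSpace ℝ E]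
    {f : E × ℝ → ℝ} (hf : AnalyticAt ℝ f 0) :
    ∃ ρ : ℝ, 0 < ρ ∧ ∃ F : E → (ℕ →ᵇ ℝ), AnalyticAt ℝ F 0 ∧
      ∀ᶠ x in 𝓝 (0 : E), ∀ t : ℝ, |t| < 1 → HasSum (fun k => F x k * t ^ k) (f (x, ρ * t)) := by
  obtain ⟨p, R, hp⟩ := hf
  obtain ⟨r, hr0, hrR⟩ := ENNReal.lt_iff_exists_nnreal_btwn.1 hp.r_pos
  have hr0' : (0 : ℝ) < r := by exact_mod_cast hr0
  obtain ⟨C, hC, hCb⟩ := p.norm_mul_pow_le_of_lt_radius (hrR.trans_le hp.r_le)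
  have hrp : (r : ℝ≥0∞) < p.radius := hrR.trans_le hp.r_le
  let ρ : ℝ := r / 2
  have hρ : 0 < ρ := by positivity
  let ι : E →L[ℝ] E × ℝ := ContinuousLinearMap.inl ℝ E ℝ
  have hι : ‖ι‖ ≤ 1 := ContinuousLinearMap.opNorm_le_bound _ zero_le_one fun x => by
    simp [ι, Prod.norm_def]
  let ev (k : ℕ) : ((E × ℝ) [×k]→L[ℝ] ℝ) →L[ℝ] ℝ :=
    ContinuousMultilinearMap.apply ℝ (fun _ : Fin k => E × ℝ) ℝ (fun _ => (0, 1))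
  have hev : ∀ k (A : (E × ℝ) [×k]→L[ℝ] ℝ), ‖ev k A‖ ≤ ‖A‖ := fun k A => by
    refine (A.le_opNorm _).trans ?_
    simp [Prod.norm_def]
  let q : ℕ → FormalMultilinearSeries ℝ E ℝ := fun k l =>
    ρ ^ k • (ev k).compContinuousMultilinearMap
      ((p.changeOriginSeries k l).compContinuousLinearMap fun _ => ι)
  have hq : ∀ k l, ‖q k l‖ ≤ C * (2 / r) ^ l := fun k l => by
    refine ContinuousMultilinearMap.opNorm_le_bound (by positivity) fun v => ?_
    have h1 : ‖q k l v‖ ≤ ρ ^ k * (2 ^ (k + l) * ‖p (k + l)‖ * ∏ i, ‖v i‖) := by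
      change ‖ρ ^ k • ev k (p.changeOriginSeries k l fun i => ι (v i))‖ ≤ _
      rw [norm_smul, Real.norm_of_nonneg (by positivity)]
      gcongr
      refine (hev _ _).trans ((ContinuousMultilinearMap.le_opNorm _ _).trans ?_)
      gcongr with i
      · exact norm_changeOriginSeries_le _ _ _
      · exact (ι.le_of_opNorm_le hι _).trans (by simp)
    refine h1.trans (le_of_eq_of_le (?_ : _ = (‖p (k + l)‖ * r ^ (k + l)) * (2 / r) ^ l * ∏ i, ‖v i‖) ?_)
    · simp only [ρ, div_pow, pow_add]
      field_simp
    · gcongr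
      exact hCb _
  obtain ⟨F, hF, hFs⟩ := exists_analyticAt_bounded_of_series q C (2 / r) (by positivity) hq
  refine ⟨ρ, hρ, F, hF, ?_⟩
  filter_upwards [hFs, Metric.ball_mem_nhds (0 : E) hρ] with x hx hxr t ht
  have hxι : ‖ι x‖ < ρ := by simpa [ι, Prod.norm_def] using hxr
  have hxr' : (‖ι x‖₊ : ℝ≥0∞) < r := by
    rw [ENNReal.coe_lt_coe, ← NNReal.coe_lt_coe, coe_nnnorm]
    refine hxι.trans ?_
    simp only [ρ]; linarith
  have hFk : ∀ k, F x k = ρ ^ k * p.changeOrigin (ι x) k (fun _ => (0, 1)) := fun k => by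
    refine (hx k).unique ?_
    have h2 := (p.hasFPowerSeriesOnBall_changeOrigin k (hp.r_pos.trans_le hp.r_le)).hasSum
      (y := ι x) (mem_eball_zero_iff.2 (hxr'.trans hrp))
    rw [zero_add] at h2
    exact (h2.mapL (ev k)).const_smul (ρ ^ k)
  have h3 := hp.changeOrigin (y := ι x) (hxr'.trans hrR)
  have h4 := h3.hasSum (y := ((0 : E), ρ * t)) (by
    rw [mem_eball_zero_iff, lt_tsub_iff_right]
    refine lt_of_le_of_lt ?_ hrR
    rw [← enorm_eq_nnnorm, enorm_eq_nnnorm, enorm_eq_nnnorm, ← ENNReal.coe_add, ENNReal.coe_le_coe, ← NNReal.coe_le_coe]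
    push_cast
    have : ‖((0 : E), ρ * t)‖ = ρ * |t| := by 
      rw [Prod.norm_def, norm_zero, Real.norm_eq_abs, abs_mul, abs_of_pos hρ]
      exact max_eq_right (by positivity)
    rw [this]
    have : ρ * |t| ≤ ρ * 1 := by gcongr
    simp only [ρ] at *
    linarith)
  have h5 : (0 : E × ℝ) + ι x + (0, ρ * t) = (x, ρ * t) := by simp [ι]
  rw [h5] at h4
  refine (congrArg (fun u => HasSum u (f (x, ρ * t))) (funext fun k => ?_)).mpr h4
  rw [hFk]
  have h6 : (fun _ : Fin k => ((0 : E), ρ * t)) = fun _ => (ρ * t) • ((0 : E), (1 : ℝ)) := by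
    simp
  rw [h6, ContinuousMultilinearMap.map_smul_univ]
  simp [mul_pow]; ring

/-- The analytic inverse function theorem. -/
theorem AnalyticAt.exists_local_inverse {𝕂 E F : Type*} [RCLike 𝕂] [NormedAddCommGroup E]
    [NormedSpace 𝕂 E] [CompleteSpace E] [NormedAddCommGroup F] [NormedSpace 𝕂 F] [CompleteSpace F]
    {f : E → F} {a : E} (hf : AnalyticAt 𝕂 f a) (f' : E ≃L[𝕂] F)
    (hf' : HasFDerivAt f (f' : E →L[𝕂] F) a) :
    ∃ g : F → E, AnalyticAt 𝕂 g (f a) ∧ g (f a) = a ∧ (∀ᶠ y in 𝓝 (f a), f (g y) = y) ∧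
      ∀ᶠ x in 𝓝 a, g (f x) = x := by
  have hc : ContDiffAt 𝕂 ⊤ f a := hf.contDiffAt
  have hs := hc.hasStrictFDerivAt' hf' (by simp)
  exact ⟨hc.localInverse hf' (by simp), (hc.to_localInverse hf' (by simp)).analyticAt,
    hc.localInverse_apply_image hf' (by simp), hs.eventually_right_inverse,
    hs.eventually_left_inverse⟩

open scoped BoundedContinuousFunction in
/-- The right shift by `j` places on bounded sequences. -/
def shiftCLM (j : ℕ) : (ℕ →ᵇ ℝ) →L[ℝ] (ℕ →ᵇ ℝ) :=
  LinearMap.mkContinuous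
    { toFun := fun u => BoundedContinuousFunction.ofNormedAddCommGroupDiscrete
        (fun k => if j ≤ k then u (k - j) else 0) ‖u‖ (fun k => by
          split_ifs
          · exact u.norm_coe_le_norm _
          · simp)
      map_add' := fun u v => by
        ext k
        by_cases h : j ≤ k <;> simp [h]
      map_smul' := fun c u => by
        ext k
        by_cases h : j ≤ k <;> simp [h] } 1
    (fun u => by
      rw [one_mul]
      refine (BoundedContinuousFunction.norm_le (norm_nonneg _)).2 fun k => ?_
      by_cases h : j ≤ k
      · simpa [h] using u.norm_coe_le_norm _
      · simp [h])

open scoped BoundedContinuousFunction in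
theorem shiftCLM_apply (j : ℕ) (u : ℕ →ᵇ ℝ) (k : ℕ) :
    shiftCLM j u k = if j ≤ k then u (k - j) else 0 := rfl

open scoped BoundedContinuousFunction in
theorem summable_bcf_mul_pow (u : ℕ →ᵇ ℝ) {t : ℝ} (ht : |t| < 1) :
    Summable fun k => u k * t ^ k := by
  refine Summable.of_norm_bounded (g := fun k => ‖u‖ * |t| ^ k)
    ((summable_geometric_of_lt_one (abs_nonneg t) ht).mul_left _) fun k => ?_
  rw [norm_mul, norm_pow, Real.norm_eq_abs t]
  gcongr
  exact u.norm_coe_le_norm k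

open scoped BoundedContinuousFunction in
theorem hasSum_shiftCLM (j : ℕ) (u : ℕ →ᵇ ℝ) {t : ℝ} (ht : |t| < 1) :
    HasSum (fun k => shiftCLM j u k * t ^ k) (t ^ j * ∑' k, u k * t ^ k) := by
  have h := ((summable_bcf_mul_pow u ht).hasSum).mul_left (t ^ j)
  have hinj : Function.Injective (fun k : ℕ => k + j) := add_left_injective j
  rw [← hinj.hasSum_iff (f := fun k => shiftCLM j u k * t ^ k)]
  · refine (congrArg (fun v => HasSum v _) (funext fun k => ?_)).mpr h
    simp [shiftCLM_apply, pow_add]; ring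
  · intro k hk
    have : ¬j ≤ k := fun hjk => hk ⟨k - j, Nat.sub_add_cancel hjk⟩
    simp [shiftCLM_apply, this]

open scoped BoundedContinuousFunction in
/-- Left shift of a bounded sequence. -/
def unshift (m : ℕ) (w : ℕ →ᵇ ℝ) : ℕ →ᵇ ℝ :=
  BoundedContinuousFunction.ofNormedAddCommGroupDiscrete (fun k => w (k + m)) ‖w‖
    fun _ => w.norm_coe_le_norm _

open scoped BoundedContinuousFunction in
/-- The sequence `1, 0, 0, …`. -/
def oneSeq : ℕ →ᵇ ℝ :=
  BoundedContinuousFunction.ofNormedAddCommGroupDiscrete (fun k => if k = 0 then 1 else 0) 1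
    fun k => by split_ifs <;> simp

open scoped BoundedContinuousFunction in
theorem shiftCLM_oneSeq (j k : ℕ) : shiftCLM j oneSeq k = if k = j then 1 else 0 := by
  rw [shiftCLM_apply]
  change (if j ≤ k then (if k - j = 0 then (1 : ℝ) else 0) else 0) = _
  split_ifs <;> first | rfl | omega

open scoped BoundedContinuousFunction in
/-- The product of a monic polynomial of degree `m` with a unit, on coefficient sequences. -/
def prodMap (m : ℕ) (z : (Fin m → ℝ) × (ℕ →ᵇ ℝ)) : ℕ →ᵇ ℝ :=
  shiftCLM m z.2 + ∑ j : Fin m, z.1 j • shiftCLM j z.2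

open scoped BoundedContinuousFunction in
theorem analyticAt_prodMap (m : ℕ) (z : (Fin m → ℝ) × (ℕ →ᵇ ℝ)) :
    AnalyticAt ℝ (prodMap m) z := by
  have h2 : ∀ j, AnalyticAt ℝ (fun z : (Fin m → ℝ) × (ℕ →ᵇ ℝ) => shiftCLM j z.2) z := fun j =>
    ((shiftCLM j).comp (ContinuousLinearMap.snd ℝ _ _)).analyticAt z
  have h1 : ∀ j : Fin m, AnalyticAt ℝ (fun z : (Fin m → ℝ) × (ℕ →ᵇ ℝ) => z.1 j) z := fun j =>
    ((ContinuousLinearMap.proj (R := ℝ) (φ := fun _ : Fin m => ℝ) j).comp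
      (ContinuousLinearMap.fst ℝ (Fin m → ℝ) (ℕ →ᵇ ℝ))).analyticAt z
  exact (h2 m).add (Finset.analyticAt_fun_sum _ fun j _ => (h1 j).smul (h2 j))

open scoped BoundedContinuousFunction in
/-- The derivative of `prodMap` at `(0, 1)`. -/
def prodDeriv (m : ℕ) : ((Fin m → ℝ) × (ℕ →ᵇ ℝ)) →L[ℝ] (ℕ →ᵇ ℝ) :=
  (shiftCLM m).comp (ContinuousLinearMap.snd ℝ _ _) +
    ∑ j : Fin m, ((ContinuousLinearMap.proj (R := ℝ) (φ := fun _ : Fin m => ℝ) j).comp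
      (ContinuousLinearMap.fst ℝ (Fin m → ℝ) (ℕ →ᵇ ℝ))).smulRight (shiftCLM j oneSeq)

open scoped BoundedContinuousFunction in
theorem hasFDerivAt_prodMap (m : ℕ) :
    HasFDerivAt (prodMap m) (prodDeriv m) ((0 : Fin m → ℝ), oneSeq) := by
  have h2 : ∀ j, HasFDerivAt (fun z : (Fin m → ℝ) × (ℕ →ᵇ ℝ) => shiftCLM j z.2)
      ((shiftCLM j).comp (ContinuousLinearMap.snd ℝ _ _)) ((0 : Fin m → ℝ), oneSeq) := fun j =>
    ((shiftCLM j).comp (ContinuousLinearMap.snd ℝ (Fin m → ℝ) (ℕ →ᵇ ℝ))).hasFDerivAt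
  have h1 : ∀ j : Fin m, HasFDerivAt (fun z : (Fin m → ℝ) × (ℕ →ᵇ ℝ) => z.1 j)
      ((ContinuousLinearMap.proj (R := ℝ) (φ := fun _ : Fin m => ℝ) j).comp
      (ContinuousLinearMap.fst ℝ (Fin m → ℝ) (ℕ →ᵇ ℝ))) ((0 : Fin m → ℝ), oneSeq) := fun j =>
    ((ContinuousLinearMap.proj (R := ℝ) (φ := fun _ : Fin m => ℝ) j).comp
      (ContinuousLinearMap.fst ℝ (Fin m → ℝ) (ℕ →ᵇ ℝ))).hasFDerivAt
  have := (h2 m).add (HasFDerivAt.fun_sum fun (j : Fin m) (_ : j ∈ Finset.univ) =>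
    (h1 j).smul (h2 j))
  refine this.congr_fderiv ?_
  simp [prodDeriv]

open scoped BoundedContinuousFunction in
theorem prodDeriv_apply (m : ℕ) (z : (Fin m → ℝ) × (ℕ →ᵇ ℝ)) (k : ℕ) :
    prodDeriv m z k = if h : k < m then z.1 ⟨k, h⟩ else z.2 (k - m) := by
  have : prodDeriv m z = shiftCLM m z.2 + ∑ j : Fin m, z.1 j • shiftCLM j oneSeq := by
    simp [prodDeriv]
  rw [this, BoundedContinuousFunction.add_apply, BoundedContinuousFunction.sum_apply]
  simp only [BoundedContinuousFunction.smul_apply, shiftCLM_oneSeq, smul_eq_mul, mul_ite, mul_one,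
    mul_zero]
  rw [shiftCLM_apply]
  split_ifs with h1 h2 h2
  · omega
  · rw [Finset.sum_eq_zero, add_zero]
    intro j _
    rw [if_neg]; have := j.2; omega
  · rw [zero_add, Finset.sum_eq_single ⟨k, h2⟩]
    · simp
    · intro j _ hj
      rw [if_neg]; rintro rfl; exact hj rfl
    · simp
  · omega

open scoped BoundedContinuousFunction in
theorem exists_prodDeriv_equiv (m : ℕ) :
    ∃ e : ((Fin m → ℝ) × (ℕ →ᵇ ℝ)) ≃L[ℝ] (ℕ →ᵇ ℝ), (e : _ →L[ℝ] _) = prodDeriv m := by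
  refine ⟨ContinuousLinearEquiv.ofBijective (prodDeriv m) ?_ ?_, ?_⟩
  · refine LinearMap.ker_eq_bot'.2 fun z hz => ?_
    have hk : ∀ k, prodDeriv m z k = 0 := fun k => by
      have := congrArg (fun w : ℕ →ᵇ ℝ => w k) hz
      simpa using this
    refine Prod.ext (funext fun j => ?_) (BoundedContinuousFunction.ext fun k => ?_)
    · have := hk j
      rw [prodDeriv_apply, dif_pos j.2] at this
      exact this
    · have := hk (k + m)
      rw [prodDeriv_apply, dif_neg (by omega), Nat.add_sub_cancel] at this
      exact this
  · refine LinearMap.range_eq_top.2 fun w => ⟨(fun j => w j, unshift m w), ?_⟩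
    refine BoundedContinuousFunction.ext fun k => ?_
    refine (prodDeriv_apply m _ k).trans ?_
    split_ifs with h
    · rfl
    · change w (k - m + m) = w k
      rw [Nat.sub_add_cancel (by omega)]
  · exact ContinuousLinearEquiv.coe_ofBijective _ _ _

open scoped BoundedContinuousFunction in
theorem hasSum_prodMap (m : ℕ) (z : (Fin m → ℝ) × (ℕ →ᵇ ℝ)) {t : ℝ} (ht : |t| < 1) :
    HasSum (fun k => prodMap m z k * t ^ k)
      ((t ^ m + ∑ j : Fin m, z.1 j * t ^ (j : ℕ)) * ∑' k, z.2 k * t ^ k) := by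
  have h := (hasSum_shiftCLM m z.2 ht).add (hasSum_sum fun (j : Fin m) (_ : j ∈ Finset.univ) =>
    (hasSum_shiftCLM j z.2 ht).mul_left (z.1 j))
  refine (congrArg₂ HasSum (funext fun k => ?_) ?_).mp h
  · rw [prodMap, BoundedContinuousFunction.add_apply, BoundedContinuousFunction.sum_apply, add_mul,
      Finset.sum_mul]
    simp [mul_assoc]
  · rw [add_mul, Finset.sum_mul]
    simp [mul_assoc]

open scoped BoundedContinuousFunction in
theorem tsum_ne_zero_of_near_oneSeq {u : ℕ →ᵇ ℝ} (hu : ‖u - oneSeq‖ < 1 / 4) {t : ℝ}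
    (ht : |t| < 1 / 2) : ∑' k, u k * t ^ k ≠ 0 := by
  have ht1 : |t| < 1 := by linarith
  have h1 : HasSum (fun k => oneSeq k * t ^ k) 1 := by
    have : (fun k => oneSeq k * t ^ k) = fun k => if k = 0 then 1 else 0 := by
      funext k
      change (if k = 0 then (1 : ℝ) else 0) * t ^ k = _
      split_ifs with h <;> simp [h]
    rw [this]
    exact hasSum_ite_eq 0 1
  have h2 := (summable_bcf_mul_pow u ht1).hasSum.sub h1
  have hg := (hasSum_geometric_of_lt_one (abs_nonneg t) ht1).mul_left (1 / 4)
  have h3 : ‖(∑' k, u k * t ^ k) - 1‖ ≤ 1 / 4 * (1 - |t|)⁻¹ := by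
    rw [← h2.tsum_eq]
    refine tsum_of_norm_bounded hg fun k => ?_
    rw [← sub_mul, norm_mul, norm_pow, Real.norm_eq_abs t]
    gcongr
    exact ((u - oneSeq).norm_coe_le_norm k).trans hu.le
  intro h0
  rw [h0] at h3
  have h4 : (1 - |t|)⁻¹ ≤ 2 := by
    rw [inv_le_comm₀ (by linarith) (by norm_num)]; linarith
  norm_num at h3
  linarith

/-- Coefficients of a convergent power series representing a monomial. -/
theorem coeff_eq_of_hasSum_monomial {c : ℕ → ℝ} {m : ℕ} {a : ℝ}
    (h : ∀ᶠ t : ℝ in 𝓝 0, HasSum (fun k => c k * t ^ k) (a * t ^ m)) (k : ℕ) :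
    c k = if k = m then a else 0 := by
  have h1 : HasFPowerSeriesAt (fun t : ℝ => a * t ^ m)
      (FormalMultilinearSeries.ofScalars ℝ c) 0 := by
    rw [hasFPowerSeriesAt_iff]
    filter_upwards [h] with t ht
    simpa [FormalMultilinearSeries.coeff_ofScalars, mul_comm] using ht
  have h2 : HasFPowerSeriesAt (fun t : ℝ => a * t ^ m)
      (FormalMultilinearSeries.ofScalars ℝ fun k => if k = m then a else 0) 0 := by
    rw [hasFPowerSeriesAt_iff]
    refine Eventually.of_forall fun t => ?_
    simp only [FormalMultilinearSeries.coeff_ofScalars, zero_add, smul_eq_mul]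
    have : (fun k => t ^ k * if k = m then a else 0) = fun k => if k = m then a * t ^ m else 0 := by
      funext k
      split_ifs with hk
      · rw [hk, mul_comm]
      · simp
    rw [this]
    exact hasSum_ite_eq m _
  have := congrArg (fun p => FormalMultilinearSeries.coeff p k) (h1.eq_formalMultilinearSeries h2)
  simpa [FormalMultilinearSeries.coeff_ofScalars] using this

open scoped BoundedContinuousFunction in
/-- Weierstrass preparation, at the level of zero sets. -/
theorem exists_weierstrass_polynomial {E : Type*} [NormedAddCommGroup E] [NormedSpace ℝ E]
    {f : E × ℝ → ℝ} (hf : AnalyticAt ℝ f 0) (hne : ¬∀ᶠ t : ℝ in 𝓝 0, f (0, t) = 0) :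
    ∃ (m : ℕ) (p : E → Fin m → ℝ), AnalyticAt ℝ p 0 ∧
      ∀ᶠ z in 𝓝 (0 : E × ℝ), f z = 0 ↔ z.2 ^ m + ∑ j : Fin m, p z.1 j * z.2 ^ (j : ℕ) = 0 := by
  have hι : AnalyticAt ℝ (fun t : ℝ => ((0 : E), t)) 0 :=
    (ContinuousLinearMap.inr ℝ E ℝ).analyticAt 0
  have hf0 : AnalyticAt ℝ (fun t : ℝ => f (0, t)) 0 :=
    AnalyticAt.fun_comp (f := fun t : ℝ => ((0 : E), t)) (g := f) (by exact hf) hι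
  obtain ⟨m, g, hg, hg0, hgf⟩ := hf0.exists_eventuallyEq_pow_smul_nonzero_iff.2 hne
  have hsnd : AnalyticAt ℝ (fun z : E × ℝ => z.2) 0 :=
    (ContinuousLinearMap.snd ℝ E ℝ).analyticAt 0
  have hgs : AnalyticAt ℝ (fun z : E × ℝ => g z.2) 0 :=
    AnalyticAt.fun_comp (f := fun z : E × ℝ => z.2) (g := g) hg hsnd
  have hf1 : AnalyticAt ℝ (fun z : E × ℝ => f z / g z.2) 0 := hf.div hgs hg0
  obtain ⟨ρ, hρ, F, hF, hFs⟩ := exists_analyticAt_coeff hf1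
  have hF0 : ∀ k, F 0 k = if k = m then ρ ^ m else 0 := by
    refine coeff_eq_of_hasSum_monomial ?_
    have h1 : ∀ᶠ t : ℝ in 𝓝 0, |t| < 1 := by
      have := Metric.ball_mem_nhds (0 : ℝ) one_pos
      filter_upwards [this] with t ht using by simpa using ht
    have h2 : Tendsto (fun t : ℝ => ρ * t) (𝓝 0) (𝓝 0) := by
      have : Continuous fun t : ℝ => ρ * t := by fun_prop
      simpa using this.tendsto 0
    have h3 := hg.continuousAt.eventually_ne hg0
    filter_upwards [h1, h2.eventually hgf, h2.eventually h3] with t ht1 ht2 ht3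
    have h4 := hFs.self_of_nhds t ht1
    simp only at h4
    rw [ht2] at h4
    simpa [ht3, mul_pow] using h4
  let G : E → (ℕ →ᵇ ℝ) := fun x => (ρ ^ m)⁻¹ • F x
  have hG : AnalyticAt ℝ G 0 := hF.fun_const_smul
  have hG0 : G 0 = prodMap m ((0 : Fin m → ℝ), oneSeq) := by
    ext k
    have : prodMap m ((0 : Fin m → ℝ), oneSeq) = shiftCLM m oneSeq := by
      simp [prodMap]
    rw [this, shiftCLM_oneSeq]
    simp only [G, BoundedContinuousFunction.smul_apply, hF0, smul_eq_mul]
    split_ifs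
    · field_simp
    · simp
  obtain ⟨e, he⟩ := exists_prodDeriv_equiv m
  obtain ⟨h, hh, hh0, hhr, -⟩ := (analyticAt_prodMap m ((0 : Fin m → ℝ), oneSeq)).exists_local_inverse
    e (by rw [he]; exact hasFDerivAt_prodMap m)
  rw [← hG0] at hh hh0 hhr
  have hhG : AnalyticAt ℝ (fun x => h (G x)) 0 := hh.comp hG
  have hp : AnalyticAt ℝ (fun x => (h (G x)).1) 0 :=
    ((ContinuousLinearMap.fst ℝ (Fin m → ℝ) (ℕ →ᵇ ℝ)).analyticAt _).comp hhG
  have hu : ContinuousAt (fun x => (h (G x)).2) 0 := continuous_snd.continuousAt.comp hhG.continuousAt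
  have hu0 : ∀ᶠ x in 𝓝 (0 : E), ‖(h (G x)).2 - oneSeq‖ < 1 / 4 := by
    have : (h (G 0)).2 = oneSeq := by rw [hh0]
    have h1 := hu.eventually (Metric.ball_mem_nhds _ (by norm_num : (0 : ℝ) < 1 / 4))
    filter_upwards [h1] with x hx
    rw [this] at hx
    simpa [dist_eq_norm] using hx
  refine ⟨m, fun x j => ρ ^ (m - j : ℕ) * (h (G x)).1 j, ?_, ?_⟩
  · rw [analyticAt_pi_iff]
    intro j
    have := analyticAt_pi_iff.1 hp j
    exact analyticAt_const.mul this
  have hfst : Tendsto (fun z : E × ℝ => z.1) (𝓝 0) (𝓝 0) := continuous_fst.tendsto 0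
  have hsd : Tendsto (fun z : E × ℝ => z.2) (𝓝 0) (𝓝 0) := continuous_snd.tendsto 0
  filter_upwards [hfst.eventually hFs, hfst.eventually hu0,
    hfst.eventually (hG.continuousAt.eventually hhr),
    hsd.eventually (Metric.ball_mem_nhds (0 : ℝ) (by positivity : 0 < ρ / 2)),
    hsd.eventually (hg.continuousAt.eventually_ne hg0)] with z hz1 hz2 hz3 hz4 hz5
  obtain ⟨x, s⟩ := z
  simp only at hz1 hz2 hz3 hz4 hz5 ⊢
  have hs : |s| < ρ / 2 := by simpa using hz4
  have ht : |s / ρ| < 1 / 2 := by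
    rw [abs_div, abs_of_pos hρ, div_lt_iff₀ hρ]; linarith
  have h1 := hz1 (s / ρ) (by linarith)
  rw [mul_div_cancel₀ s hρ.ne'] at h1
  have h2 := hasSum_prodMap m (h (G x)) (t := s / ρ) (by linarith)
  rw [hz3] at h2
  have h3 : HasSum (fun k => G x k * (s / ρ) ^ k) ((ρ ^ m)⁻¹ * (f (x, s) / g s)) := by
    refine (congrArg (fun u => HasSum u _) (funext fun k => ?_)).mp (h1.mul_left (ρ ^ m)⁻¹)
    simp [G, mul_assoc]
  have h4 := h2.unique h3
  have h5 := tsum_ne_zero_of_near_oneSeq hz2 ht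
  have h6 : f (x, s) = 0 ↔ (s / ρ) ^ m + ∑ j : Fin m, (h (G x)).1 j * (s / ρ) ^ (j : ℕ) = 0 := by
    constructor
    · intro h0
      rw [h0] at h4
      simpa [h5] using h4
    · intro h0
      rw [h0, zero_mul] at h4
      have := h4.symm
      simpa [hρ.ne', hz5] using this
  rw [h6]
  have h7 : s ^ m + ∑ j : Fin m, ρ ^ (m - j : ℕ) * (h (G x)).1 j * s ^ (j : ℕ) =
      ρ ^ m * ((s / ρ) ^ m + ∑ j : Fin m, (h (G x)).1 j * (s / ρ) ^ (j : ℕ)) := by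
    rw [mul_add, Finset.mul_sum]
    congr 1
    · rw [div_pow, mul_div_cancel₀ _ (by positivity)]
    · refine Finset.sum_congr rfl fun j _ => ?_
      have : ρ ^ m = ρ ^ (m - j : ℕ) * ρ ^ (j : ℕ) := by
        rw [← pow_add, Nat.sub_add_cancel j.2.le]
      rw [this, div_pow]
      field_simp
  rw [h7, mul_eq_zero, or_iff_right (by positivity)]

/-- The analytic implicit function theorem for a scalar equation in the last variable. -/
theorem AnalyticAt.exists_implicit {E : Type*} [NormedAddCommGroup E] [NormedSpace ℝ E]
    [CompleteSpace E] {h : E × ℝ → ℝ} {y₀ : E} {t₀ : ℝ} (hh : AnalyticAt ℝ h (y₀, t₀))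
    (h0 : h (y₀, t₀) = 0) (hd : fderiv ℝ h (y₀, t₀) (0, 1) ≠ 0) :
    ∃ τ : E → ℝ, AnalyticAt ℝ τ y₀ ∧ τ y₀ = t₀ ∧ (∀ᶠ y in 𝓝 y₀, h (y, τ y) = 0) ∧
      ∀ᶠ z in 𝓝 (y₀, t₀), h z = 0 → z.2 = τ z.1 := by
  set D := fderiv ℝ h (y₀, t₀) with hD
  set c := D (0, 1) with hc
  have hDd : ∀ u : E, ∀ s : ℝ, D (u, s) = D (u, 0) + s * c := fun u s => by
    have : ((u, s) : E × ℝ) = (u, 0) + s • ((0 : E), (1 : ℝ)) := by simp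
    rw [this, map_add, map_smul, smul_eq_mul]
  let e : (E × ℝ) ≃L[ℝ] (E × ℝ) := ContinuousLinearEquiv.equivOfInverse
    ((ContinuousLinearMap.fst ℝ E ℝ).prod D)
    ((ContinuousLinearMap.fst ℝ E ℝ).prod (c⁻¹ • (ContinuousLinearMap.snd ℝ E ℝ -
      D.comp ((ContinuousLinearMap.inl ℝ E ℝ).comp (ContinuousLinearMap.fst ℝ E ℝ)))))
    (fun z => by
      obtain ⟨u, s⟩ := z
      simp [hDd u s]
      field_simp)
    (fun z => by
      obtain ⟨u, s⟩ := z
      simp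
      rw [hDd]
      field_simp
      ring)
  have hH : AnalyticAt ℝ (fun z : E × ℝ => (z.1, h z)) (y₀, t₀) := analyticAt_fst.prod hh
  obtain ⟨g, hg, hg0, hgr, hgl⟩ := hH.exists_local_inverse e
    (hasFDerivAt_fst.prodMk hh.differentiableAt.hasFDerivAt)
  simp only [h0] at hg hg0 hgr
  have hin : AnalyticAt ℝ (fun y : E => (y, (0 : ℝ))) y₀ := analyticAt_id.prod analyticAt_const
  refine ⟨fun y => (g (y, 0)).2, ?_, by simp [hg0], ?_, ?_⟩
  · exact analyticAt_snd.fun_comp (hg.comp_of_eq hin rfl)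
  · have := hin.continuousAt.eventually hgr
    filter_upwards [this] with y hy
    have h1 := congrArg Prod.fst hy
    have h2 := congrArg Prod.snd hy
    simp only at h1 h2
    have h3 : (y, (g (y, 0)).2) = g (y, 0) := Prod.ext h1.symm rfl
    rw [h3, h2]
  · filter_upwards [hgl] with z hz hz0
    simp only [hz0] at hz
    rw [hz]

open Polynomial in
/-- Evaluation of a polynomial family with analytic coefficients is jointly analytic. -/
theorem analyticAt_eval_family {E : Type*} [NormedAddCommGroup E] [NormedSpace ℝ E]
    {A : E → ℝ[X]} {N : ℕ} (hN : ∀ y, (A y).natDegree ≤ N) {y₀ : E}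
    (hA : ∀ i, AnalyticAt ℝ (fun y => (A y).coeff i) y₀) (t₀ : ℝ) :
    AnalyticAt ℝ (fun z : E × ℝ => (A z.1).eval z.2) (y₀, t₀) := by
  have : (fun z : E × ℝ => (A z.1).eval z.2) =
      fun z => ∑ i ∈ Finset.range (N + 1), (A z.1).coeff i * z.2 ^ i := by
    funext z
    exact eval_eq_sum_range' (Nat.lt_succ_of_le (hN _)) _
  rw [this]
  refine Finset.analyticAt_fun_sum _ fun i _ => ?_
  exact ((hA i).fun_comp_of_eq analyticAt_fst rfl).mul (analyticAt_snd.pow i)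

open Polynomial in
theorem abs_root_le {P : ℝ[X]} {N : ℕ} (hP : P.Monic) (hN : P.natDegree = N) {t : ℝ}
    (ht : P.eval t = 0) : |t| ≤ 1 + ∑ i ∈ Finset.range N, |P.coeff i| := by
  by_contra! hlt
  have hs : 0 ≤ ∑ i ∈ Finset.range N, |P.coeff i| := Finset.sum_nonneg fun _ _ => abs_nonneg _
  have h1 : 1 < |t| := by linarith
  have h2 : P.eval t = t ^ N + ∑ i ∈ Finset.range N, P.coeff i * t ^ i := by
    rw [eval_eq_sum_range, hN, Finset.sum_range_succ, ← hN, hP.coeff_natDegree, hN]; ring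
  rw [h2] at ht
  rcases N with _ | n
  · simp at ht
  have h3 : |t| ^ (n + 1) ≤ (∑ i ∈ Finset.range (n + 1), |P.coeff i|) * |t| ^ n := by
    rw [← abs_pow, eq_neg_of_add_eq_zero_left ht, abs_neg]
    refine (Finset.abs_sum_le_sum_abs _ _).trans ?_
    rw [Finset.sum_mul]
    refine Finset.sum_le_sum fun i hi => ?_
    rw [abs_mul, abs_pow]
    gcongr
    · exact h1.le
    · exact Nat.lt_succ_iff.1 (Finset.mem_range.1 hi)
  rw [pow_succ'] at h3
  have := le_of_mul_le_mul_right h3 (by positivity)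
  linarith

open Polynomial in
/-- The real roots of a monic family with simple real roots are locally analytic graphs. -/
theorem exists_local_roots {E : Type*} [NormedAddCommGroup E] [NormedSpace ℝ E]
    [CompleteSpace E] {A : E → ℝ[X]} {N : ℕ} (hmon : ∀ y, (A y).Monic)
    (hN : ∀ y, (A y).natDegree = N) (y₀ : E)
    (hA : ∀ i, AnalyticAt ℝ (fun y => (A y).coeff i) y₀)
    (hsimple : ∀ t, (A y₀).eval t = 0 → (A y₀).derivative.eval t ≠ 0) :
    ∃ τ : ℝ → E → ℝ, (∀ r ∈ (A y₀).roots.toFinset, AnalyticAt ℝ (τ r) y₀ ∧ τ r y₀ = r) ∧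
      ∀ᶠ y in 𝓝 y₀, (∀ r ∈ (A y₀).roots.toFinset, (A y).eval (τ r y) = 0) ∧
        (∀ t, (A y).eval t = 0 → ∃ r ∈ (A y₀).roots.toFinset, t = τ r y) ∧
        ∀ r ∈ (A y₀).roots.toFinset, ∀ r' ∈ (A y₀).roots.toFinset, r < r' → τ r y < τ r' y := by
  set S := (A y₀).roots.toFinset with hS
  have hmem : ∀ t, t ∈ S ↔ (A y₀).eval t = 0 := fun t => by
    rw [hS, Multiset.mem_toFinset, mem_roots (hmon y₀).ne_zero, IsRoot.def]
  let h : E × ℝ → ℝ := fun z => (A z.1).eval z.2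
  have hh : ∀ t, AnalyticAt ℝ h (y₀, t) := fun t =>
    analyticAt_eval_family (fun y => (hN y).le) hA t
  have hfd : ∀ t, fderiv ℝ h (y₀, t) (0, 1) = (A y₀).derivative.eval t := fun t => by
    have h1 : HasDerivAt (fun s : ℝ => (y₀, s)) ((0 : E), (1 : ℝ)) t :=
      (hasDerivAt_const t y₀).prodMk (hasDerivAt_id t)
    have h2 := (hh t).differentiableAt.hasFDerivAt.comp_hasDerivAt t h1
    exact h2.unique ((A y₀).hasDerivAt t)
  have hex : ∀ r, ∃ τ : E → ℝ, r ∈ S → AnalyticAt ℝ τ y₀ ∧ τ y₀ = r ∧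
      (∀ᶠ y in 𝓝 y₀, h (y, τ y) = 0) ∧ ∀ᶠ z in 𝓝 (y₀, r), h z = 0 → z.2 = τ z.1 := fun r => by
    by_cases hr : r ∈ S
    · have h0 := (hmem r).1 hr
      obtain ⟨τ, hτ⟩ := (hh r).exists_implicit h0 (by rw [hfd]; exact hsimple r h0)
      exact ⟨τ, fun _ => hτ⟩
    · exact ⟨0, fun h => absurd h hr⟩
  choose τ hτ using hex
  refine ⟨τ, fun r hr => ⟨(hτ r hr).1, (hτ r hr).2.1⟩, ?_⟩
  refine Eventually.and ?_ (Eventually.and ?_ ?_)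
  · exact (Filter.eventually_all_finset S).2 fun r hr => (hτ r hr).2.2.1
  · let B : E → ℝ := fun y => 1 + ∑ i ∈ Finset.range N, |(A y).coeff i|
    have hB : ContinuousAt B y₀ := by
      refine continuousAt_const.add (tendsto_finsetSum _ fun i _ => ?_)
      exact (hA i).continuousAt.abs
    have hB1 : ∀ᶠ y in 𝓝 y₀, B y < B y₀ + 1 := hB.eventually_lt_const (by linarith)
    have hK : ∀ᶠ y in 𝓝 y₀, ∀ t ∈ Icc (-(B y₀ + 1)) (B y₀ + 1),
        (A y).eval t = 0 → ∃ r ∈ S, t = τ r y := by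
      refine isCompact_Icc.eventually_forall_of_forall_eventually fun t _ => ?_
      by_cases ht : t ∈ S
      · filter_upwards [(hτ t ht).2.2.2] with z hz h0
        exact ⟨t, ht, hz h0⟩
      · have : h (y₀, t) ≠ 0 := fun h0 => ht ((hmem t).2 h0)
        filter_upwards [(hh t).continuousAt.eventually_ne this] with z hz h0
        exact absurd h0 hz
    filter_upwards [hK, hB1] with y hy hyB t ht
    have := abs_root_le (hmon y) (hN y) ht
    exact hy t (abs_le.1 (this.trans (by simp only [B] at hyB ⊢; linarith))) ht
  · refine (Filter.eventually_all_finset S).2 fun r hr => ?_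
    refine (Filter.eventually_all_finset S).2 fun r' hr' => ?_
    by_cases hlt : r < r'
    · have := (hτ r hr).1.continuousAt.eventually_lt (hτ r' hr').1.continuousAt
        (by rw [(hτ r hr).2.1, (hτ r' hr').2.1]; exact hlt)
      filter_upwards [this] with y hy _ using hy
    · exact Eventually.of_forall fun _ h => absurd h hlt

open Polynomial in
/-- The real roots of a monic family with simple real roots over a vector space are globally
ordered analytic functions. -/
theorem exists_ordered_roots_of_simple {E : Type*} [NormedAddCommGroup E] [NormedSpace ℝ E]
    [CompleteSpace E] {A : E → ℝ[X]} {N : ℕ} (hmon : ∀ y, (A y).Monic)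
    (hN : ∀ y, (A y).natDegree = N)
    (hA : ∀ i, AnalyticOnNhd ℝ (fun y => (A y).coeff i) univ)
    (hsimple : ∀ y t, (A y).eval t = 0 → (A y).derivative.eval t ≠ 0) :
    ∃ (M : ℕ) (ξ : Fin M → E → ℝ), (∀ j, AnalyticOnNhd ℝ (ξ j) univ) ∧
      (∀ y, StrictMono fun j => ξ j y) ∧ ∀ y t, (A y).eval t = 0 ↔ ∃ j, ξ j y = t := by
  let Z : E → Finset ℝ := fun y => (A y).roots.toFinset
  have hmem : ∀ y t, t ∈ Z y ↔ (A y).eval t = 0 := fun y t => by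
    rw [Multiset.mem_toFinset, mem_roots (hmon y).ne_zero, IsRoot.def]
  have hloc : ∀ y₀, ∃ τ : ℝ → E → ℝ, (∀ r ∈ Z y₀, AnalyticAt ℝ (τ r) y₀ ∧ τ r y₀ = r) ∧
      ∀ᶠ y in 𝓝 y₀, Z y = (Z y₀).image (fun r => τ r y) ∧ StrictMonoOn (fun r => τ r y) (Z y₀) := by
    intro y₀
    obtain ⟨τ, h1, h2⟩ := exists_local_roots hmon hN y₀ (fun i => hA i y₀ trivial) (hsimple y₀)
    refine ⟨τ, h1, h2.mono fun y hy => ⟨?_, fun r hr r' hr' => hy.2.2 r hr r' hr'⟩⟩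
    ext t
    rw [hmem, Finset.mem_image]
    constructor
    · intro ht
      obtain ⟨r, hr, rfl⟩ := hy.2.1 t ht
      exact ⟨r, hr, rfl⟩
    · rintro ⟨r, hr, rfl⟩
      exact hy.1 r hr
  have hcard : ∀ y, (Z y).card = (Z 0).card := by
    have : IsLocallyConstant fun y => (Z y).card := by
      rw [IsLocallyConstant.iff_eventually_eq]
      intro y₀
      obtain ⟨τ, -, h2⟩ := hloc y₀
      filter_upwards [h2] with y hy
      rw [hy.1, Finset.card_image_of_injOn hy.2.injOn]
    exact fun y => this.apply_eq_of_isPreconnected isPreconnected_univ trivial trivial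
  refine ⟨(Z 0).card, fun j y => (Z y).orderEmbOfFin (hcard y) j, fun j y₀ _ => ?_,
    fun y => ((Z y).orderEmbOfFin (hcard y)).strictMono, fun y t => ?_⟩
  · obtain ⟨τ, h1, h2⟩ := hloc y₀
    refine (h1 _ ((Z y₀).orderEmbOfFin_mem (hcard y₀) j)).1.congr ?_
    filter_upwards [h2] with y hy
    have := Finset.orderEmbOfFin_unique (s := Z y) (hcard y)
      (f := fun j => τ ((Z y₀).orderEmbOfFin (hcard y₀) j) y) (fun i => by
        rw [hy.1]
        exact Finset.mem_image_of_mem _ ((Z y₀).orderEmbOfFin_mem (hcard y₀) i))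
      (fun i k hik => hy.2 ((Z y₀).orderEmbOfFin_mem (hcard y₀) i)
        ((Z y₀).orderEmbOfFin_mem (hcard y₀) k) (((Z y₀).orderEmbOfFin (hcard y₀)).strictMono hik))
    exact congrFun this j
  · rw [← hmem, ← Finset.mem_coe, ← Finset.range_orderEmbOfFin (Z y) (hcard y)]
    rfl

/-- A continuous selection of values of an ordered family of continuous functions is a member. -/
theorem exists_eq_of_forall_exists_eq {E ι : Type*} [TopologicalSpace E] [PreconnectedSpace E]
    [Nonempty E] [Finite ι] {ξ : ι → E → ℝ} (hξ : ∀ j, Continuous (ξ j))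
    (hinj : ∀ y, Function.Injective fun j => ξ j y) {η : E → ℝ} (hη : Continuous η)
    (h : ∀ y, ∃ j, η y = ξ j y) : ∃ j, ∀ y, η y = ξ j y := by
  obtain ⟨y₀⟩ := ‹Nonempty E›
  obtain ⟨j, hj⟩ := h y₀
  have hcl : ∀ i, IsClosed {y | η y = ξ i y} := fun i => isClosed_eq hη (hξ i)
  have hop : IsOpen {y | η y = ξ j y} := by
    have : {y | η y = ξ j y} = (⋃ i ∈ {i | i ≠ j}, {y | η y = ξ i y})ᶜ := by
      ext y
      simp only [mem_ofPred_eq, mem_compl_iff, mem_iUnion, not_exists]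
      constructor
      · intro hy i hi hi'
        exact hi (hinj y (hi'.symm.trans hy))
      · intro hy
        obtain ⟨i, hi⟩ := h y
        by_cases hij : i = j
        · rwa [hij] at hi
        · exact absurd hi (hy i hij)
    rw [this, isOpen_compl_iff]
    exact (Set.toFinite _).isClosed_biUnion fun i _ => hcl i
  have := IsClopen.eq_univ ⟨hcl j, hop⟩ ⟨y₀, hj⟩
  exact ⟨j, fun y => (this ▸ mem_univ y : y ∈ {y | η y = ξ j y})⟩

open Polynomial in
/-- The polynomial of degree less than `k` with given coefficients. -/
def polyOf {k : ℕ} (a : Fin k → ℝ) : ℝ[X] := ∑ j, C (a j) * X ^ (j : ℕ)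

open Polynomial in
theorem coeff_polyOf {k : ℕ} (a : Fin k → ℝ) (j : Fin k) : (polyOf a).coeff j = a j := by
  rw [polyOf, finsetSum_coeff, Finset.sum_eq_single j]
  · simp
  · intro i _ hi
    rw [coeff_C_mul_X_pow, if_neg]
    exact fun h => hi (Fin.ext h.symm)
  · simp

open Polynomial in
theorem degree_polyOf_lt {k : ℕ} (a : Fin k → ℝ) : (polyOf a).degree < k := by
  rw [← mem_degreeLT]
  refine Submodule.sum_mem _ fun j _ => ?_
  rw [mem_degreeLT]
  exact (degree_C_mul_X_pow_le _ _).trans_lt (by exact_mod_cast j.2)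

open Polynomial in
theorem polyOf_coeff {k : ℕ} {p : ℝ[X]} (hp : p.degree < k) :
    polyOf (fun j : Fin k => p.coeff j) = p := by
  ext n
  by_cases h : n < k
  · exact coeff_polyOf (fun j : Fin k => p.coeff j) ⟨n, h⟩
  · have hk : (k : WithBot ℕ) ≤ n := by exact_mod_cast not_lt.1 h
    rw [coeff_eq_zero_of_degree_lt ((degree_polyOf_lt _).trans_le hk),
      coeff_eq_zero_of_degree_lt (hp.trans_le hk)]

open Polynomial in
/-- The matrix of `(a, b) ↦ a P' + b P` on pairs of polynomials of degree less than `k`. -/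
def sylv (L k : ℕ) (P : ℝ[X]) : Matrix (Fin L) (Fin k ⊕ Fin k) ℝ := fun i c =>
  Sum.elim (fun j => (X ^ (j : ℕ) * derivative P).coeff i)
    (fun j => (X ^ (j : ℕ) * P).coeff i) c

open Polynomial in
theorem sylv_mulVec (L k : ℕ) (P : ℝ[X]) (v : Fin k ⊕ Fin k → ℝ) (i : Fin L) :
    (sylv L k P).mulVec v i =
      (polyOf (v ∘ Sum.inl) * derivative P + polyOf (v ∘ Sum.inr) * P).coeff i := by
  simp only [Matrix.mulVec, dotProduct, Fintype.sum_sum_type, sylv, Sum.elim_inl, Sum.elim_inr,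
    polyOf, Finset.sum_mul, coeff_add, finsetSum_coeff, mul_assoc, coeff_C_mul,
    Function.comp_apply]
  simp only [mul_comm]

open Polynomial in
/-- The Gram determinant of `sylv`. -/
def sylvDet (L k : ℕ) (P : ℝ[X]) : ℝ := ((sylv L k P).transpose * sylv L k P).det

open Polynomial in
theorem sylvDet_ne_zero_iff {L k : ℕ} {P : ℝ[X]} (hL : k + P.natDegree ≤ L) :
    sylvDet L k P ≠ 0 ↔ ∀ a b : ℝ[X], a.degree < k → b.degree < k →
      a * derivative P + b * P = 0 → a = 0 ∧ b = 0 := by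
  have hG : sylvDet L k P ≠ 0 ↔ ∀ v, (sylv L k P).mulVec v = 0 → v = 0 := by
    rw [sylvDet, ne_eq, ← Matrix.exists_mulVec_eq_zero_iff]
    push Not
    constructor
    · intro h v hv
      by_contra hv0
      exact h v hv0 (by rw [← Matrix.mulVec_mulVec, hv, Matrix.mulVec_zero])
    · intro h v hv0 hv
      refine hv0 (h v ?_)
      have := Matrix.ker_mulVecLin_transpose_mul_self (sylv L k P)
      have h1 : v ∈ ((sylv L k P).transpose * sylv L k P).mulVecLin.ker := hv
      rw [this] at h1
      exact h1
  have hdeg : ∀ a b : ℝ[X], a.degree < k → b.degree < k →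
      (a * derivative P + b * P).degree < L := by
    intro a b ha hb
    have key : ∀ c q : ℝ[X], c.degree < k → q.degree ≤ P.natDegree → (c * q).degree < L := by
      intro c q hc hq
      rw [degree_mul]
      by_cases hc0 : c = 0
      · simp only [hc0, degree_zero, WithBot.bot_add]; exact WithBot.bot_lt_coe _
      · by_cases hq0 : q = 0
        · simp only [hq0, degree_zero, WithBot.add_bot]; exact WithBot.bot_lt_coe _
        · rw [degree_eq_natDegree hc0] at hc ⊢
          rw [degree_eq_natDegree hq0] at hq ⊢
          have h1 : c.natDegree < k := by exact_mod_cast hc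
          have h2 : q.natDegree ≤ P.natDegree := by exact_mod_cast hq
          have : c.natDegree + q.natDegree < L := by omega
          exact_mod_cast this
    refine (degree_add_le _ _).trans_lt (max_lt (key a _ ha ?_) (key b _ hb degree_le_natDegree))
    exact (degree_derivative_le).trans degree_le_natDegree
  rw [hG]
  constructor
  · intro h a b ha hb hab
    have := h (Sum.elim (fun j => a.coeff j) (fun j => b.coeff j)) (by
      funext i
      rw [sylv_mulVec]
      have h1 : (Sum.elim (fun j : Fin k => a.coeff j) (fun j : Fin k => b.coeff j)) ∘ Sum.inl =
        fun j : Fin k => a.coeff j := rfl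
      have h2 : (Sum.elim (fun j : Fin k => a.coeff j) (fun j : Fin k => b.coeff j)) ∘ Sum.inr =
        fun j : Fin k => b.coeff j := rfl
      rw [h1, h2, polyOf_coeff ha, polyOf_coeff hb, hab]
      simp)
    rw [← polyOf_coeff ha, ← polyOf_coeff hb]
    have h1 : (fun j : Fin k => a.coeff j) = 0 := funext fun j => congrFun this (Sum.inl j)
    have h2 : (fun j : Fin k => b.coeff j) = 0 := funext fun j => congrFun this (Sum.inr j)
    rw [h1, h2]
    simp [polyOf]
  · intro h v hv
    have h0 : polyOf (v ∘ Sum.inl) * derivative P + polyOf (v ∘ Sum.inr) * P = 0 := by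
      have hd := hdeg _ _ (degree_polyOf_lt (v ∘ Sum.inl)) (degree_polyOf_lt (v ∘ Sum.inr))
      rw [← polyOf_coeff hd]
      have : (fun j : Fin L => (polyOf (v ∘ Sum.inl) * derivative P +
          polyOf (v ∘ Sum.inr) * P).coeff j) = 0 := by
        funext i
        rw [← sylv_mulVec, hv]
      rw [this]
      simp [polyOf]
    obtain ⟨h1, h2⟩ := h _ _ (degree_polyOf_lt _) (degree_polyOf_lt _) h0
    funext c
    rcases c with j | j
    · have := coeff_polyOf (v ∘ Sum.inl) j
      rw [h1] at this
      simpa using this.symm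
    · have := coeff_polyOf (v ∘ Sum.inr) j
      rw [h2] at this
      simpa using this.symm

open Polynomial in
/-- The squarefree part of a monic real polynomial. -/
theorem exists_reduced {P : ℝ[X]} (hP : P.Monic) {L : ℕ} (hL : 2 * P.natDegree + 1 ≤ L) :
    ∃ A R : ℝ[X], A.Monic ∧ A.natDegree ≤ P.natDegree ∧ R.degree < A.natDegree ∧
      A * derivative P = R * P ∧
      (∀ k ≤ P.natDegree + 1, sylvDet L k P ≠ 0 ↔ k ≤ A.natDegree) ∧
      (∀ t, A.eval t = 0 ↔ P.eval t = 0) ∧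
      ∀ t, A.eval t = 0 → (derivative A).eval t ≠ 0 := by
  have hP0 : P ≠ 0 := hP.ne_zero
  set D₀ := EuclideanDomain.gcd P (derivative P) with hD₀
  have hD₀0 : D₀ ≠ 0 := fun h => hP0 (EuclideanDomain.gcd_eq_zero_iff.1 h).1
  set D := normalize D₀ with hD
  have hDmon : D.Monic := monic_normalize hD₀0
  have hDP : D ∣ P := (normalize_dvd_iff).2 (EuclideanDomain.gcd_dvd_left _ _)
  have hDP' : D ∣ derivative P := (normalize_dvd_iff).2 (EuclideanDomain.gcd_dvd_right _ _)
  obtain ⟨A, hA⟩ := hDP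
  obtain ⟨R, hR⟩ := hDP'
  have hAmon : A.Monic := hDmon.of_mul_monic_left (hA ▸ hP)
  have hco : IsCoprime A R := by
    have hb := EuclideanDomain.gcd_eq_gcd_ab P (derivative P)
    have hdd : D ∣ D₀ := normalize_dvd_iff.2 dvd_rfl
    have hdd' : D₀ ∣ D := dvd_normalize_iff.2 dvd_rfl
    obtain ⟨u, hu⟩ := hdd'
    refine ⟨u * EuclideanDomain.gcdA P (derivative P), u * EuclideanDomain.gcdB P (derivative P), ?_⟩
    have : D * (u * EuclideanDomain.gcdA P (derivative P) * A +
        u * EuclideanDomain.gcdB P (derivative P) * R) = D * 1 := by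
      linear_combination (-(u * EuclideanDomain.gcdA P (derivative P))) * hA -
        u * EuclideanDomain.gcdB P (derivative P) * hR - u * hb - hu + u * hD₀
    exact mul_left_cancel₀ hDmon.ne_zero this
  have hAR : A * derivative P = R * P := by
    linear_combination A * hR - R * hA
  have hAdeg : A.natDegree ≤ P.natDegree := natDegree_le_of_dvd ⟨D, by rw [hA]; ring⟩ hP0
  have hRdeg : R.degree < A.natDegree := by
    rw [← degree_eq_natDegree hAmon.ne_zero]
    by_contra! hle
    have h1 : (derivative P).degree < P.degree := degree_derivative_lt hP0
    rw [hR, hA, degree_mul, degree_mul] at h1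
    exact absurd h1 (not_lt.2 (by gcongr))
  refine ⟨A, R, hAmon, hAdeg, hRdeg, hAR, ?_, ?_, ?_⟩
  · intro k hk
    rw [sylvDet_ne_zero_iff (by omega)]
    constructor
    · intro h
      by_contra! hlt
      have hlt' : (A.natDegree : WithBot ℕ) < k := by exact_mod_cast hlt
      have := h A (-R) (degree_le_natDegree.trans_lt hlt') (by
        rw [degree_neg]; exact hRdeg.trans hlt') (by rw [hAR]; ring)
      exact hAmon.ne_zero this.1
    · intro hkA a b ha hb hab
      have h1 : a * R + b * A = 0 := by
        have : D * (a * R + b * A) = D * 0 := by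
          rw [mul_zero, ← hab]
          nth_rewrite 2 [hA]
          nth_rewrite 1 [hR]
          ring
        exact mul_left_cancel₀ hDmon.ne_zero this
      have h2 : A ∣ a := hco.dvd_of_dvd_mul_right ⟨-b, by linear_combination h1⟩
      have h3 : a = 0 := by
        by_contra h0
        have := degree_le_of_dvd h2 h0
        rw [degree_eq_natDegree hAmon.ne_zero] at this
        have h4 : (k : WithBot ℕ) ≤ A.natDegree := by exact_mod_cast hkA
        exact absurd (this.trans_lt ha) (not_lt.2 h4)
      refine ⟨h3, ?_⟩
      rw [h3, zero_mul, zero_add] at h1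
      exact (mul_eq_zero.1 h1).resolve_right hAmon.ne_zero
  · intro t
    constructor
    · intro ht
      rw [hA, eval_mul, ht, mul_zero]
    · intro ht
      by_contra hAt
      have hd : derivative P ≠ 0 := fun h0 => by
        have := derivative_eq_zero.1 h0
        rw [eq_one_of_monic_natDegree_zero hP this] at ht
        simp at ht
      have h1 := derivative_rootMultiplicity_of_root (p := P) (t := t) ht
      have h2 : 0 < P.rootMultiplicity t := (rootMultiplicity_pos hP0).2 ht
      have h3 : A * derivative P ≠ 0 := mul_ne_zero hAmon.ne_zero hd
      have h4 := rootMultiplicity_mul (x := t) h3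
      have h5 : (R * P).rootMultiplicity t = _ := rootMultiplicity_mul (x := t) (hAR ▸ h3)
      rw [hAR, h5, h1, rootMultiplicity_eq_zero (p := A) hAt] at h4
      omega
  · intro t ht ht'
    have hPt : P.eval t = 0 := by rw [hA, eval_mul, ht, mul_zero]
    have hd : derivative P ≠ 0 := fun h0 => by
      have := derivative_eq_zero.1 h0
      rw [eq_one_of_monic_natDegree_zero hP this] at hPt
      simp at hPt
    have h1 := derivative_rootMultiplicity_of_root (p := P) (t := t) hPt
    have h2 : 0 < P.rootMultiplicity t := (rootMultiplicity_pos hP0).2 hPt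
    have h3 : A * derivative P ≠ 0 := mul_ne_zero hAmon.ne_zero hd
    have h4 := rootMultiplicity_mul (x := t) h3
    have h5 : (R * P).rootMultiplicity t = _ := rootMultiplicity_mul (x := t) (hAR ▸ h3)
    have hRt : ¬R.IsRoot t := fun hRt => by
      obtain ⟨u, v, huv⟩ := hco
      have := congrArg (eval t) huv
      rw [IsRoot.def] at hRt
      simp [ht, hRt] at this
    have h6 := (one_lt_rootMultiplicity_iff_isRoot (p := A) (t := t) hAmon.ne_zero).2 ⟨ht, ht'⟩
    rw [hAR, h5, h1, rootMultiplicity_eq_zero hRt] at h4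
    omega

theorem analyticAt_det {E n : Type*} [NormedAddCommGroup E] [NormedSpace ℝ E] [Fintype n]
    [DecidableEq n] {M : E → Matrix n n ℝ} {y : E}
    (h : ∀ i j, AnalyticAt ℝ (fun y => M y i j) y) : AnalyticAt ℝ (fun y => (M y).det) y := by
  simp only [Matrix.det_apply']
  refine Finset.analyticAt_fun_sum _ fun σ _ => analyticAt_const.mul ?_
  exact Finset.analyticAt_fun_prod _ fun i _ => h _ _

open Polynomial in
theorem analyticAt_sylv {E : Type*} [NormedAddCommGroup E] [NormedSpace ℝ E] {Q : E → ℝ[X]}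
    {y : E} (h : ∀ i, AnalyticAt ℝ (fun y => (Q y).coeff i) y) (L k : ℕ) (i : Fin L)
    (c : Fin k ⊕ Fin k) : AnalyticAt ℝ (fun y => sylv L k (Q y) i c) y := by
  rcases c with j | j
  · simp only [sylv, Sum.elim_inl, coeff_X_pow_mul', coeff_derivative]
    split_ifs
    · exact (h _).mul analyticAt_const
    · exact analyticAt_const
  · simp only [sylv, Sum.elim_inr, coeff_X_pow_mul']
    split_ifs
    · exact h _
    · exact analyticAt_const

open Polynomial in
theorem analyticAt_sylvGram {E : Type*} [NormedAddCommGroup E] [NormedSpace ℝ E] {Q : E → ℝ[X]}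
    {y : E} (h : ∀ i, AnalyticAt ℝ (fun y => (Q y).coeff i) y) (L k : ℕ) (c d : Fin k ⊕ Fin k) :
    AnalyticAt ℝ (fun y => ((sylv L k (Q y)).transpose * sylv L k (Q y)) c d) y := by
  simp only [Matrix.mul_apply, Matrix.transpose_apply]
  exact Finset.analyticAt_fun_sum _ fun i _ =>
    (analyticAt_sylv h L k i c).mul (analyticAt_sylv h L k i d)

open Polynomial in
theorem analyticAt_sylvDet {E : Type*} [NormedAddCommGroup E] [NormedSpace ℝ E] {Q : E → ℝ[X]}
    {y : E} (h : ∀ i, AnalyticAt ℝ (fun y => (Q y).coeff i) y) (L k : ℕ) :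
    AnalyticAt ℝ (fun y => sylvDet L k (Q y)) y :=
  analyticAt_det fun c d => analyticAt_sylvGram h L k c d

open Polynomial in
/-- A monic family with constant subdiscriminant pattern has globally ordered analytic roots. -/
theorem exists_ordered_roots {E : Type*} [NormedAddCommGroup E] [NormedSpace ℝ E]
    [CompleteSpace E] {Q : E → ℝ[X]} {m : ℕ} (hmon : ∀ y, (Q y).Monic)
    (hm : ∀ y, (Q y).natDegree = m)
    (hQ : ∀ i, AnalyticOnNhd ℝ (fun y => (Q y).coeff i) univ)
    (hG : ∀ k ≤ m + 1, (∀ y, sylvDet (2 * m + 1) k (Q y) = 0) ∨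
      ∀ y, sylvDet (2 * m + 1) k (Q y) ≠ 0) :
    ∃ (M : ℕ) (ξ : Fin M → E → ℝ), (∀ j, AnalyticOnNhd ℝ (ξ j) univ) ∧
      (∀ y, StrictMono fun j => ξ j y) ∧ ∀ y t, (Q y).eval t = 0 ↔ ∃ j, ξ j y = t := by
  have hex := fun y => exists_reduced (hmon y) (L := 2 * m + 1) (by rw [hm])
  choose A R hAmon hAdeg hRdeg hAR hAk hAev hAs using hex
  set N := (A 0).natDegree with hN
  have hle : ∀ y y', (A y).natDegree ≤ (A y').natDegree := fun y y' => by
    have hk : (A y).natDegree ≤ m + 1 := (hAdeg y).trans (by rw [hm]; omega)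
    have h1 := (hAk y _ (by rw [hm]; exact hk)).2 le_rfl
    refine (hAk y' _ (by rw [hm]; exact hk)).1 ?_
    rcases hG _ hk with h | h
    · exact absurd (h y) h1
    · exact h y'
  have hAN : ∀ y, (A y).natDegree = N := fun y => le_antisymm (hle _ _) (hle _ _)
  have hcoef : ∀ i, AnalyticOnNhd ℝ (fun y => (A y).coeff i) univ := by
    intro i y₀ _
    rcases lt_trichotomy i N with hi | hi | hi
    · let w : E → Fin (2 * m + 1) → ℝ := fun y i => -(X ^ N * derivative (Q y)).coeff i
      let b : E → Fin N ⊕ Fin N → ℝ := fun y => (sylv (2 * m + 1) N (Q y)).transpose.mulVec (w y)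
      let G : E → Matrix (Fin N ⊕ Fin N) (Fin N ⊕ Fin N) ℝ := fun y =>
        (sylv (2 * m + 1) N (Q y)).transpose * sylv (2 * m + 1) N (Q y)
      have hdet : ∀ y, (G y).det ≠ 0 := fun y =>
        (hAk y N (by rw [← hAN y]; exact (hAdeg y).trans (by omega))).2 (hAN y).ge
      have hw : ∀ j, AnalyticAt ℝ (fun y => w y j) y₀ := fun j => by
        simp only [w, coeff_X_pow_mul', coeff_derivative]
        split_ifs
        · exact ((hQ _ y₀ trivial).mul analyticAt_const).neg
        · exact analyticAt_const
      have hb : ∀ c, AnalyticAt ℝ (fun y => b y c) y₀ := fun c => by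
        simp only [b, Matrix.mulVec, dotProduct, Matrix.transpose_apply]
        exact Finset.analyticAt_fun_sum _ fun j _ =>
          (analyticAt_sylv (fun i => hQ i y₀ trivial) _ _ _ _).mul (hw j)
      have hGan : ∀ c d, AnalyticAt ℝ (fun y => G y c d) y₀ := fun c d =>
        analyticAt_sylvGram (fun i => hQ i y₀ trivial) _ _ c d
      have hform : ∀ y, (A y).coeff i = ((G y).updateCol (Sum.inl ⟨i, hi⟩) (b y)).det / (G y).det := by
        intro y
        let v : Fin N ⊕ Fin N → ℝ := Sum.elim (fun j => (A y - X ^ N).coeff j) fun j => (-R y).coeff j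
        have hdA : (A y - X ^ N).degree < (N : WithBot ℕ) := by
          have h1 : (A y).degree = (N : WithBot ℕ) := by
            rw [degree_eq_natDegree (hAmon y).ne_zero, hAN]
          have := degree_sub_lt_left (p := A y) (q := X ^ N) (by rw [h1, degree_X_pow]) (hAmon y).ne_zero
            (by rw [(hAmon y).leadingCoeff, (monic_X_pow N).leadingCoeff])
          rwa [h1] at this
        have hdR : (-R y).degree < (N : WithBot ℕ) := by
          rw [degree_neg, ← hAN y]; exact hRdeg y
        have hv1 : polyOf (v ∘ Sum.inl) = A y - X ^ N := polyOf_coeff hdA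
        have hv2 : polyOf (v ∘ Sum.inr) = -R y := polyOf_coeff hdR
        have hMv : (sylv (2 * m + 1) N (Q y)).mulVec v = w y := by
          funext j
          rw [sylv_mulVec, hv1, hv2]
          have : (A y - X ^ N) * derivative (Q y) + -R y * Q y = -(X ^ N * derivative (Q y)) := by
            linear_combination hAR y
          rw [this, coeff_neg]
        have hGv : (G y).mulVec v = b y := by
          rw [← Matrix.mulVec_mulVec, hMv]
        have hcr := Matrix.cramer_apply (G y) (b y) (Sum.inl ⟨i, hi⟩)
        rw [Matrix.cramer_eq_adjugate_mulVec, ← hGv, Matrix.mulVec_mulVec, Matrix.adjugate_mul,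
          Matrix.smul_mulVec, Matrix.one_mulVec, hGv] at hcr
        rw [← hcr, Pi.smul_apply, smul_eq_mul, mul_div_cancel_left₀ _ (hdet y)]
        simp only [v, Sum.elim_inl, coeff_sub, coeff_X_pow, if_neg hi.ne, sub_zero]
      simp only [hform]
      refine AnalyticAt.div (analyticAt_det fun c d => ?_) (analyticAt_det hGan) (hdet y₀)
      simp only [Matrix.updateCol_apply]
      split_ifs
      · exact hb c
      · exact hGan c d
    · have : (fun y => (A y).coeff i) = fun _ => 1 := by
        funext y
        rw [hi, ← hAN y]; exact hAmon y
      rw [this]; exact analyticAt_const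
    · have : (fun y => (A y).coeff i) = fun _ => 0 := by
        funext y
        exact coeff_eq_zero_of_natDegree_lt (by rw [hAN]; exact hi)
      rw [this]; exact analyticAt_const
  obtain ⟨M, ξ, h1, h2, h3⟩ := exists_ordered_roots_of_simple hAmon hAN hcoef hAs
  exact ⟨M, ξ, h1, h2, fun y t => by rw [← hAev, h3]⟩

open Polynomial in
/-- Cells over a base on which all root counts are constant. -/
theorem exists_cylinder_cells {E ι : Type*} [NormedAddCommGroup E] [NormedSpace ℝ E]
    [CompleteSpace E] [Fintype ι] {Q : ι → E → ℝ[X]} {m : ι → ℕ} {ρ : ℝ}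
    (hmon : ∀ i y, (Q i y).Monic) (hm : ∀ i y, (Q i y).natDegree = m i)
    (hQ : ∀ i k, AnalyticOnNhd ℝ (fun y => (Q i y).coeff k) univ)
    (hG : ∀ i, ∀ k ≤ m i + 1, (∀ y, sylvDet (2 * m i + 1) k (Q i y) = 0) ∨
      ∀ y, sylvDet (2 * m i + 1) k (Q i y) ≠ 0)
    {P : E → ℝ[X]} {m₀ : ℕ} (hP : ∀ y, P y = (∏ i, Q i y) * ((X - C ρ) * (X - C (-ρ))))
    (hPm : ∀ y, (P y).natDegree = m₀)
    (hPQ : ∀ k, AnalyticOnNhd ℝ (fun y => (P y).coeff k) univ)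
    (hPG : ∀ k ≤ m₀ + 1, (∀ y, sylvDet (2 * m₀ + 1) k (P y) = 0) ∨
      ∀ y, sylvDet (2 * m₀ + 1) k (P y) ≠ 0) :
    ∃ (K : Type) (_ : Finite K) (ψ : K → E × ℝ → ℝ), (∀ c, AnalyticOnNhd ℝ (ψ c) univ) ∧
      (∀ c z, |ψ c z| ≤ ρ) ∧
      (∀ c i, (∀ z, (Q i z.1).eval (ψ c z) = 0) ∨ ∀ z, (Q i z.1).eval (ψ c z) ≠ 0) ∧
      ∀ y t, |t| < ρ → ∃ c s, ψ c (y, s) = t := by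
  have hPmon : ∀ y, (P y).Monic := fun y => by
    rw [hP]
    exact (monic_prod_of_monic _ _ fun i _ => hmon i y).mul ((monic_X_sub_C _).mul (monic_X_sub_C _))
  have hPev : ∀ y t, (P y).eval t = 0 ↔ (∃ i, (Q i y).eval t = 0) ∨ t = ρ ∨ t = -ρ := by
    intro y t
    rw [hP]
    simp [eval_mul, eval_prod, Finset.prod_eq_zero_iff, sub_eq_zero, add_eq_zero_iff_eq_neg]
  obtain ⟨M, ξ, hξan, hξmono, hξ⟩ := exists_ordered_roots hPmon hPm hPQ hPG
  have hξc : ∀ j, Continuous (ξ j) := fun j => continuousOn_univ.mp (hξan j).continuousOn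
  have hξinj : ∀ y, Function.Injective fun j => ξ j y := fun y => (hξmono y).injective
  have key : ∀ η : E → ℝ, Continuous η → (∀ y, (P y).eval (η y) = 0) → ∃ j, ∀ y, η y = ξ j y := by
    intro η hη h
    refine exists_eq_of_forall_exists_eq hξc hξinj hη fun y => ?_
    obtain ⟨j, hj⟩ := (hξ y _).mp (h y)
    exact ⟨j, hj.symm⟩
  obtain ⟨a, ha⟩ := key (fun _ => -ρ) continuous_const fun y => (hPev y _).mpr (Or.inr (Or.inr rfl))
  obtain ⟨b, hb⟩ := key (fun _ => ρ) continuous_const fun y => (hPev y _).mpr (Or.inr (Or.inl rfl))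
  have hQr : ∀ i j, (∀ y, (Q i y).eval (ξ j y) = 0) ∨ ∀ y, (Q i y).eval (ξ j y) ≠ 0 := by
    intro i j
    obtain ⟨M', ζ, hζan, -, hζ⟩ := exists_ordered_roots (hmon i) (hm i) (hQ i) (hG i)
    by_cases h : ∃ y, (Q i y).eval (ξ j y) = 0
    · left
      obtain ⟨y₀, h⟩ := h
      obtain ⟨l, hl⟩ := (hζ y₀ _).mp h
      obtain ⟨j', hj'⟩ := key (ζ l) (continuousOn_univ.mp (hζan l).continuousOn) fun y =>
        (hPev y _).mpr (Or.inl ⟨i, (hζ y _).mpr ⟨l, rfl⟩⟩)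
      have : j' = j := hξinj y₀ (by simp only [← hj', hl])
      intro y
      rw [← this, ← hj' y]
      exact (hζ y _).mpr ⟨l, rfl⟩
    · right
      push Not at h
      exact h
  let K := {q : Fin M × Fin M // a ≤ q.1 ∧ q.1 ≤ q.2 ∧ q.2 ≤ b ∧ (q.2 : ℕ) ≤ q.1 + 1}
  let ψ : K → E × ℝ → ℝ := fun q z =>
    ξ q.1.1 z.1 + (ξ q.1.2 z.1 - ξ q.1.1 z.1) * Real.sigmoid z.2
  have hσ : AnalyticOnNhd ℝ Real.sigmoid univ := fun x _ => _root_.analyticAt_sigmoid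
  refine ⟨K, inferInstance, ψ, ?_, ?_, ?_, ?_⟩
  · intro q z _
    have h : ∀ j, AnalyticAt ℝ (fun z : E × ℝ => ξ j z.1) z := fun j =>
      (hξan j z.1 trivial).fun_comp_of_eq analyticAt_fst rfl
    exact (h _).add (((h _).sub (h _)).mul ((hσ z.2 trivial).fun_comp_of_eq analyticAt_snd rfl))
  · rintro ⟨⟨j, j'⟩, h1, h2, h3, h4⟩ ⟨y, s⟩
    have e1 := (hξmono y).monotone h1
    have e2 := (hξmono y).monotone h2
    have e3 := (hξmono y).monotone h3
    simp only [← ha, ← hb] at e1 e2 e3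
    simp only [ψ]
    have s1 := Real.sigmoid_pos s
    have s2 := Real.sigmoid_lt_one s
    rw [abs_le]
    constructor <;> nlinarith
  · rintro ⟨⟨j, j'⟩, h1, h2, h3, h4⟩ i
    rcases h2.eq_or_lt with h2 | h2
    · simp only at h2
      subst h2
      simp only [ψ, sub_self, zero_mul, add_zero]
      rcases hQr i j with h | h
      · exact Or.inl fun z => h z.1
      · exact Or.inr fun z => h z.1
    · right
      rintro ⟨y, s⟩ h0
      have e2 := hξmono y h2
      simp only [ψ] at h0 e2
      obtain ⟨l, hl⟩ := (hξ y _).mp ((hPev y _).mpr (Or.inl ⟨i, h0⟩))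
      have s1 := Real.sigmoid_pos s
      have s2 := Real.sigmoid_lt_one s
      have l1 : ξ j y < ξ l y := by rw [hl]; nlinarith
      have l2 : ξ l y < ξ j' y := by rw [hl]; nlinarith
      have l1' := (hξmono y).lt_iff_lt.mp l1
      have l2' := (hξmono y).lt_iff_lt.mp l2
      simp only [Fin.lt_def] at l1' l2' h4
      omega
  · intro y t ht
    obtain ⟨ht1, ht2⟩ := abs_lt.mp ht
    obtain ⟨j, hj, hjmax⟩ := Finset.exists_max_image (Finset.univ.filter fun j => ξ j y ≤ t) id
      ⟨a, by simp only [Finset.mem_filter, Finset.mem_univ, true_and, ← ha]; exact ht1.le⟩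
    simp only [Finset.mem_filter, Finset.mem_univ, true_and, id] at hj hjmax
    have haj : a ≤ j := hjmax a (by rw [← ha]; exact ht1.le)
    have hjb : j < b := (hξmono y).lt_iff_lt.mp (by simp only [← hb]; linarith)
    rcases hj.eq_or_lt with hj | hj
    · exact ⟨⟨(j, j), haj, le_rfl, hjb.le, by simp⟩, 0, by simp [ψ, hj]⟩
    · have hlt : (j : ℕ) + 1 < M := by have := b.2; have := Fin.lt_def.mp hjb; omega
      have hj' : t < ξ ⟨j + 1, hlt⟩ y := by
        by_contra hc
        have := hjmax _ (not_lt.mp hc)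
        simp [Fin.le_def] at this
      have hmem : (t - ξ j y) / (ξ ⟨j + 1, hlt⟩ y - ξ j y) ∈ range Real.sigmoid := by
        rw [Real.range_sigmoid]
        constructor
        · exact div_pos (by linarith) (by linarith)
        · rw [div_lt_one (by linarith)]; linarith
      obtain ⟨s, hs⟩ := hmem
      refine ⟨⟨(j, ⟨j + 1, hlt⟩), haj, by simp [Fin.le_def], by
        have := Fin.lt_def.mp hjb; simp only [Fin.le_def]; omega, le_rfl⟩, s, ?_⟩
      simp only [ψ, hs]
      rw [mul_div_cancel₀ _ (by linarith)]
      ring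

/-- The family `f` has a finite cover of a neighbourhood of `0` by analytic images of the whole
space, inside `U`, on each of which every member vanishes identically or nowhere. -/
def HasCellsFor {E ι : Type*} [NormedAddCommGroup E] [NormedSpace ℝ E] (f : ι → E → ℝ)
    (U : Set E) : Prop :=
  ∃ (K : Type) (_ : Finite K) (φ : K → E → E), (∀ c, AnalyticOnNhd ℝ (φ c) univ) ∧
    (∀ c y, φ c y ∈ U) ∧ (∀ c i, (∀ y, f i (φ c y) = 0) ∨ ∀ y, f i (φ c y) ≠ 0) ∧
    (⋃ c, range (φ c)) ∈ 𝓝 0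

def HasCells (E : Type*) [NormedAddCommGroup E] [NormedSpace ℝ E] : Prop :=
  ∀ (ι : Type) [Finite ι] (f : ι → E → ℝ), (∀ i, AnalyticAt ℝ (f i) 0) →
    ∀ U ∈ 𝓝 (0 : E), HasCellsFor f U

open Polynomial in
theorem analyticAt_coeff_mul {E : Type*} [NormedAddCommGroup E] [NormedSpace ℝ E]
    {Q R : E → ℝ[X]} {x : E} (hQ : ∀ k, AnalyticAt ℝ (fun y => (Q y).coeff k) x)
    (hR : ∀ k, AnalyticAt ℝ (fun y => (R y).coeff k) x) (k : ℕ) :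
    AnalyticAt ℝ (fun y => (Q y * R y).coeff k) x := by
  simp only [coeff_mul]
  exact Finset.analyticAt_fun_sum _ fun i _ => (hQ _).mul (hR _)

open Polynomial in
theorem analyticAt_coeff_prod {E ι : Type*} [NormedAddCommGroup E] [NormedSpace ℝ E]
    {Q : ι → E → ℝ[X]} {x : E} (s : Finset ι)
    (hQ : ∀ i k, AnalyticAt ℝ (fun y => (Q i y).coeff k) x) (k : ℕ) :
    AnalyticAt ℝ (fun y => (∏ i ∈ s, Q i y).coeff k) x := by
  classical
  induction s using Finset.induction_on generalizing k with
  | empty => simpa using analyticAt_const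
  | insert a s ha ih =>
    simp only [Finset.prod_insert ha]
    exact analyticAt_coeff_mul (hQ a) ih k

open Polynomial in
theorem HasCells.prod_of_regular {E : Type*} [NormedAddCommGroup E] [NormedSpace ℝ E]
    [CompleteSpace E] (hE : HasCells E) {ι : Type} [Finite ι] {f : ι → E × ℝ → ℝ}
    (hf : ∀ i, AnalyticAt ℝ (f i) 0) (hne : ∀ i, ¬∀ᶠ t : ℝ in 𝓝 0, f i (0, t) = 0)
    {U : Set (E × ℝ)} (hU : U ∈ 𝓝 0) : HasCellsFor f U := by
  have := Fintype.ofFinite ι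
  choose m p hp hfp using fun i => exists_weierstrass_polynomial (hf i) (hne i)
  let Q : ι → E → ℝ[X] := fun i x => X ^ m i + polyOf (p i x)
  have hQmon : ∀ i x, (Q i x).Monic := fun i x =>
    monic_X_pow_add (degree_polyOf_lt _)
  have hQm : ∀ i x, (Q i x).natDegree = m i := fun i x => by
    have : (Q i x).degree = (m i : ℕ) := by
      rw [degree_add_eq_left_of_degree_lt (by rw [degree_X_pow]; exact degree_polyOf_lt _),
        degree_X_pow]
    exact natDegree_eq_of_degree_eq_some this
  have hQev : ∀ i x t, (Q i x).eval t = t ^ m i + ∑ j, p i x j * t ^ (j : ℕ) := fun i x t => by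
    simp [Q, polyOf, eval_finsetSum]
  have hQan : ∀ x, (∀ i, AnalyticAt ℝ (p i) x) → ∀ i k, AnalyticAt ℝ (fun y => (Q i y).coeff k) x := by
    intro x hx i k
    simp only [Q, coeff_add]
    refine analyticAt_const.add ?_
    by_cases hk : k < m i
    · have := fun y => coeff_polyOf (p i y) ⟨k, hk⟩
      simp only at this
      simp only [this]
      exact (analyticAt_pi_iff.mp (hx i)) ⟨k, hk⟩
    · have : ∀ y, (polyOf (p i y)).coeff k = 0 := fun y =>
        coeff_eq_zero_of_degree_lt ((degree_polyOf_lt _).trans_le (by simpa using hk))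
      simp only [this]
      exact analyticAt_const
  have hS : U ∩ {z : E × ℝ | ∀ i, f i z = 0 ↔ (Q i z.1).eval z.2 = 0} ∈ 𝓝 ((0 : E), (0 : ℝ)) := by
    refine inter_mem hU ?_
    simp only [hQev]
    exact eventually_all.mpr hfp
  rw [nhds_prod_eq, mem_prod_iff] at hS
  obtain ⟨A, hA, B, hB, hAB⟩ := hS
  obtain ⟨ρ, hρ, hρB⟩ := Metric.nhds_basis_closedBall.mem_iff.mp hB
  have hA' : A ∩ {x | ∀ i, AnalyticAt ℝ (p i) x} ∈ 𝓝 (0 : E) :=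
    inter_mem hA (eventually_all.mpr fun i => (hp i).eventually_analyticAt)
  let P : E → ℝ[X] := fun x => (∏ i, Q i x) * ((X - C ρ) * (X - C (-ρ)))
  let m₀ := (∑ i, m i) + 2
  have hPm : ∀ x, (P x).natDegree = m₀ := fun x => by
    have h1 : (∏ i, Q i x).Monic := monic_prod_of_monic _ _ fun i _ => hQmon i x
    have h2 : ((X - C ρ) * (X - C (-ρ)) : ℝ[X]).Monic := (monic_X_sub_C _).mul (monic_X_sub_C _)
    simp only [P, m₀]
    rw [h1.natDegree_mul h2, natDegree_prod_of_monic _ _ fun i _ => hQmon i x,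
      (monic_X_sub_C _).natDegree_mul (monic_X_sub_C _)]
    simp [hQm]
  have hPan : ∀ x, (∀ i, AnalyticAt ℝ (p i) x) → ∀ k, AnalyticAt ℝ (fun y => (P y).coeff k) x :=
    fun x hx => analyticAt_coeff_mul (analyticAt_coeff_prod _ (hQan x hx)) fun k => analyticAt_const
  have h0 : ∀ i, AnalyticAt ℝ (p i) 0 := hp
  obtain ⟨K, hK, φ, hφ, hφA, hφG, hφc⟩ := hE ((Σ i, Fin (m i + 2)) ⊕ Fin (m₀ + 2))
    (Sum.elim (fun q x => sylvDet (2 * m q.1 + 1) q.2 (Q q.1 x))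
      fun k x => sylvDet (2 * m₀ + 1) k (P x))
    (by
      rintro (⟨i, k⟩ | k)
      · exact analyticAt_sylvDet (hQan 0 h0 i) _ _
      · exact analyticAt_sylvDet (hPan 0 h0) _ _) _ hA'
  have hcell := fun c => exists_cylinder_cells (Q := fun i y => Q i (φ c y)) (m := m) (ρ := ρ)
    (fun i y => hQmon i _) (fun i y => hQm i _)
    (fun i k y _ => (hQan (φ c y) (hφA c y).2 i k).fun_comp_of_eq (hφ c y trivial) rfl)
    (fun i k hk => hφG c (Sum.inl ⟨i, ⟨k, by omega⟩⟩))
    (P := fun y => P (φ c y)) (fun y => rfl) (fun y => hPm _)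
    (fun k y _ => (hPan (φ c y) (hφA c y).2 k).fun_comp_of_eq (hφ c y trivial) rfl)
    (fun k hk => hφG c (Sum.inr ⟨k, by omega⟩))
  choose K' hK' ψ hψ hψρ hψQ hψc using hcell
  have hmem : ∀ c d z, (φ c z.1, ψ c d z) ∈ A ×ˢ B := fun c d z =>
    ⟨(hφA c z.1).1, hρB (by simpa using hψρ c d z)⟩
  refine ⟨Σ c, K' c, inferInstance, fun q z => (φ q.1 z.1, ψ q.1 q.2 z), ?_, ?_, ?_, ?_⟩
  · intro q z _
    exact ((hφ q.1 z.1 trivial).fun_comp_of_eq analyticAt_fst rfl).prod (hψ q.1 q.2 z trivial)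
  · exact fun q z => (hAB (hmem q.1 q.2 z)).1
  · intro q i
    have := fun z => (hAB (hmem q.1 q.2 z)).2 i
    simp only [ne_eq, this]
    exact hψQ q.1 q.2 i
  · have : (⋃ c, range (φ c)) ×ˢ Metric.ball (0 : ℝ) ρ ∈ 𝓝 ((0 : E), (0 : ℝ)) :=
      prod_mem_nhds hφc (Metric.ball_mem_nhds _ hρ)
    refine mem_of_superset this ?_
    rintro ⟨x, t⟩ ⟨hx, ht⟩
    obtain ⟨c, y, rfl⟩ := mem_iUnion.mp hx
    obtain ⟨d, s, hs⟩ := hψc c y t (by simpa using ht)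
    exact mem_iUnion.mpr ⟨⟨c, d⟩, (y, s), by simp [hs]⟩

theorem HasCellsFor.of_equiv {E E' ι : Type*} [NormedAddCommGroup E] [NormedSpace ℝ E]
    [NormedAddCommGroup E'] [NormedSpace ℝ E'] (e : E ≃L[ℝ] E') {f : ι → E → ℝ} {U : Set E}
    (h : HasCellsFor (fun i x => f i (e.symm x)) (e.symm ⁻¹' U)) : HasCellsFor f U := by
  obtain ⟨K, hK, φ, hφ, hU, hf, hc⟩ := h
  refine ⟨K, hK, fun c y => e.symm (φ c (e y)), fun c y _ => ?_, fun c y => hU c _, fun c i => ?_, ?_⟩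
  · have h1 : AnalyticAt ℝ (fun y => φ c (e y)) y :=
      (hφ c (e y) trivial).fun_comp_of_eq ((e : E →L[ℝ] E').analyticAt y) rfl
    exact ((e.symm : E' →L[ℝ] E).analyticAt _).fun_comp h1
  · rcases hf c i with h | h
    · exact Or.inl fun y => h (e y)
    · exact Or.inr fun y => h (e y)
  · have h1 : e ⁻¹' (⋃ c, range (φ c)) ∈ 𝓝 (0 : E) :=
      e.continuous.continuousAt.preimage_mem_nhds (by rwa [map_zero])
    refine mem_of_superset h1 fun x hx => ?_
    obtain ⟨c, y, hy⟩ := mem_iUnion.mp hx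
    exact mem_iUnion.mpr ⟨c, e.symm y, by simp [hy]⟩

/-- A common direction along which finitely many nonzero analytic germs do not vanish. -/
theorem exists_regular_direction {E ι : Type*} [NormedAddCommGroup E] [NormedSpace ℝ E]
    [CompleteSpace E] [Nontrivial E] [Finite ι] {f : ι → E → ℝ} (hf : ∀ i, AnalyticAt ℝ (f i) 0)
    (hne : ∀ i, ¬∀ᶠ x in 𝓝 0, f i x = 0) :
    ∃ v : E, v ≠ 0 ∧ ∀ i, ¬∀ᶠ t : ℝ in 𝓝 0, f i (t • v) = 0 := by
  classical
  have := Fintype.ofFinite ι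
  have hev : ∀ᶠ x in 𝓝 (0 : E), ∀ i, AnalyticAt ℝ (f i) x :=
    eventually_all.mpr fun i => (hf i).eventually_analyticAt
  obtain ⟨R, hR, hball⟩ := Metric.eventually_nhds_iff_ball.mp hev
  have han : ∀ i, AnalyticOnNhd ℝ (f i) (Metric.ball 0 R) := fun i x hx => hball x hx i
  have hO : ∀ s : Finset ι, ∃ O : Set E, IsOpen O ∧ O.Nonempty ∧ O ⊆ Metric.ball 0 R ∧ 0 ∉ O ∧
      ∀ i ∈ s, ∀ x ∈ O, f i x ≠ 0 := by
    intro s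
    induction s using Finset.induction_on with
    | empty =>
      refine ⟨Metric.ball 0 R \ {0}, Metric.isOpen_ball.sdiff isClosed_singleton, ?_, sdiff_subset,
        by simp, by simp⟩
      have := Module.punctured_nhds_neBot ℝ E 0
      have hb : ∀ᶠ x in 𝓝[≠] (0 : E), x ∈ Metric.ball 0 R :=
        nhdsWithin_le_nhds (Metric.ball_mem_nhds _ hR)
      obtain ⟨x, hx, hx'⟩ := (hb.and self_mem_nhdsWithin).exists
      exact ⟨x, hx, hx'⟩
    | insert a s ha ih =>
      obtain ⟨O, hOo, ⟨x, hx⟩, hOR, h0, hs⟩ := ih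
      have : ∃ x ∈ O, f a x ≠ 0 := by
        by_contra hc
        push Not at hc
        refine hne a ?_
        have := (han a).eqOn_zero_of_preconnected_of_eventuallyEq_zero
          (convex_ball _ _).isPreconnected (hOR hx) (eventually_of_mem (hOo.mem_nhds hx) hc)
        exact eventually_of_mem (Metric.ball_mem_nhds _ hR) this
      obtain ⟨x, hx, hax⟩ := this
      have hopen : IsOpen (O ∩ f a ⁻¹' {0}ᶜ) :=
        ((han a).continuousOn.mono hOR).isOpen_inter_preimage hOo isOpen_compl_singleton
      refine ⟨O ∩ f a ⁻¹' {0}ᶜ, hopen, ⟨x, hx, hax⟩, inter_subset_left.trans hOR, fun h => h0 h.1, ?_⟩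
      intro i hi y hy
      rcases Finset.mem_insert.mp hi with rfl | hi
      · exact hy.2
      · exact hs i hi y hy.1
  obtain ⟨O, -, ⟨v, hv⟩, hOR, h0, hO⟩ := hO Finset.univ
  refine ⟨v, fun h => h0 (h ▸ hv), fun i hi => hO i (Finset.mem_univ _) v hv ?_⟩
  have hl : ∀ t, AnalyticAt ℝ (fun t : ℝ => t • v) t := fun t => analyticAt_id.smul analyticAt_const
  have hg : AnalyticOnNhd ℝ (fun t : ℝ => f i (t • v)) ((fun t : ℝ => t • v) ⁻¹' Metric.ball 0 R) :=
    fun t ht => (han i _ ht).fun_comp_of_eq (hl t) rfl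
  have hconv : Convex ℝ ((fun t : ℝ => t • v) ⁻¹' Metric.ball (0 : E) R) :=
    (convex_ball (0 : E) R).is_linear_preimage (IsLinearMap.isLinearMap_smul' v)
  have := hg.eqOn_zero_of_preconnected_of_eventuallyEq_zero hconv.isPreconnected
    (by simpa using hR) hi (show (1 : ℝ) ∈ _ by simpa using hOR hv)
  simpa using this

theorem hasCells_of_finrank (n : ℕ) : ∀ (E : Type) [NormedAddCommGroup E] [NormedSpace ℝ E]
    [FiniteDimensional ℝ E], Module.finrank ℝ E = n → HasCells E := by
  induction n with
  | zero =>
    intro E _ _ _ hE ι _ f hf U hU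
    have := Module.finrank_zero_iff.mp hE
    refine ⟨Unit, inferInstance, fun _ x => x, fun _ x _ => analyticAt_id, fun _ y => ?_,
      fun _ i => ?_, ?_⟩
    · rw [Subsingleton.elim y 0]; exact mem_of_mem_nhds hU
    rotate_left
    · rw [iUnion_const]; exact univ_mem' fun x => ⟨x, rfl⟩
    · rcases eq_or_ne (f i 0) 0 with h | h
      · exact Or.inl fun y => by rwa [Subsingleton.elim y 0]
      · exact Or.inr fun y => by rwa [Subsingleton.elim y 0]
  | succ n ih =>
    intro E _ _ _ hE ι _ f hf U hU
    have : Nontrivial E := Module.nontrivial_of_finrank_pos (R := ℝ) (by omega)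
    have : CompleteSpace E := FiniteDimensional.complete ℝ E
    let ι' := {i // ¬∀ᶠ x in 𝓝 (0 : E), f i x = 0}
    obtain ⟨v, hv, hdir⟩ := exists_regular_direction (f := fun i : ι' => f i) (fun i => hf i)
      fun i => i.2
    let e : E ≃L[ℝ] (Fin n → ℝ) × ℝ := ContinuousLinearEquiv.ofFinrankEq (by simp [hE])
    have he : e.symm (0, 1) ≠ 0 := by
      rw [Ne, ContinuousLinearEquiv.map_eq_zero_iff]
      simp
    obtain ⟨A, hA⟩ := SeparatingDual.exists_continuousLinearEquiv_apply_eq (R := ℝ) hv he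
    let e' := A.trans e
    have he' : ∀ t : ℝ, e'.symm (0, t) = t • v := fun t => by
      have h1 : e'.symm (0, 1) = v := by
        rw [ContinuousLinearEquiv.symm_apply_eq]
        simp [e', hA]
      rw [← h1, ← map_smul]
      simp
    have hU' : U ∩ {x | ∀ i, i ∉ {i | ¬∀ᶠ x in 𝓝 (0 : E), f i x = 0} → f i x = 0} ∈ 𝓝 (0 : E) := by
      refine inter_mem hU (eventually_all.mpr fun i => ?_)
      by_cases hi : ∀ᶠ x in 𝓝 (0 : E), f i x = 0
      · exact hi.mono fun x hx _ => hx
      · exact Eventually.of_forall fun x h => absurd hi h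
    have hcells := (ih (Fin n → ℝ) (by simp)).prod_of_regular (ι := ι')
      (f := fun i x => f i (e'.symm x))
      (fun i => by
        refine AnalyticAt.fun_comp_of_eq (hf i) ((e'.symm : (Fin n → ℝ) × ℝ →L[ℝ] E).analyticAt 0) ?_
        simp)
      (fun i => by simpa only [he'] using hdir i)
      (U := e'.symm ⁻¹' _)
      (e'.symm.continuous.continuousAt.preimage_mem_nhds (by rw [map_zero]; exact hU'))
    obtain ⟨K, hK, φ, hφ, hφU, hφf, hφc⟩ := HasCellsFor.of_equiv e' (f := fun i : ι' => f i) hcells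
    refine ⟨K, hK, φ, hφ, fun c y => (hφU c y).1, fun c i => ?_, hφc⟩
    by_cases hi : ∀ᶠ x in 𝓝 (0 : E), f i x = 0
    · exact Or.inl fun y => (hφU c y).2 i (by simpa using hi)
    · exact hφf c ⟨i, hi⟩

/-- A multiplicative encoding of multi-indices by natural numbers. -/
def primeKey {N : ℕ} (α : Fin N → ℕ) : ℕ := ∏ j : Fin N, Nat.nth Nat.Prime j ^ α j

theorem primeKey_pos {N : ℕ} (α : Fin N → ℕ) : 0 < primeKey α :=
  Finset.prod_pos fun j _ => pow_pos (Nat.prime_nth_prime j).pos _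

theorem primeKey_add {N : ℕ} (α β : Fin N → ℕ) : primeKey (α + β) = primeKey α * primeKey β := by
  simp [primeKey, pow_add, Finset.prod_mul_distrib]

theorem primeKey_injective {N : ℕ} : Function.Injective (primeKey (N := N)) := by
  have key : ∀ (α : Fin N → ℕ) (j : Fin N), (primeKey α).factorization (Nat.nth Nat.Prime j) = α j := by
    intro α j
    rw [primeKey, Nat.factorization_prod fun (i : Fin N) _ => pow_ne_zero _ (Nat.prime_nth_prime i).ne_zero,
      Finsupp.finsetSum_apply, Finset.sum_eq_single j]
    · simp
    · intro i _ hij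
      have : Nat.nth Nat.Prime i ≠ Nat.nth Nat.Prime j := fun h =>
        hij (Fin.ext (Nat.nth_injective Nat.infinite_setOfPred_prime h))
      simp [this]
    · simp
  intro α β h
  funext j
  rw [← key α, h, key]

/-- The weight of a multi-index. -/
def wt {N : ℕ} (τ : ℕ) (α : Fin N → ℕ) : ℝ := ((primeKey α : ℝ) ^ τ)⁻¹

theorem wt_pos {N : ℕ} (τ : ℕ) (α : Fin N → ℕ) : 0 < wt τ α := by
  have := primeKey_pos α
  unfold wt
  positivity

theorem wt_add {N : ℕ} (τ : ℕ) (α β : Fin N → ℕ) : wt τ (α + β) = wt τ α * wt τ β := by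
  simp [wt, primeKey_add, mul_pow, mul_comm]

theorem wt_add_left {N : ℕ} (τ m : ℕ) (α : Fin N → ℕ) : wt (τ + m) α = wt τ α * wt m α := by
  simp [wt, pow_add, mul_comm]

theorem wt_le_one {N : ℕ} (m : ℕ) (α : Fin N → ℕ) : wt m α ≤ 1 :=
  inv_le_one_of_one_le₀ (one_le_pow₀ (by exact_mod_cast primeKey_pos α))

open Classical in
/-- Multiplication of a coefficient family by a monomial. -/
def shift {N : ℕ} (β : Fin N → ℕ) : ((Fin N → ℕ) → ℂ) →ₗ[ℂ] ((Fin N → ℕ) → ℂ) where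
  toFun a α := if β ≤ α then a (α - β) else 0
  map_add' a b := by ext α; simp only [Pi.add_apply]; split_ifs <;> simp
  map_smul' c a := by ext α; simp

theorem shift_add {N : ℕ} (β : Fin N → ℕ) (a : (Fin N → ℕ) → ℂ) (α : Fin N → ℕ) :
    shift β a (α + β) = a α := by
  have : β ≤ α + β := fun j => by simp
  simp [shift, this]

theorem shift_eq_zero {N : ℕ} (β : Fin N → ℕ) (a : (Fin N → ℕ) → ℂ) {α : Fin N → ℕ}
    (h : α ∉ range fun γ => γ + β) : shift β a α = 0 := by
  have : ¬β ≤ α := fun hle => h ⟨α - β, by ext j; have : β j ≤ α j := hle j; simp [Nat.sub_add_cancel this]⟩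
  simp [shift, this]

theorem shift_shift {N : ℕ} (β γ : Fin N → ℕ) (a : (Fin N → ℕ) → ℂ) :
    shift β (shift γ a) = shift (γ + β) a := by
  ext α
  by_cases h : α ∈ range fun δ => δ + β
  · obtain ⟨δ, rfl⟩ := h
    simp only [shift_add]
    by_cases h : δ ∈ range fun η => η + γ
    · obtain ⟨η, rfl⟩ := h
      simp only [shift_add, add_assoc]
    · rw [shift_eq_zero _ _ h, shift_eq_zero]
      rintro ⟨η, hη⟩
      exact h ⟨η, by simpa [← add_assoc] using hη⟩
  · rw [shift_eq_zero _ _ h, shift_eq_zero]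
    rintro ⟨η, rfl⟩
    exact h ⟨η + γ, by simp [add_assoc]⟩

theorem hasSum_shift {N : ℕ} {M : Type*} [AddCommMonoid M] [TopologicalSpace M]
    (β : Fin N → ℕ) (a : (Fin N → ℕ) → ℂ) (u : (Fin N → ℕ) → ℂ → M) (hu : ∀ α, u α 0 = 0) {s : M} :
    HasSum (fun α => u α (shift β a α)) s ↔ HasSum (fun α => u (α + β) (a α)) s := by
  rw [← (add_left_injective β).hasSum_iff]
  · simp only [Function.comp_def, shift_add]
  · intro α hα
    rw [shift_eq_zero _ _ hα, hu]

/-- The span of all monomial multiples of members of `S`. -/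
def shiftSpan {N : ℕ} (S : Set ((Fin N → ℕ) → ℂ)) : Submodule ℂ ((Fin N → ℕ) → ℂ) :=
  Submodule.span ℂ {b | ∃ β, ∃ a ∈ S, shift β a = b}

theorem shiftSpan_mono {N : ℕ} {S T : Set ((Fin N → ℕ) → ℂ)} (h : S ⊆ T) :
    shiftSpan S ≤ shiftSpan T :=
  Submodule.span_mono fun _ ⟨β, a, ha, e⟩ => ⟨β, a, h ha, e⟩

theorem subset_shiftSpan {N : ℕ} {S : Set ((Fin N → ℕ) → ℂ)} {a : (Fin N → ℕ) → ℂ} (ha : a ∈ S) :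
    a ∈ shiftSpan S :=
  Submodule.subset_span ⟨0, a, ha, by ext α; simpa using shift_add 0 a α⟩

theorem shift_mem_shiftSpan {N : ℕ} {S : Set ((Fin N → ℕ) → ℂ)} {a : (Fin N → ℕ) → ℂ}
    (ha : a ∈ shiftSpan S) (β : Fin N → ℕ) : shift β a ∈ shiftSpan S := by
  refine Submodule.span_induction ?_ ?_ ?_ ?_ ha
  · rintro _ ⟨γ, b, hb, rfl⟩
    rw [shift_shift]
    exact Submodule.subset_span ⟨_, b, hb, rfl⟩
  · simp
  · intro x y _ _ hx hy
    rw [map_add]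
    exact add_mem hx hy
  · intro c x _ hx
    rw [map_smul]
    exact Submodule.smul_mem _ _ hx

theorem exists_finite_mem_shiftSpan {N : ℕ} {S : Set ((Fin N → ℕ) → ℂ)} {a : (Fin N → ℕ) → ℂ}
    (ha : a ∈ shiftSpan S) : ∃ T ⊆ S, T.Finite ∧ a ∈ shiftSpan T := by
  refine Submodule.span_induction ?_ ?_ ?_ ?_ ha
  · rintro _ ⟨γ, b, hb, rfl⟩
    exact ⟨{b}, by simpa using hb, finite_singleton b,
      shift_mem_shiftSpan (subset_shiftSpan (mem_singleton b)) γ⟩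
  · exact ⟨∅, empty_subset _, finite_empty, zero_mem _⟩
  · rintro x y _ _ ⟨T, hT, hTf, hx⟩ ⟨T', hT', hTf', hy⟩
    exact ⟨T ∪ T', union_subset hT hT', hTf.union hTf',
      add_mem (shiftSpan_mono subset_union_left hx) (shiftSpan_mono subset_union_right hy)⟩
  · rintro c x _ ⟨T, hT, hTf, hx⟩
    exact ⟨T, hT, hTf, Submodule.smul_mem _ _ hx⟩

/-- The monomial `z ^ α`. -/
def mon {N : ℕ} (z : Fin N → ℂ) (α : Fin N → ℕ) : ℂ := ∏ j, z j ^ α j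

theorem mon_add {N : ℕ} (z : Fin N → ℂ) (α β : Fin N → ℕ) : mon z (α + β) = mon z α * mon z β := by
  simp [mon, pow_add, Finset.prod_mul_distrib]

theorem norm_mon_le {N : ℕ} {τ : ℕ} {z : Fin N → ℂ}
    (hz : ∀ j, ‖z j‖ ≤ ((Nat.nth Nat.Prime j : ℝ) ^ τ)⁻¹) (α : Fin N → ℕ) : ‖mon z α‖ ≤ wt τ α := by
  have : wt τ α = ∏ j : Fin N, (((Nat.nth Nat.Prime j : ℝ) ^ τ)⁻¹) ^ α j := by
    simp only [wt, primeKey, Nat.cast_prod, Nat.cast_pow, ← Finset.prod_pow, ← Finset.prod_inv_distrib,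
      inv_pow, ← pow_mul, mul_comm τ]
  rw [this, mon, norm_prod]
  refine Finset.prod_le_prod (fun _ _ => norm_nonneg _) fun j _ => ?_
  rw [norm_pow]
  exact pow_le_pow_left₀ (norm_nonneg _) (hz j) _

theorem summable_mul_mon {N : ℕ} {τ : ℕ} {z : Fin N → ℂ}
    (hz : ∀ j, ‖z j‖ ≤ ((Nat.nth Nat.Prime j : ℝ) ^ τ)⁻¹) {a : (Fin N → ℕ) → ℂ}
    (ha : Summable fun α => ‖a α‖ * wt τ α) : Summable fun α => a α * mon z α :=
  Summable.of_norm_bounded ha fun α => by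
    rw [norm_mul]
    exact mul_le_mul_of_nonneg_left (norm_mon_le hz α) (norm_nonneg _)

theorem summable_wt_of_mem_shiftSpan {N : ℕ} {τ : ℕ} {S : Set ((Fin N → ℕ) → ℂ)}
    (hS : ∀ a ∈ S, Summable fun α => ‖a α‖ * wt τ α) {a : (Fin N → ℕ) → ℂ}
    (ha : a ∈ shiftSpan S) : Summable fun α => ‖a α‖ * wt τ α := by
  refine Submodule.span_induction ?_ ?_ ?_ ?_ ha
  · rintro _ ⟨γ, b, hb, rfl⟩
    refine ((hasSum_shift γ b (fun α c => ‖c‖ * wt τ α) (by simp)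
      (s := ∑' α, ‖b α‖ * wt τ (α + γ))).mpr (Summable.hasSum ?_)).summable
    simp only [wt_add, ← mul_assoc]
    exact (hS b hb).mul_right _
  · simp
  · intro x y _ _ hx hy
    refine Summable.of_nonneg_of_le (fun α => by have := wt_pos τ α; positivity) (fun α => ?_) (hx.add hy)
    rw [← add_mul]
    exact mul_le_mul_of_nonneg_right (norm_add_le _ _) (wt_pos τ α).le
  · intro c x _ hx
    simpa [mul_assoc] using hx.mul_left ‖c‖

theorem tsum_mul_mon_eq_zero {N : ℕ} {τ : ℕ} {z : Fin N → ℂ}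
    (hz : ∀ j, ‖z j‖ ≤ ((Nat.nth Nat.Prime j : ℝ) ^ τ)⁻¹) {S : Set ((Fin N → ℕ) → ℂ)}
    (hS : ∀ a ∈ S, Summable fun α => ‖a α‖ * wt τ α) (h0 : ∀ a ∈ S, ∑' α, a α * mon z α = 0)
    {a : (Fin N → ℕ) → ℂ} (ha : a ∈ shiftSpan S) : ∑' α, a α * mon z α = 0 := by
  suffices h : HasSum (fun α => a α * mon z α) 0 from h.tsum_eq
  refine Submodule.span_induction ?_ ?_ ?_ ?_ ha
  · rintro _ ⟨γ, b, hb, rfl⟩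
    refine (hasSum_shift γ b (fun α c => c * mon z α) (by simp)).mpr ?_
    have := (summable_mul_mon hz (hS b hb)).hasSum.mul_right (mon z γ)
    simpa [mon_add, ← mul_assoc, h0 b hb] using this
  · simp
  · intro x y _ _ hx hy
    simpa [add_mul] using hx.add hy
  · intro c x _ hx
    simpa [mul_assoc] using hx.mul_left c

/-- `α` is the leading exponent of `a`. -/
def IsLead {N : ℕ} (a : (Fin N → ℕ) → ℂ) (α : Fin N → ℕ) : Prop :=
  a α ≠ 0 ∧ ∀ β, primeKey β < primeKey α → a β = 0

/-- The weighted `ℓ¹` norm. -/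
def wnorm {N : ℕ} (τ : ℕ) (a : (Fin N → ℕ) → ℂ) : ℝ := ∑' α, ‖a α‖ * wt τ α

theorem Summable.wt_mono {N : ℕ} {τ m : ℕ} {a : (Fin N → ℕ) → ℂ}
    (h : Summable fun α => ‖a α‖ * wt τ α) : Summable fun α => ‖a α‖ * wt (τ + m) α := by
  refine Summable.of_nonneg_of_le (fun α => by have := wt_pos (τ + m) α; positivity) (fun α => ?_) h
  rw [wt_add_left, ← mul_assoc]
  exact mul_le_of_le_one_right (by have := wt_pos τ α; positivity) (wt_le_one m α)

theorem wnorm_add_le {N : ℕ} {τ : ℕ} {a b : (Fin N → ℕ) → ℂ}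
    (ha : Summable fun α => ‖a α‖ * wt τ α) (hb : Summable fun α => ‖b α‖ * wt τ α) :
    wnorm τ (a + b) ≤ wnorm τ a + wnorm τ b := by
  unfold wnorm
  rw [← ha.tsum_add hb]
  have hle : ∀ α, ‖(a + b) α‖ * wt τ α ≤ ‖a α‖ * wt τ α + ‖b α‖ * wt τ α := fun α => by
    rw [← add_mul]
    exact mul_le_mul_of_nonneg_right (norm_add_le _ _) (wt_pos τ α).le
  exact (Summable.of_nonneg_of_le (fun α => by have := wt_pos τ α; positivity) hle
    (ha.add hb)).tsum_le_tsum hle (ha.add hb)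

theorem hasSum_update_zero {N : ℕ} {τ : ℕ} {a : (Fin N → ℕ) → ℂ}
    (ha : Summable fun α => ‖a α‖ * wt τ α) (γ : Fin N → ℕ) :
    HasSum (fun α => ‖Function.update a γ 0 α‖ * wt τ α) (wnorm τ a - ‖a γ‖ * wt τ γ) := by
  have h := ha.hasSum.update γ 0
  have e1 : Function.update (fun α => ‖a α‖ * wt τ α) γ 0 =
      fun α => ‖Function.update a γ 0 α‖ * wt τ α := by
    funext α
    rcases eq_or_ne α γ with rfl | h <;> simp [*]
  have e2 : wnorm τ a - ‖a γ‖ * wt τ γ = 0 - ‖a γ‖ * wt τ γ + ∑' α, ‖a α‖ * wt τ α := by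
    simp only [wnorm]; ring
  rw [e2, ← e1]
  exact h

theorem eventually_wnorm_update_le {N : ℕ} {τ : ℕ} {a : (Fin N → ℕ) → ℂ} {α : Fin N → ℕ}
    (ha : Summable fun α => ‖a α‖ * wt τ α) (hl : IsLead a α) :
    ∀ᶠ m in atTop, wnorm (τ + m) (Function.update a α 0) ≤ ‖a α‖ * wt (τ + m) α := by
  set κ : ℝ := (primeKey α : ℝ) with hκ
  have hκ0 : 0 < κ := Nat.cast_pos.mpr (primeKey_pos α)
  have hlim : Tendsto (fun m : ℕ => wnorm τ a * (κ / (κ + 1)) ^ m) atTop (𝓝 0) := by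
    simpa using (tendsto_pow_atTop_nhds_zero_of_lt_one (by positivity)
      ((div_lt_one (by positivity)).mpr (by linarith) : κ / (κ + 1) < 1)).const_mul (wnorm τ a)
  have hc : 0 < ‖a α‖ * wt τ α := mul_pos (norm_pos_iff.mpr hl.1) (wt_pos _ _)
  filter_upwards [hlim.eventually (gt_mem_nhds hc)] with m hm
  have hle : ∀ β, ‖Function.update a α 0 β‖ * wt (τ + m) β ≤
      ‖a β‖ * wt τ β * ((κ + 1) ^ m)⁻¹ := by
    intro β
    have hp : 0 ≤ ‖a β‖ * wt τ β * ((κ + 1) ^ m)⁻¹ := by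
      have := wt_pos τ β; positivity
    rcases eq_or_ne β α with rfl | hne
    · simpa using hp
    rw [Function.update_of_ne hne]
    by_cases h0 : a β = 0
    · simp [h0]
    have h1 : primeKey α < primeKey β := by
      refine lt_of_le_of_ne (not_lt.mp fun h => h0 (hl.2 β h)) fun h => hne ?_
      exact (primeKey_injective h).symm
    have h2 : κ + 1 ≤ (primeKey β : ℝ) := by rw [hκ]; exact_mod_cast h1
    rw [wt_add_left, ← mul_assoc]
    refine mul_le_mul_of_nonneg_left ?_ (by have := wt_pos τ β; positivity)
    exact inv_anti₀ (by positivity) (pow_le_pow_left₀ (by positivity) h2 m)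
  have h3 : wnorm (τ + m) (Function.update a α 0) ≤ wnorm τ a * ((κ + 1) ^ m)⁻¹ := by
    rw [wnorm, wnorm, ← tsum_mul_right]
    exact (Summable.of_nonneg_of_le (fun β => by have := wt_pos (τ + m) β; positivity) hle
      (ha.mul_right _)).tsum_le_tsum hle (ha.mul_right _)
  refine h3.trans ?_
  have h4 : wt (τ + m) α = wt τ α * (κ ^ m)⁻¹ := by rw [wt_add_left]; rfl
  rw [h4, ← mul_assoc]
  rw [div_pow] at hm
  have hκm : 0 < κ ^ m := by positivity
  calc wnorm τ a * ((κ + 1) ^ m)⁻¹ = wnorm τ a * (κ ^ m / (κ + 1) ^ m) * (κ ^ m)⁻¹ := by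
        field_simp
    _ ≤ _ := mul_le_mul_of_nonneg_right hm.le (by positivity)

theorem wnorm_smul_shift_update {N : ℕ} {τ : ℕ} {g : (Fin N → ℕ) → ℂ} {α β : Fin N → ℕ} (c : ℂ)
    (hg : Summable fun α => ‖g α‖ * wt τ α)
    (hd : wnorm τ (Function.update g α 0) ≤ ‖g α‖ * wt τ α) :
    Summable (fun γ => ‖(c • shift β (Function.update g α 0)) γ‖ * wt τ γ) ∧
      wnorm τ (c • shift β (Function.update g α 0)) ≤ ‖c * g α‖ * wt τ (α + β) := by
  have h1 : HasSum (fun γ => ‖(c • shift β (Function.update g α 0)) γ‖ * wt τ γ)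
      (‖c‖ * (wnorm τ (Function.update g α 0) * wt τ β)) := by
    simp only [Pi.smul_apply, smul_eq_mul, norm_mul, mul_assoc]
    refine HasSum.mul_left _ ?_
    refine (hasSum_shift β _ (fun α c => ‖c‖ * wt τ α) (by simp)).mpr ?_
    simp only [wt_add, ← mul_assoc]
    exact ((hasSum_update_zero hg α).summable.hasSum).mul_right _
  refine ⟨h1.summable, ?_⟩
  rw [show wnorm τ (c • shift β (Function.update g α 0)) = _ from h1.tsum_eq, norm_mul, wt_add]
  have := mul_le_mul_of_nonneg_left (mul_le_mul_of_nonneg_right hd (wt_pos τ β).le) (norm_nonneg c)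
  linarith

/-- Division with remainder against a dominated system of generators, up to any order. -/
theorem exists_reduction {N : ℕ} {τ : ℕ} {H : Set ((Fin N → ℕ) → ℂ)}
    (hH : ∀ a ∈ H, Summable fun α => ‖a α‖ * wt τ α) {F : Set (Fin N → ℕ)}
    {g : (Fin N → ℕ) → (Fin N → ℕ) → ℂ} (hg : ∀ α ∈ F, g α ∈ shiftSpan H)
    (hlead : ∀ α ∈ F, IsLead (g α) α)
    (hdom : ∀ α ∈ F, wnorm τ (Function.update (g α) α 0) ≤ ‖g α α‖ * wt τ α)
    (hF : ∀ h ∈ shiftSpan H, ∀ γ, IsLead h γ → ∃ α ∈ F, α ≤ γ) {z : Fin N → ℂ}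
    (hz : ∀ j, ‖z j‖ ≤ ((Nat.nth Nat.Prime j : ℝ) ^ τ)⁻¹)
    (h0 : ∀ α ∈ F, ∑' β, g α β * mon z β = 0) {h : (Fin N → ℕ) → ℂ} (hh : h ∈ shiftSpan H) (k : ℕ) :
    ∃ h' ∈ shiftSpan H, (∀ β, primeKey β < k → h' β = 0) ∧ wnorm τ h' ≤ wnorm τ h ∧
      ∑' β, h' β * mon z β = ∑' β, h β * mon z β := by
  induction k with
  | zero => exact ⟨h, hh, by simp, le_rfl, rfl⟩
  | succ k ih =>
    obtain ⟨h', hh', hk, hn, he⟩ := ih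
    by_cases hγ : ∃ γ, primeKey γ = k ∧ h' γ ≠ 0
    swap
    · push Not at hγ
      refine ⟨h', hh', fun β hβ => ?_, hn, he⟩
      rcases Nat.lt_succ_iff_lt_or_eq.mp hβ with h1 | h1
      · exact hk β h1
      · exact hγ β h1
    obtain ⟨γ, rfl, hγ0⟩ := hγ
    obtain ⟨α, hα, hαγ⟩ := hF h' hh' γ ⟨hγ0, hk⟩
    obtain ⟨β, rfl⟩ : ∃ β, γ = α + β := ⟨γ - α, by ext j; have : α j ≤ γ j := hαγ j; simp; omega⟩
    set c : ℂ := -(h' (α + β) / g α α) with hc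
    have hgα : g α α ≠ 0 := (hlead α hα).1
    have hS := summable_wt_of_mem_shiftSpan hH hh'
    have hSg := summable_wt_of_mem_shiftSpan hH (hg α hα)
    have hmem : shift β (g α) ∈ shiftSpan H := shift_mem_shiftSpan (hg α hα) β
    have hcv : c * g α α = -h' (α + β) := by rw [hc]; field_simp
    obtain ⟨hs1, hs2⟩ := wnorm_smul_shift_update (β := β) c hSg (hdom α hα)
    have hu := hasSum_update_zero hS (α + β)
    have hdec : h' + c • shift β (g α) =
        Function.update h' (α + β) 0 + c • shift β (Function.update (g α) α 0) := by
      funext δ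
      simp only [Pi.add_apply, Pi.smul_apply, smul_eq_mul]
      rcases eq_or_ne δ (α + β) with rfl | hδ
      · simp [shift_add, hcv]
      · rw [Function.update_of_ne hδ]
        by_cases hr : δ ∈ range fun η => η + β
        · obtain ⟨η, rfl⟩ := hr
          have : η ≠ α := fun e => hδ (by simp [e])
          simp [shift_add, Function.update_of_ne this]
        · simp [shift_eq_zero _ _ hr]
    refine ⟨h' + c • shift β (g α), add_mem hh' (Submodule.smul_mem _ _ hmem), ?_, ?_, ?_⟩
    · intro δ hδ
      have hz' : ∀ δ, primeKey δ < primeKey (α + β) → shift β (g α) δ = 0 := by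
        intro δ hδ
        by_cases hr : δ ∈ range fun η => η + β
        · obtain ⟨η, rfl⟩ := hr
          rw [shift_add]
          refine (hlead α hα).2 η ?_
          rw [primeKey_add, primeKey_add] at hδ
          exact lt_of_mul_lt_mul_right hδ (Nat.zero_le _)
        · exact shift_eq_zero _ _ hr
      rcases Nat.lt_succ_iff_lt_or_eq.mp hδ with h1 | h1
      · simp [hk δ h1, hz' δ h1]
      · rw [primeKey_injective h1]
        simp [shift_add, hcv]
    · rw [hdec]
      refine (wnorm_add_le hu.summable hs1).trans (le_trans ?_ hn)
      rw [show wnorm τ (Function.update h' (α + β) 0) = _ from hu.tsum_eq]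
      rw [hcv, norm_neg] at hs2
      linarith
    · have e1 : HasSum (fun δ => shift β (g α) δ * mon z δ) 0 := by
        refine (hasSum_shift β (g α) (fun α c => c * mon z α) (by simp)).mpr ?_
        have := (summable_mul_mon hz hSg).hasSum.mul_right (mon z β)
        simpa [mon_add, ← mul_assoc, h0 α hα] using this
      have e2 := (summable_mul_mon hz hS).hasSum.add (e1.mul_left c)
      have e3 : ∀ δ, (h' + c • shift β (g α)) δ * mon z δ =
          h' δ * mon z δ + c * (shift β (g α) δ * mon z δ) := fun δ => by
        simp only [Pi.add_apply, Pi.smul_apply, smul_eq_mul]; ring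
      simp only [e3]
      rw [e2.tsum_eq, mul_zero, add_zero, he]

theorem exists_finite_minimal_le {N : ℕ} (S : Set (Fin N → ℕ)) :
    ∃ F ⊆ S, F.Finite ∧ ∀ γ ∈ S, ∃ α ∈ F, α ≤ γ := by
  refine ⟨{α | Minimal (· ∈ S) α}, fun α h => h.prop, ?_, fun γ hγ => ?_⟩
  · exact WellQuasiOrderedLE.finite_of_isAntichain (setOfPred_minimal_antichain _)
  · obtain ⟨α, h1, h2⟩ := exists_minimal_le_of_wellFoundedLT (· ∈ S) γ hγ
    exact ⟨α, h2, h1⟩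

/-- The common zero set, near the origin, of power series with a common domain of convergence is
that of finitely many of them. -/
theorem exists_finite_subfamily {N : ℕ} {τ₀ : ℕ} {H : Set ((Fin N → ℕ) → ℂ)}
    (hH : ∀ a ∈ H, Summable fun α => ‖a α‖ * wt τ₀ α) :
    ∃ τ, ∃ S ⊆ H, S.Finite ∧ ∀ z : Fin N → ℂ, (∀ j, ‖z j‖ ≤ ((Nat.nth Nat.Prime j : ℝ) ^ τ)⁻¹) →
      (∀ a ∈ S, ∑' α, a α * mon z α = 0) → ∀ a ∈ H, ∑' α, a α * mon z α = 0 := by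
  obtain ⟨F, hFS, hFfin, hF⟩ := exists_finite_minimal_le {γ | ∃ h ∈ shiftSpan H, IsLead h γ}
  have hFS' : ∀ γ ∈ F, ∃ h : (Fin N → ℕ) → ℂ, h ∈ shiftSpan H ∧ IsLead h γ := fun γ hγ => hFS hγ
  choose! g hg hlead using hFS'
  have hdom : ∀ᶠ m in atTop, ∀ α ∈ F,
      wnorm (τ₀ + m) (Function.update (g α) α 0) ≤ ‖g α α‖ * wt (τ₀ + m) α :=
    (eventually_all_finite hFfin).mpr fun α hα =>
      eventually_wnorm_update_le (summable_wt_of_mem_shiftSpan hH (hg α hα)) (hlead α hα)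
  obtain ⟨m, hdom⟩ := hdom.exists
  choose! T hTH hTfin hT using fun α (hα : α ∈ F) => exists_finite_mem_shiftSpan (hg α hα)
  set τ := τ₀ + m
  have hHτ : ∀ a ∈ H, Summable fun α => ‖a α‖ * wt τ α := fun a ha => (hH a ha).wt_mono
  refine ⟨τ + 1, ⋃ α ∈ F, T α, iUnion₂_subset hTH, hFfin.biUnion hTfin, fun z hz h0 a ha => ?_⟩
  have hz' : ∀ j : Fin N, ‖z j‖ ≤ ((Nat.nth Nat.Prime j : ℝ) ^ τ)⁻¹ := fun j => by
    refine (hz j).trans (inv_anti₀ ?_ ?_)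
    · have := (Nat.prime_nth_prime j).pos; positivity
    · exact pow_le_pow_right₀ (by exact_mod_cast (Nat.prime_nth_prime j).one_le) (Nat.le_succ _)
  have hg0 : ∀ α ∈ F, ∑' β, g α β * mon z β = 0 := fun α hα =>
    tsum_mul_mon_eq_zero hz' (fun b hb => hHτ b (hTH α hα hb))
      (fun b hb => h0 b (mem_biUnion hα hb)) (hT α hα)
  have key : ∀ k : ℕ, ‖∑' α, a α * mon z α‖ ≤ ((k + 1 : ℕ) : ℝ)⁻¹ * wnorm τ a := by
    intro k
    obtain ⟨h', hh', hk, hn, he⟩ := exists_reduction hHτ hg hlead hdom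
      (fun h hh γ hl => hF γ ⟨h, hh, hl⟩) hz' hg0 (subset_shiftSpan ha) (k + 1)
    rw [← he]
    have hS := summable_wt_of_mem_shiftSpan hHτ hh'
    refine (tsum_of_norm_bounded (hS.hasSum.mul_left ((k + 1 : ℕ) : ℝ)⁻¹) fun α => ?_).trans
      (mul_le_mul_of_nonneg_left hn (by positivity))
    rcases lt_or_ge (primeKey α) (k + 1) with h1 | h1
    · have := wt_pos τ α
      rw [hk α h1]
      simp
    · rw [norm_mul]
      have h2 := norm_mon_le hz α
      have h3 : wt 1 α ≤ ((k + 1 : ℕ) : ℝ)⁻¹ := by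
        rw [wt, pow_one]
        exact inv_anti₀ (by positivity) (by exact_mod_cast h1)
      rw [wt_add_left] at h2
      calc ‖h' α‖ * ‖mon z α‖ ≤ ‖h' α‖ * (wt τ α * ((k + 1 : ℕ) : ℝ)⁻¹) :=
            mul_le_mul_of_nonneg_left (h2.trans (mul_le_mul_of_nonneg_left h3 (wt_pos τ α).le))
              (norm_nonneg _)
        _ = _ := by ring
  have hlim : Tendsto (fun k : ℕ => ((k + 1 : ℕ) : ℝ)⁻¹ * wnorm τ a) atTop (𝓝 0) := by
    have h1 : Tendsto (fun k : ℕ => ((k + 1 : ℕ) : ℝ)⁻¹) atTop (𝓝 0) :=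
      (tendsto_inv_atTop_zero.comp tendsto_natCast_atTop_atTop).comp (tendsto_add_atTop_nat 1)
    simpa using h1.mul_const (wnorm τ a)
  exact norm_le_zero_iff.mp (ge_of_tendsto' hlim key)

/-- The multi-index counting the letters of a word. -/
def letterCount {N : ℕ} (w : Σ n : ℕ, Fin n → Fin N) (j : Fin N) : ℕ :=
  (Finset.univ.filter fun i => w.2 i = j).card

theorem prod_pow_letterCount {N : ℕ} {R : Type*} [CommMonoid R] (w : Σ n : ℕ, Fin n → Fin N)
    (u : Fin N → R) : ∏ j, u j ^ letterCount w j = ∏ i, u (w.2 i) := by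
  rw [← Finset.prod_fiberwise' Finset.univ w.2 u]
  exact Finset.prod_congr rfl fun j _ => by rw [Finset.prod_const, letterCount]

theorem wt_letterCount_le {N τ : ℕ} (w : Σ n : ℕ, Fin n → Fin N) :
    wt τ (letterCount w) ≤ (((2 : ℝ) ^ τ)⁻¹) ^ w.1 := by
  have h1 : wt τ (letterCount w) = ∏ i, ((Nat.nth Nat.Prime (w.2 i) : ℝ) ^ τ)⁻¹ := by
    rw [← prod_pow_letterCount w fun j : Fin N => ((Nat.nth Nat.Prime j : ℝ) ^ τ)⁻¹]
    simp only [wt, primeKey, Nat.cast_prod, Nat.cast_pow, ← Finset.prod_pow, ← Finset.prod_inv_distrib,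
      inv_pow, ← pow_mul, mul_comm τ]
  rw [h1]
  refine (Finset.prod_le_prod (g := fun _ => ((2 : ℝ) ^ τ)⁻¹) (fun i _ => by positivity)
    fun i _ => ?_).trans_eq (by simp)
  exact inv_anti₀ (by positivity) (pow_le_pow_left₀ (by norm_num)
    (by exact_mod_cast (Nat.prime_nth_prime _).two_le) _)

/-- Collecting the words with the same letters in a noncommutative expansion. -/
theorem exists_monomial_coeffs (N : ℕ) (K : ℝ) (hK : 0 ≤ K) : ∃ τ : ℕ,
    ∀ c : (n : ℕ) → (Fin n → Fin N) → ℂ, (∃ C : ℝ, ∀ n w, ‖c n w‖ ≤ C * K ^ n) →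
      ∃ a : (Fin N → ℕ) → ℂ, (Summable fun α => ‖a α‖ * wt τ α) ∧
        ∀ z : Fin N → ℂ, (∀ j, ‖z j‖ ≤ ((Nat.nth Nat.Prime j : ℝ) ^ τ)⁻¹) →
          ∑' n, ∑ w : Fin n → Fin N, c n w * ∏ i, z (w i) = ∑' α, a α * mon z α := by
  obtain ⟨τ, hτ⟩ := pow_unbounded_of_one_lt (N * K) (one_lt_two)
  refine ⟨τ, fun c ⟨C, hC⟩ => ?_⟩
  have hlt : N * (K * ((2 : ℝ) ^ τ)⁻¹) < 1 := by
    rw [← mul_assoc, ← div_eq_mul_inv, div_lt_one (by positivity)]; exact hτ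
  set c' : (Σ n : ℕ, Fin n → Fin N) → ℂ := fun w => c w.1 w.2 with hc'
  have hsum : Summable fun w => ‖c' w‖ * wt τ (letterCount w) := by
    have h1 : Summable fun w : Σ n : ℕ, Fin n → Fin N => C * (K * ((2 : ℝ) ^ τ)⁻¹) ^ w.1 := by
      refine Summable.mul_left _ ?_
      refine (summable_sigma_of_nonneg fun w => by positivity).mpr ⟨fun n => .of_finite, ?_⟩
      have : ∀ n : ℕ, ∑' _ : Fin n → Fin N, (K * ((2 : ℝ) ^ τ)⁻¹) ^ n = (N * (K * ((2 : ℝ) ^ τ)⁻¹)) ^ n := by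
        intro n
        rw [tsum_fintype, Finset.sum_const, mul_pow (N : ℝ)]
        simp
      simp only [this]
      exact summable_geometric_of_lt_one (by positivity) hlt
    refine Summable.of_nonneg_of_le (fun w => by have := wt_pos τ (letterCount w); positivity)
      (fun w => ?_) h1
    rw [mul_pow, ← mul_assoc]
    exact mul_le_mul (hC _ _) (wt_letterCount_le w) (wt_pos _ _).le ((norm_nonneg _).trans (hC w.1 w.2))
  let e := Equiv.sigmaFiberEquiv (letterCount (N := N))
  have hsum' : Summable fun q => ‖c' (e q)‖ * wt τ (letterCount (e q)) := e.summable_iff.mpr hsum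
  have hq : ∀ q, letterCount (e q) = q.1 := fun q => q.2.2
  simp only [hq] at hsum'
  have hfib : ∀ α, Summable fun q : {w : Σ n, Fin n → Fin N // letterCount w = α} => ‖c' q.1‖ := fun α => by
    have := (hsum'.sigma_factor α).mul_right (wt τ α)⁻¹
    refine this.congr fun q => ?_
    rw [mul_assoc, mul_inv_cancel₀ (wt_pos τ α).ne', mul_one]
    rfl
  refine ⟨fun α => ∑' q : {w : Σ n, Fin n → Fin N // letterCount w = α}, c' q.1, ?_, fun z hz => ?_⟩
  · refine Summable.of_nonneg_of_le (fun α => by have := wt_pos τ α; positivity) (fun α => ?_)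
      hsum'.sigma
    have hs : ∑' q : {w : Σ n, Fin n → Fin N // letterCount w = α}, ‖c' q.1‖ * wt τ α =
        (∑' q : {w : Σ n, Fin n → Fin N // letterCount w = α}, ‖c' q.1‖) * wt τ α :=
      tsum_mul_right
    refine le_of_le_of_eq ?_ hs.symm
    exact mul_le_mul_of_nonneg_right (norm_tsum_le_tsum_norm (hfib α)) (wt_pos _ _).le
  · have h1 : Summable fun w => c' w * mon z (letterCount w) :=
      Summable.of_norm_bounded hsum fun w => by
        rw [norm_mul]
        exact mul_le_mul_of_nonneg_left (norm_mon_le hz _) (norm_nonneg _)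
    have h2 : ∑' w, c' w * mon z (letterCount w) =
        ∑' n, ∑ w : Fin n → Fin N, c n w * ∏ i, z (w i) := by
      rw [h1.tsum_sigma]
      refine tsum_congr fun n => ?_
      rw [tsum_fintype]
      refine Finset.sum_congr rfl fun w _ => ?_
      rw [mon, prod_pow_letterCount]
    have h3 : Summable fun q => c' (e q) * mon z q.1 :=
      (e.summable_iff.mpr h1).congr fun q => by simp only [Function.comp_apply, hq]
    rw [← h2, ← e.tsum_eq]
    simp only [hq]
    rw [h3.tsum_sigma]
    refine tsum_congr fun α => ?_
    exact tsum_mul_right (L := .unconditional _) (a := mon z α)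
      (f := fun q : {w : Σ n, Fin n → Fin N // letterCount w = α} => c' q.1)

/-- A strong Noetherian property: the common zero set, near a point, of holomorphic functions with
a common ball of convergence is that of finitely many of them. -/
theorem exists_finite_common_zero {N : ℕ} {κ : Type*} {f : κ → (Fin N → ℂ) → ℂ} {x : Fin N → ℂ}
    {r : ℝ≥0∞} (hr : 0 < r) (hf : ∀ k, ∃ p : FormalMultilinearSeries ℂ (Fin N → ℂ) ℂ,
      HasFPowerSeriesOnBall (f k) p x r) :
    ∃ ε > 0, ∃ S : Set κ, S.Finite ∧
      ∀ z ∈ Metric.ball x ε, (∀ k ∈ S, f k z = 0) → ∀ k, f k z = 0 := by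
  choose p hp using hf
  obtain ⟨r', hr'0, hr'r⟩ := ENNReal.lt_iff_exists_nnreal_btwn.mp hr
  have hr'0' : (0 : ℝ) < r' := by exact_mod_cast hr'0
  obtain ⟨τ, hτ⟩ := exists_monomial_coeffs N (r' : ℝ)⁻¹ (by positivity)
  have hcoef : ∀ k, ∃ a : (Fin N → ℕ) → ℂ, (Summable fun α => ‖a α‖ * wt τ α) ∧
      ∀ z : Fin N → ℂ, (∀ j, ‖z j‖ ≤ ((Nat.nth Nat.Prime j : ℝ) ^ τ)⁻¹) → ‖z‖ < r' →
        f k (x + z) = ∑' α, a α * mon z α := by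
    intro k
    obtain ⟨C, -, hC⟩ := (p k).norm_mul_pow_le_of_lt_radius (hr'r.trans_le (hp k).r_le)
    obtain ⟨a, ha, hz⟩ := hτ (fun n w => p k n fun i => Pi.single (w i) 1) ⟨C, fun n w => by
      refine ((p k n).le_opNorm _).trans ?_
      have : ∏ i, ‖(Pi.single (w i) 1 : Fin N → ℂ)‖ = 1 :=
        Finset.prod_eq_one fun i _ => by rw [Pi.norm_single, norm_one]
      rw [this, mul_one, inv_pow, ← div_eq_mul_inv, le_div_iff₀ (by positivity)]
      exact hC n⟩
    refine ⟨a, ha, fun z hzj hzr => ?_⟩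
    rw [← hz z hzj]
    have hmem : z ∈ Metric.eball (0 : Fin N → ℂ) r := by
      rw [mem_eball_zero_iff]
      refine lt_of_lt_of_le ?_ hr'r.le
      rw [← ofReal_norm, ← ENNReal.ofReal_coe_nnreal]
      exact (ENNReal.ofReal_lt_ofReal_iff hr'0').mpr hzr
    rw [← ((hp k).hasSum hmem).tsum_eq]
    refine tsum_congr fun n => ?_
    have hzs : z = ∑ j, z j • (Pi.single j 1 : Fin N → ℂ) := by
      ext i; simp [Finset.sum_apply, Pi.single_apply]
    conv_lhs => rw [hzs]
    rw [ContinuousMultilinearMap.map_sum]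
    refine Finset.sum_congr rfl fun w _ => ?_
    rw [ContinuousMultilinearMap.map_smul_univ, smul_eq_mul, mul_comm]
  choose a ha hfa using hcoef
  obtain ⟨τ', S, hS, hSf, hS0⟩ := exists_finite_subfamily (H := range a) (τ₀ := τ) (by
    rintro _ ⟨k, rfl⟩
    exact ha k)
  rcases isEmpty_or_nonempty κ with hκ | hκ
  · exact ⟨1, one_pos, ∅, finite_empty, fun z _ _ k => hκ.elim k⟩
  have hS' : ∀ s ∈ S, ∃ k, a k = s := fun s hs => hS hs
  choose! j hj using hS'
  have hev : ∀ᶠ z in 𝓝 x, ‖z - x‖ < r' ∧ (∀ i, ‖(z - x) i‖ ≤ ((Nat.nth Nat.Prime i : ℝ) ^ τ)⁻¹) ∧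
      ∀ i, ‖(z - x) i‖ ≤ ((Nat.nth Nat.Prime i : ℝ) ^ τ')⁻¹ := by
    have hpos : ∀ (i : Fin N) (t : ℕ), 0 < ((Nat.nth Nat.Prime i : ℝ) ^ t)⁻¹ := fun i t => by
      have : (0 : ℝ) < Nat.nth Nat.Prime i := Nat.cast_pos.mpr (Nat.prime_nth_prime _).pos
      positivity
    have hc : ∀ i : Fin N, Tendsto (fun z : Fin N → ℂ => ‖(z - x) i‖) (𝓝 x) (𝓝 0) := fun i => by
      have : Continuous fun z : Fin N → ℂ => ‖(z - x) i‖ := by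
        simp only [Pi.sub_apply]; fun_prop
      simpa using this.tendsto x
    refine Filter.Eventually.and ?_ (.and ?_ ?_)
    · have : Tendsto (fun z : Fin N → ℂ => ‖z - x‖) (𝓝 x) (𝓝 0) := by
        simpa using (continuous_id.sub continuous_const).norm.tendsto (x := x)
          (f := fun z : Fin N → ℂ => ‖z - x‖)
      exact this.eventually (gt_mem_nhds hr'0')
    · exact eventually_all.mpr fun i => (hc i).eventually (ge_mem_nhds (hpos i τ))
    · exact eventually_all.mpr fun i => (hc i).eventually (ge_mem_nhds (hpos i τ'))
  obtain ⟨ε, hε, hball⟩ := Metric.eventually_nhds_iff_ball.mp hev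
  refine ⟨ε, hε, j '' S, hSf.image j, fun z hz h0 k => ?_⟩
  obtain ⟨h1, h2, h3⟩ := hball z hz
  have key : ∀ k, f k z = ∑' α, a k α * mon (z - x) α := fun k => by
    rw [← hfa k (z - x) h2 h1, add_sub_cancel]
  rw [key]
  refine hS0 (z - x) h3 (fun s hs => ?_) _ (mem_range_self k)
  have := h0 (j s) (mem_image_of_mem j hs)
  rwa [key, hj s hs] at this

/-- The real basis of `ℂ^N`. -/
def reBasis (N : ℕ) : Fin N ⊕ Fin N → (Fin N → ℂ)
  | .inl j => Pi.single j 1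
  | .inr j => Pi.single j I

theorem norm_reBasis (N : ℕ) (s : Fin N ⊕ Fin N) : ‖reBasis N s‖ = 1 := by
  rcases s with j | j <;> simp [reBasis, Pi.norm_single]

/-- The complexified real coordinates: at `(z, star z)` these are the real and imaginary parts. -/
def cxCoord (N : ℕ) : Fin N ⊕ Fin N → ((Fin N → ℂ) × (Fin N → ℂ) →L[ℂ] ℂ)
  | .inl j => (2⁻¹ : ℂ) • ((ContinuousLinearMap.proj j).comp (.fst ℂ _ _) +
      (ContinuousLinearMap.proj j).comp (.snd ℂ _ _))
  | .inr j => (-(2⁻¹ * I) : ℂ) • ((ContinuousLinearMap.proj j).comp (.fst ℂ _ _) -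
      (ContinuousLinearMap.proj j).comp (.snd ℂ _ _))

theorem cxCoord_swap {N : ℕ} (s : Fin N ⊕ Fin N) (z w : Fin N → ℂ) :
    cxCoord N s (star w, star z) = star (cxCoord N s (z, w)) := by
  rcases s with j | j
  · simp [cxCoord, add_comm]
  · simp [cxCoord]; ring

/-- The real coordinates on `ℂ^N`. -/
def reCoord {N : ℕ} (z : Fin N → ℂ) : Fin N ⊕ Fin N → ℝ
  | .inl j => (z j).re
  | .inr j => (z j).im

theorem cxCoord_self {N : ℕ} (s : Fin N ⊕ Fin N) (z : Fin N → ℂ) :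
    cxCoord N s (z, star z) = (reCoord z s : ℂ) := by
  rcases s with j | j <;> apply Complex.ext <;> simp [cxCoord, reCoord] <;> ring

theorem sum_reCoord_smul {N : ℕ} (z : Fin N → ℂ) : ∑ s, reCoord z s • reBasis N s = z := by
  rw [Fintype.sum_sum_type]
  ext i
  simp only [reCoord, reBasis, Pi.add_apply, Finset.sum_apply, Pi.smul_apply, Pi.single_apply,
    smul_ite, smul_zero, Finset.sum_ite_eq, Finset.mem_univ, if_true]
  simp only [Complex.real_smul, mul_one]
  exact Complex.re_add_im _

/-- The complexification of a real multilinear form on `ℂ^N`. -/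
def cxSeries {N : ℕ} (p : FormalMultilinearSeries ℝ (Fin N → ℂ) ℝ) :
    FormalMultilinearSeries ℂ ((Fin N → ℂ) × (Fin N → ℂ)) ℂ := fun n =>
  ∑ b : Fin n → Fin N ⊕ Fin N, (p n fun i => reBasis N (b i) : ℂ) •
    (ContinuousMultilinearMap.mkPiAlgebra ℂ (Fin n) ℂ).compContinuousLinearMap
      fun i => cxCoord N (b i)

theorem cxSeries_apply {N : ℕ} (p : FormalMultilinearSeries ℝ (Fin N → ℂ) ℝ) (n : ℕ)
    (v : Fin n → (Fin N → ℂ) × (Fin N → ℂ)) :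
    cxSeries p n v = ∑ b : Fin n → Fin N ⊕ Fin N, (p n fun i => reBasis N (b i) : ℂ) *
      ∏ i, cxCoord N (b i) (v i) := by
  simp [cxSeries]

theorem cxSeries_self {N : ℕ} (p : FormalMultilinearSeries ℝ (Fin N → ℂ) ℝ) (n : ℕ)
    (z : Fin N → ℂ) : (cxSeries p n fun _ => (z, star z)) = (p n fun _ => z : ℂ) := by
  rw [cxSeries_apply]
  conv_rhs => rw [← sum_reCoord_smul z, ContinuousMultilinearMap.map_sum]
  rw [Complex.ofReal_sum]
  refine Finset.sum_congr rfl fun b _ => ?_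
  rw [ContinuousMultilinearMap.map_smul_univ]
  simp only [cxCoord_self, smul_eq_mul]
  push_cast
  ring

theorem cxSeries_swap {N : ℕ} (p : FormalMultilinearSeries ℝ (Fin N → ℂ) ℝ) (n : ℕ)
    (z w : Fin N → ℂ) :
    (cxSeries p n fun _ => (star w, star z)) = star (cxSeries p n fun _ => (z, w)) := by
  simp only [cxSeries_apply, cxCoord_swap, star_sum, star_mul', star_prod]
  simp

theorem exists_norm_cxSeries_le (N : ℕ) : ∃ L : ℝ, 0 ≤ L ∧
    ∀ (p : FormalMultilinearSeries ℝ (Fin N → ℂ) ℝ) (n : ℕ), ‖cxSeries p n‖ ≤ L ^ n * ‖p n‖ := by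
  set M : ℝ := ∑ s, ‖cxCoord N s‖
  have hM : ∀ s, ‖cxCoord N s‖ ≤ M := fun s =>
    Finset.single_le_sum (f := fun s => ‖cxCoord N s‖) (fun _ _ => norm_nonneg _) (Finset.mem_univ s)
  have hM0 : 0 ≤ M := Finset.sum_nonneg fun _ _ => norm_nonneg _
  refine ⟨(N + N) * M, by positivity, fun p n => ?_⟩
  refine (norm_sum_le _ _).trans ?_
  have : ∀ b : Fin n → Fin N ⊕ Fin N, ‖(p n fun i => reBasis N (b i) : ℂ) •
      (ContinuousMultilinearMap.mkPiAlgebra ℂ (Fin n) ℂ).compContinuousLinearMap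
      fun i => cxCoord N (b i)‖ ≤ ‖p n‖ * M ^ n := by
    intro b
    rw [norm_smul]
    refine mul_le_mul ?_ ?_ (norm_nonneg _) (norm_nonneg _)
    · rw [Complex.norm_real]
      refine ((p n).le_opNorm _).trans_eq ?_
      simp [norm_reBasis]
    · refine (ContinuousMultilinearMap.norm_compContinuousLinearMap_le _ _).trans ?_
      rw [ContinuousMultilinearMap.norm_mkPiAlgebra, one_mul]
      refine (Finset.prod_le_prod (fun _ _ => norm_nonneg _) fun i _ => hM (b i)).trans_eq ?_
      simp
  refine (Finset.sum_le_sum fun b _ => this b).trans_eq ?_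
  simp [mul_pow]
  ring

/-- Real-analytic functions on `ℂ^N` extend to holomorphic functions of `(z, star z)`. -/
theorem exists_complexification {N : ℕ} {f : (Fin N → ℂ) → ℝ} {p : Fin N → ℂ}
    (hf : AnalyticAt ℝ f p) :
    ∃ (F : (Fin N → ℂ) × (Fin N → ℂ) → ℂ)
      (q : FormalMultilinearSeries ℂ ((Fin N → ℂ) × (Fin N → ℂ)) ℂ) (R : ℝ≥0∞),
      HasFPowerSeriesOnBall F q (p, star p) R ∧
      (∀ z ∈ Metric.eball p R, F (z, star z) = f z) ∧
      ∀ z u, F (u, star z) = star (F (z, star u)) := by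
  obtain ⟨s, r, hs⟩ := hf
  obtain ⟨L, hL0, hL⟩ := exists_norm_cxSeries_le N
  obtain ⟨r', hr'0, hr'r⟩ := ENNReal.lt_iff_exists_nnreal_btwn.mp hs.r_pos
  have hr'0' : (0 : ℝ) < r' := by exact_mod_cast hr'0
  obtain ⟨C, -, hC⟩ := s.norm_mul_pow_le_of_lt_radius (hr'r.trans_le hs.r_le)
  have hrad : 0 < (cxSeries s).radius := by
    refine lt_of_lt_of_le ?_ ((cxSeries s).le_radius_of_bound C
      (r := Real.toNNReal (r' * (L + 1)⁻¹)) fun n => ?_)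
    · exact ENNReal.coe_pos.2 (Real.toNNReal_pos.2 (by positivity))
    · rw [Real.coe_toNNReal _ (by positivity), mul_pow]
      have h1 : L ^ n * ((L + 1)⁻¹) ^ n ≤ 1 := by
        rw [← mul_pow]
        refine pow_le_one₀ (by positivity) ?_
        rw [← div_eq_mul_inv, div_le_one (by positivity)]
        linarith
      calc _ ≤ (L ^ n * ‖s n‖) * (r' ^ n * ((L + 1)⁻¹) ^ n) := by gcongr; exact hL s n
        _ = (L ^ n * ((L + 1)⁻¹) ^ n) * (‖s n‖ * r' ^ n) := by ring
        _ ≤ 1 * C := by gcongr; exact hC n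
        _ = C := one_mul C
  have h0 := (cxSeries s).hasFPowerSeriesOnBall hrad
  have h1 := h0.comp_sub (p, star p)
  rw [zero_add] at h1
  refine ⟨_, _, min (cxSeries s).radius r, h1.mono (lt_min hrad hs.r_pos) (min_le_left _ _),
    fun z hz => ?_, fun z u => ?_⟩
  · have hy : z - p ∈ Metric.eball (0 : Fin N → ℂ) r := by
      rw [mem_eball_zero_iff, ← edist_eq_enorm_sub]
      exact lt_of_lt_of_le hz (min_le_right _ _)
    have := hs.hasSum hy
    rw [add_sub_cancel] at this
    rw [Prod.mk_sub_mk, ← star_sub, FormalMultilinearSeries.sum]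
    simp only [cxSeries_self]
    rw [← this.tsum_eq, Complex.ofReal_tsum]
  · simp only [Prod.mk_sub_mk, FormalMultilinearSeries.sum]
    rw [tsum_star]
    refine tsum_congr fun n => ?_
    rw [← cxSeries_swap, star_sub, star_sub, star_star, star_star]

/-- The slices of a holomorphic function have a common ball of convergence. -/
theorem exists_slice_radius {N : ℕ} {F : (Fin N → ℂ) × (Fin N → ℂ) → ℂ}
    {q : FormalMultilinearSeries ℂ ((Fin N → ℂ) × (Fin N → ℂ)) ℂ} {p p' : Fin N → ℂ} {R : ℝ≥0∞}
    (hF : HasFPowerSeriesOnBall F q (p, p') R) :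
    ∃ r : ℝ≥0∞, 0 < r ∧ ∀ w ∈ Metric.eball p' r,
      ∃ s : FormalMultilinearSeries ℂ (Fin N → ℂ) ℂ,
        HasFPowerSeriesOnBall (fun z => F (z, w)) s p r := by
  refine ⟨R / 2, ENNReal.div_pos hF.r_pos.ne' (by simp), fun w hw => ?_⟩
  have hy : ‖((0 : Fin N → ℂ), w - p')‖ₑ < R / 2 := by
    have : ‖((0 : Fin N → ℂ), w - p')‖ₑ = edist w p' := by
      rw [edist_eq_enorm_sub, ← ofReal_norm, ← ofReal_norm, Prod.norm_def]
      simp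
    rw [this]; exact hw
  have h1 := hF.changeOrigin (y := (0, w - p')) (hy.trans_le ENNReal.half_le_self)
  have h2 := (h1.mono (ENNReal.div_pos hF.r_pos.ne' (by simp)) (ENNReal.le_sub_of_add_le_right
    (by simp) ((add_le_add_right hy.le _).trans_eq (ENNReal.add_halves R)))).comp_sub (0, -w)
  have e : (p, p') + (0, w - p') + (0, -w) = ContinuousLinearMap.inl ℂ (Fin N → ℂ) (Fin N → ℂ) p := by
    ext <;> simp
  rw [e] at h2
  have h3 := h2.compContinuousLinearMap
  refine ⟨_, (h3.mono (ENNReal.div_pos hF.r_pos.ne' (by simp)) ?_).congr fun z _ => ?_⟩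
  · conv_lhs => rw [← div_one (R / 2)]
    refine ENNReal.div_le_div_left ?_ _
    rw [← ofReal_norm, ENNReal.ofReal_le_one]
    exact ContinuousLinearMap.norm_inl_le_one ..
  · simp

/-- Linearly independent functionals are jointly surjective. -/
theorem LinearIndependent.range_pi_eq_top {𝕂 E : Type*} [RCLike 𝕂] [NormedAddCommGroup E]
    [NormedSpace 𝕂 E] {m : ℕ} {L : Fin m → E →L[𝕂] 𝕂} (hL : LinearIndependent 𝕂 L) :
    (ContinuousLinearMap.pi L).range = ⊤ := by
  by_contra hne
  obtain ⟨φ, hφ0, hφ⟩ := Submodule.exists_le_ker_of_lt_top _ (lt_top_iff_ne_top.mpr hne)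
  have hφs : ∀ y : Fin m → 𝕂, φ y = ∑ i, y i * φ (Pi.single i 1) := fun y => by
    conv_lhs => rw [pi_eq_sum_univ' y]
    rw [map_sum]
    refine Finset.sum_congr rfl fun i _ => ?_
    rw [map_smul, smul_eq_mul]
  have h0 : ∑ i, φ (Pi.single i 1) • L i = 0 := by
    ext x
    have : φ (ContinuousLinearMap.pi L x) = 0 := hφ ⟨x, rfl⟩
    rw [hφs] at this
    simpa [mul_comm] using this
  have hz := Fintype.linearIndependent_iff.mp hL _ h0
  refine hφ0 (LinearMap.ext fun y => ?_)
  rw [hφs]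
  simp [hz]

/-- Functions with independent differentials are part of a system of analytic coordinates. -/
theorem exists_analytic_coords {𝕂 E : Type*} [RCLike 𝕂] [NormedAddCommGroup E]
    [NormedSpace 𝕂 E] [CompleteSpace E] {m : ℕ} {g : Fin m → E → 𝕂} {q : E}
    (hg : ∀ i, AnalyticAt 𝕂 (g i) q) (hli : LinearIndependent 𝕂 fun i => fderiv 𝕂 (g i) q) :
    ∃ (F : Submodule 𝕂 E) (π : E →L[𝕂] F) (G : (Fin m → 𝕂) × F → E),
      AnalyticAt 𝕂 G (fun i => g i q, π q) ∧ G (fun i => g i q, π q) = q ∧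
      (∀ᶠ y in 𝓝 ((fun i => g i q, π q) : (Fin m → 𝕂) × F),
        ((fun i => g i (G y), π (G y)) : (Fin m → 𝕂) × F) = y) ∧
      ∀ᶠ x in 𝓝 q, G (fun i => g i x, π x) = x := by
  set L : E →L[𝕂] (Fin m → 𝕂) := ContinuousLinearMap.pi fun i => fderiv 𝕂 (g i) q with hL
  have hsurj : L.range = ⊤ := hli.range_pi_eq_top
  obtain ⟨π, hπ⟩ := L.ker_closedComplemented_of_finiteDimensional_range
  have hcl : IsClosed (L.ker : Set E) := L.isClosed_ker
  have : CompleteSpace L.ker := hcl.completeSpace_coe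
  have hinj : (L.prod π).ker = ⊥ := by
    refine LinearMap.ker_eq_bot'.mpr fun x hx => ?_
    have hx' : (L x, π x) = 0 := hx
    rw [Prod.mk_eq_zero] at hx'
    exact congrArg Subtype.val ((hπ ⟨x, hx'.1⟩).symm.trans hx'.2)
  have hrange : (L.prod π).range = ⊤ := by
    refine LinearMap.range_eq_top.mpr fun y => ?_
    obtain ⟨x₀, hx₀⟩ := LinearMap.range_eq_top.mp hsurj y.1
    refine ⟨x₀ - π x₀ + y.2, ?_⟩
    show (L _, π _) = y
    have e1 : L (π x₀ : E) = 0 := (π x₀).2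
    have e2 : L (y.2 : E) = 0 := y.2.2
    refine Prod.ext ?_ ?_
    · simp only [map_add, map_sub, e1, e2, sub_zero, add_zero]
      exact hx₀
    · simp [hπ]
  let e := ContinuousLinearEquiv.ofBijective (L.prod π) hinj hrange
  have hder : HasFDerivAt (fun x => ((fun i => g i x, π x) : (Fin m → 𝕂) × L.ker))
      (e : E →L[𝕂] (Fin m → 𝕂) × L.ker) q := by
    have : (e : E →L[𝕂] (Fin m → 𝕂) × L.ker) = L.prod π := by ext <;> rfl
    rw [this]
    exact (hasFDerivAt_pi.mpr fun i => (hg i).differentiableAt.hasFDerivAt).prodMk π.hasFDerivAt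
  have han : AnalyticAt 𝕂 (fun x => ((fun i => g i x, π x) : (Fin m → 𝕂) × L.ker)) q :=
    (analyticAt_pi_iff.mpr hg).prod (π.analyticAt q)
  obtain ⟨G, h1, h2, h3, h4⟩ := han.exists_local_inverse e hder
  exact ⟨L.ker, π, G, h1, h2, h3, h4⟩

theorem AnalyticAt.eventually_eq_zero_of_iteratedDeriv {φ : ℝ → ℝ} (hφ : AnalyticAt ℝ φ 0)
    (h : ∀ n, iteratedDeriv n φ 0 = 0) : ∀ᶠ s in 𝓝 0, φ s = 0 := by
  rw [← analyticOrderAt_eq_top, ENat.eq_top_iff_forall_ge]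
  exact fun n => (natCast_le_analyticOrderAt_iff_iteratedDeriv_eq_zero hφ).mpr fun i _ => h i

/-- A class of analytic germs vanishing at `a` and stable under differentiation along the second
factor consists of germs vanishing on the slice of `a`. -/
theorem eventually_slice_eq_zero {E F : Type*} [NormedAddCommGroup E] [NormedSpace ℝ E]
    [NormedAddCommGroup F] [NormedSpace ℝ F] [CompleteSpace E] [CompleteSpace F]
    {a : E × F} {V : Set (E × F → ℝ)}
    (han : ∀ H ∈ V, AnalyticAt ℝ H a) (h0 : ∀ H ∈ V, H a = 0)
    (hd : ∀ H ∈ V, ∀ v : F, (fun y => fderiv ℝ H y (0, v)) ∈ V) {H : E × F → ℝ} (hH : H ∈ V) :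
    ∀ᶠ y in 𝓝 a.2, H (a.1, y) = 0 := by
  have hline : ∀ w : E × F, Tendsto (fun s : ℝ => a + s • w) (𝓝 0) (𝓝 a) := fun w => by
    have : Continuous fun s : ℝ => a + s • w := by fun_prop
    simpa using this.tendsto 0
  have hiter : ∀ (v : F) (n : ℕ), ∀ H ∈ V,
      iteratedDeriv n (fun s : ℝ => H (a + s • ((0, v) : E × F))) 0 = 0 := by
    intro v n
    induction n with
    | zero =>
      intro H hH
      rw [iteratedDeriv_zero, zero_smul, add_zero]
      exact h0 H hH
    | succ n ih =>
      intro H hH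
      rw [iteratedDeriv_succ']
      rw [Filter.EventuallyEq.iteratedDeriv_eq n
        (g := fun s : ℝ => fderiv ℝ H (a + s • ((0, v) : E × F)) (0, v))]
      · exact ih _ (hd H hH v)
      · filter_upwards [(hline (0, v)).eventually (han H hH).eventually_analyticAt] with s hs
        have h1 : HasDerivAt (fun s : ℝ => a + s • ((0, v) : E × F)) ((0, v) : E × F) s := by
          simpa using ((hasDerivAt_id s).smul_const ((0, v) : E × F)).const_add a
        exact (hs.differentiableAt.hasFDerivAt.comp_hasDerivAt s h1).deriv
  obtain ⟨ε, hε, hball⟩ := Metric.eventually_nhds_iff_ball.mp (han H hH).eventually_analyticAt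
  filter_upwards [Metric.ball_mem_nhds a.2 hε] with y hy
  set w : E × F := (0, y - a.2) with hw
  have hwn : ‖w‖ < ε := by
    rw [hw, Prod.norm_def, norm_zero, max_eq_right (norm_nonneg _)]
    exact mem_ball_iff_norm.mp hy
  have hon : AnalyticOnNhd ℝ (fun s : ℝ => H (a + s • w)) (Icc 0 1) := fun s hs => by
    refine AnalyticAt.fun_comp (g := H) (hball _ ?_)
      (analyticAt_const.add (analyticAt_id.smul analyticAt_const))
    rw [mem_ball_iff_norm, add_sub_cancel_left, norm_smul, Real.norm_of_nonneg hs.1]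
    exact (mul_le_of_le_one_left (norm_nonneg _) hs.2).trans_lt hwn
  have h0mem : (0 : ℝ) ∈ Icc (0 : ℝ) 1 := ⟨le_rfl, zero_le_one⟩
  have := hon.eqOn_zero_of_preconnected_of_eventuallyEq_zero isPreconnected_Icc h0mem
    ((hon 0 h0mem).eventually_eq_zero_of_iteratedDeriv fun n => hiter _ n H hH)
    (show (1 : ℝ) ∈ Icc (0 : ℝ) 1 from ⟨zero_le_one, le_rfl⟩)
  have e : a + (1 : ℝ) • w = (a.1, y) := by ext <;> simp [hw]
  rw [← e]
  exact this

/-- A real-analytic set has a regular point in every neighbourhood of each of its points. -/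
theorem exists_regular_point {E : Type*} [NormedAddCommGroup E] [NormedSpace ℝ E]
    [FiniteDimensional ℝ E] {X O : Set E} (hO : IsOpen O) {q₀ : E} (hq₀X : q₀ ∈ X) (hq₀O : q₀ ∈ O)
    {ι : Type*} [Finite ι] {f : ι → E → ℝ} (hf : ∀ i, ∀ z ∈ O, AnalyticAt ℝ (f i) z)
    (hXf : ∀ z ∈ O, z ∈ X ↔ ∀ i, f i z = 0) :
    ∃ q ∈ X ∩ O, ∃ r ≤ Module.finrank ℝ E, ∃ g : Fin r → E → ℝ, (∀ i, AnalyticAt ℝ (g i) q) ∧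
      LinearIndependent ℝ (fun i => fderiv ℝ (g i) q) ∧
      ∀ᶠ z in 𝓝 q, z ∈ X ↔ ∀ i, g i z = 0 := by
  classical
  have hcs : CompleteSpace E := FiniteDimensional.complete ℝ E
  let P : E → (r : ℕ) → (Fin r → E → ℝ) → Prop := fun q r g =>
    (∀ i, AnalyticAt ℝ (g i) q) ∧ (∀ i, ∀ᶠ z in 𝓝 q, z ∈ X → g i z = 0) ∧
      LinearIndependent ℝ fun i => fderiv ℝ (g i) q
  let Q : ℕ → Prop := fun r => ∃ q ∈ X ∩ O, ∃ g, P q r g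
  have hQ0 : Q 0 := ⟨q₀, ⟨hq₀X, hq₀O⟩, fun i => i.elim0, fun i => i.elim0, fun i => i.elim0,
    linearIndependent_empty_type⟩
  have hQle : ∀ r, Q r → r ≤ Module.finrank ℝ E := by
    rintro r ⟨q, -, g, -, -, hli⟩
    have h1 := hli.fintype_card_le_finrank
    have h2 : Module.finrank ℝ (E →L[ℝ] ℝ) = Module.finrank ℝ E := by
      rw [← (LinearMap.toContinuousLinearMap (𝕜 := ℝ) (E := E) (F' := ℝ)).finrank_eq]
      exact Subspace.dual_finrank_eq
    rwa [Fintype.card_fin, h2] at h1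
  obtain ⟨r, hr, hmax⟩ : ∃ r, Q r ∧ ¬ Q (r + 1) := by
    by_contra! hcon
    have hall : ∀ r, Q r := fun r => Nat.rec hQ0 (fun r ih => hcon r ih) r
    exact absurd (hQle _ (hall (Module.finrank ℝ E + 1))) (by omega)
  have hrle := hQle r hr
  obtain ⟨q, ⟨hqX, hqO⟩, g, hg⟩ := hr
  obtain ⟨hga, hgX, hgli⟩ := hg
  have hspan : ∀ z ∈ X ∩ O, P z r g → ∀ h : E → ℝ, AnalyticAt ℝ h z →
      (∀ᶠ z' in 𝓝 z, z' ∈ X → h z' = 0) →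
      fderiv ℝ h z ∈ Submodule.span ℝ (range fun i => fderiv ℝ (g i) z) := by
    intro z hz hPz h hh hhX
    by_contra hns
    refine hmax ⟨z, hz, Fin.cons h g, fun i => ?_, fun i => ?_, ?_⟩
    · refine Fin.cases ?_ (fun i => ?_) i
      · simpa using hh
      · simpa using hPz.1 i
    · refine Fin.cases ?_ (fun i => ?_) i
      · simpa using hhX
      · simpa using hPz.2.1 i
    · have e : (fun i : Fin (r + 1) => fderiv ℝ ((Fin.cons h g : Fin (r + 1) → E → ℝ) i) z) =
          Fin.cons (fderiv ℝ h z) fun i => fderiv ℝ (g i) z := by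
        funext i
        refine Fin.cases ?_ (fun i => ?_) i <;> simp
      rw [e]
      exact hPz.2.2.finCons hns
  have hPnear : ∀ᶠ z in 𝓝 q, P z r g := by
    refine (eventually_all.mpr fun i => (hga i).eventually_analyticAt).and
      (.and (eventually_all.mpr fun i => (hgX i).eventually_nhds) ?_)
    have hc : ContinuousAt (fun z => fun i => fderiv ℝ (g i) z) q :=
      continuousAt_pi.mpr fun i => (hga i).fderiv.continuousAt
    exact hc.eventually (isOpen_setOfPred_linearIndependent.mem_nhds hgli)
  obtain ⟨F, π, G, hGa, hGq, hΨG, hGΨ⟩ := exists_analytic_coords hga hgli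
  set Ψ : E → (Fin r → ℝ) × F := fun z => (fun i => g i z, π z) with hΨ
  change AnalyticAt ℝ G (Ψ q) at hGa
  change G (Ψ q) = q at hGq
  change ∀ᶠ y in 𝓝 (Ψ q), Ψ (G y) = y at hΨG
  change ∀ᶠ z in 𝓝 q, G (Ψ z) = z at hGΨ
  have hΨa : AnalyticAt ℝ Ψ q := (analyticAt_pi_iff.mpr hga).prod (π.analyticAt q)
  let V : Set ((Fin r → ℝ) × F → ℝ) :=
    {H | AnalyticAt ℝ H (Ψ q) ∧ ∀ᶠ z in 𝓝 q, z ∈ X → H (Ψ z) = 0}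
  have hVd : ∀ H ∈ V, ∀ v : F, (fun y => fderiv ℝ H y (0, v)) ∈ V := by
    rintro H ⟨hHa, hHX⟩ v
    refine ⟨((ContinuousLinearMap.apply ℝ ℝ ((0, v) : (Fin r → ℝ) × F)).analyticAt _).comp
      hHa.fderiv, ?_⟩
    filter_upwards [hPnear, hO.mem_nhds hqO, hΨa.continuousAt.eventually hHa.eventually_analyticAt,
      hΨa.eventually_analyticAt, hHX.eventually_nhds,
      hΨa.continuousAt.eventually hGa.eventually_analyticAt,
      hΨa.continuousAt.eventually hΨG.eventually_nhds, hGΨ] with z hP hzO hHz hΨz hHXz hGz hΨGz hGΨz hzX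
    have hmem := hspan z ⟨hzX, hzO⟩ hP (fun z => H (Ψ z)) (hHz.fun_comp hΨz) hHXz
    have hΨ' : HasFDerivAt Ψ ((ContinuousLinearMap.pi fun i => fderiv ℝ (g i) z).prod π) z :=
      (hasFDerivAt_pi.mpr fun i => (hP.1 i).differentiableAt.hasFDerivAt).prodMk π.hasFDerivAt
    have hΨ'' : HasFDerivAt Ψ ((ContinuousLinearMap.pi fun i => fderiv ℝ (g i) z).prod π)
        (G (Ψ z)) := by rwa [hGΨz]
    have hid := (hΨ''.comp (Ψ z) hGz.differentiableAt.hasFDerivAt).unique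
      ((hasFDerivAt_id (Ψ z)).congr_of_eventuallyEq hΨGz)
    set u := fderiv ℝ G (Ψ z) (0, v) with hu
    have hΨu : ((fun i => fderiv ℝ (g i) z u, π u) : (Fin r → ℝ) × F) = (0, v) := by
      simpa using DFunLike.congr_fun hid ((0, v) : (Fin r → ℝ) × F)
    have hcomp : fderiv ℝ (fun z => H (Ψ z)) z u = fderiv ℝ H (Ψ z) (0, v) := by
      have hc : HasFDerivAt (fun z => H (Ψ z)) _ z :=
        hHz.differentiableAt.hasFDerivAt.comp z hΨ'
      rw [hc.fderiv, ← hΨu]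
      rfl
    rw [← hcomp]
    refine Submodule.span_induction (p := fun φ _ => φ u = 0) ?_ (by simp) ?_ ?_ hmem
    · rintro _ ⟨i, rfl⟩
      exact congrFun (congrArg Prod.fst hΨu) i
    · intro x y _ _ hx hy; simp [hx, hy]
    · intro c x _ hx; simp [hx]
  have hslice : ∀ i, ∀ᶠ y in 𝓝 (Ψ q).2, f i (G ((Ψ q).1, y)) = 0 := fun i =>
    eventually_slice_eq_zero (H := fun y => f i (G y)) (V := V) (fun H hH => hH.1)
      (fun H hH => hH.2.self_of_nhds hqX) hVd
      ⟨(hf i q hqO).fun_comp_of_eq hGa hGq, by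
        filter_upwards [hGΨ, hO.mem_nhds hqO] with z hz hzO hzX
        rw [hz]
        exact (hXf z hzO).mp hzX i⟩
  refine ⟨q, ⟨hqX, hqO⟩, r, hrle, g, hga, hgli, ?_⟩
  have hπ : ∀ᶠ z in 𝓝 q, ∀ i, f i (G ((Ψ q).1, π z)) = 0 :=
    eventually_all.mpr fun i => π.continuous.continuousAt.eventually (hslice i)
  filter_upwards [hπ, hGΨ, hO.mem_nhds hqO, eventually_all.mpr hgX] with z hz hGz hzO hgz
  refine ⟨fun hzX i => hgz i hzX, fun h0 => (hXf z hzO).mpr fun i => ?_⟩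
  have e : Ψ z = ((Ψ q).1, π z) := by
    refine Prod.ext (funext fun i => ?_) rfl
    show g i z = g i q
    rw [h0 i, (hgX i).self_of_nhds hqX]
  rw [← hGz, e]
  exact hz i

theorem AnalyticAt.star_comp_star {N : ℕ} {f : ℂ → Fin N → ℂ} {y : ℂ}
    (hf : AnalyticAt ℂ f (star y)) : AnalyticAt ℂ (fun y => star (f (star y))) y := by
  rw [Complex.analyticAt_iff_eventually_differentiableAt]
  filter_upwards [(continuous_star.tendsto y).eventually hf.eventually_analyticAt] with z hz
  have := hz.differentiableAt.star_star
  rwa [star_star] at this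

theorem frequently_mem_range_ofReal : ∃ᶠ y : ℂ in 𝓝[≠] 0, ∃ t : ℝ, (t : ℂ) = y := by
  have h1 : Tendsto (fun t : ℝ => (t : ℂ)) (𝓝[≠] 0) (𝓝[≠] 0) := by
    refine tendsto_nhdsWithin_iff.mpr ⟨?_, ?_⟩
    · have := Complex.continuous_ofReal.tendsto 0
      rw [Complex.ofReal_zero] at this
      exact this.mono_left nhdsWithin_le_nhds
    · filter_upwards [self_mem_nhdsWithin] with t ht
      simpa using ht
  exact h1.frequently (Eventually.of_forall fun t => ⟨t, rfl⟩).frequently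

/-- A holomorphic function of `(z, star u)` vanishing on the diagonal of a complex submanifold
vanishes on pairs of points of it. -/
theorem exists_polarization {N m : ℕ} {g : Fin m → (Fin N → ℂ) → ℂ} {w : Fin N → ℂ}
    (hg : ∀ i, AnalyticAt ℂ (g i) w) (hli : LinearIndependent ℂ fun i => fderiv ℂ (g i) w)
    {X : Set (Fin N → ℂ)} (hw : w ∈ X) (hX : ∀ᶠ z in 𝓝 w, z ∈ X ↔ ∀ i, g i z = 0)
    {F : (Fin N → ℂ) × (Fin N → ℂ) → ℂ} (hF : AnalyticAt ℂ F (w, star w))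
    (hF0 : ∀ᶠ z in 𝓝 w, z ∈ X → F (z, star z) = 0) :
    ∃ W ∈ 𝓝 w, ∀ z ∈ X ∩ W, ∀ u ∈ X ∩ W, F (z, star u) = 0 := by
  obtain ⟨S, π, G, hGa, hGw, hΨG, hGΨ⟩ := exists_analytic_coords hg hli
  have hg0 : (fun i => g i w) = 0 := funext fun i => hX.self_of_nhds.mp hw i
  rw [hg0] at hGa hGw hΨG
  set ψ : S → Fin N → ℂ := fun s => G (0, s) with hψ
  have hψa : AnalyticAt ℂ ψ (π w) :=
    AnalyticAt.fun_comp (g := G) hGa (analyticAt_const.prod analyticAt_id)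
  have hψw : ψ (π w) = w := hGw
  have hc : Tendsto (fun s : S => ((0, s) : (Fin m → ℂ) × S)) (𝓝 (π w)) (𝓝 (0, π w)) :=
    (by fun_prop : Continuous fun s : S => ((0, s) : (Fin m → ℂ) × S)).tendsto _
  have hψt : Tendsto ψ (𝓝 (π w)) (𝓝 w) := by
    have := hψa.continuousAt.tendsto; rwa [hψw] at this
  have hev : ∀ᶠ s in 𝓝 (π w), AnalyticAt ℂ ψ s ∧ F (ψ s, star (ψ s)) = 0 := by
    filter_upwards [hψa.eventually_analyticAt, hc.eventually hΨG, hψt.eventually hX,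
      hψt.eventually hF0] with s h1 h2 h3 h4
    exact ⟨h1, h4 (h3.mpr fun i => congrFun (congrArg Prod.fst h2) i)⟩
  have hev2 : ∀ᶠ s in 𝓝 (π w, π w), AnalyticAt ℂ F (ψ s.1, star (ψ s.2)) := by
    have hfst : Tendsto (fun s : S × S => ψ s.1) (𝓝 (π w, π w)) (𝓝 w) :=
      hψt.comp (continuous_fst.tendsto (π w, π w))
    have hsnd : Tendsto (fun s : S × S => star (ψ s.2)) (𝓝 (π w, π w)) (𝓝 (star w)) :=
      (continuous_star.tendsto w).comp (hψt.comp (continuous_snd.tendsto (π w, π w)))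
    exact (hfst.prodMk_nhds hsnd).eventually hF.eventually_analyticAt
  obtain ⟨δ₁, hδ₁, hb₁⟩ := Metric.eventually_nhds_iff_ball.mp hev
  obtain ⟨δ₂, hδ₂, hb₂⟩ := Metric.eventually_nhds_iff_ball.mp hev2
  set δ := min δ₁ δ₂ with hδ
  have hδ0 : 0 < δ := lt_min hδ₁ hδ₂
  have hkey : ∀ s₁ ∈ Metric.ball (π w) (δ / 4), ∀ s₂ ∈ Metric.ball (π w) (δ / 4),
      F (ψ s₁, star (ψ s₂)) = 0 := by
    intro s₁ h₁ s₂ h₂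
    rw [mem_ball_iff_norm] at h₁ h₂
    set A : ℂ → S := fun y => s₁ + (1 / 2 + I * y) • (s₂ - s₁) with hA
    have hAa : ∀ y, AnalyticAt ℂ A y := fun y =>
      analyticAt_const.add ((analyticAt_const.add (analyticAt_const.mul analyticAt_id)).smul
        analyticAt_const)
    have hAmem : ∀ y ∈ Metric.closedBall (0 : ℂ) (1 / 2), A y ∈ Metric.ball (π w) δ := by
      intro y hy
      rw [mem_closedBall_zero_iff] at hy
      rw [mem_ball_iff_norm]
      have e1 : ‖(1 / 2 + I * y : ℂ)‖ ≤ 1 := by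
        refine (norm_add_le _ _).trans ?_
        rw [norm_mul, Complex.norm_I, one_mul]
        norm_num
        linarith
      have e2 : ‖s₂ - s₁‖ ≤ ‖s₂ - π w‖ + ‖s₁ - π w‖ := by
        rw [← sub_sub_sub_cancel_right s₂ s₁ (π w)]
        exact norm_sub_le _ _
      calc ‖A y - π w‖ = ‖(s₁ - π w) + (1 / 2 + I * y) • (s₂ - s₁)‖ := by
            congr 1; simp only [hA]; abel
        _ ≤ ‖s₁ - π w‖ + ‖(1 / 2 + I * y : ℂ)‖ * ‖s₂ - s₁‖ :=
            (norm_add_le _ _).trans_eq (by rw [norm_smul])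
        _ ≤ ‖s₁ - π w‖ + 1 * ‖s₂ - s₁‖ := by gcongr
        _ < δ := by linarith
    have hstar : ∀ y ∈ Metric.closedBall (0 : ℂ) (1 / 2),
        star y ∈ Metric.closedBall (0 : ℂ) (1 / 2) := fun y hy => by
      simpa using hy
    have hball₁ : Metric.ball (π w) δ ⊆ Metric.ball (π w) δ₁ := Metric.ball_subset_ball (min_le_left _ _)
    have hball₂ : ∀ s ∈ Metric.ball (π w) δ, ∀ t ∈ Metric.ball (π w) δ,
        (s, t) ∈ Metric.ball (π w, π w) δ₂ := fun s hs t ht => by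
      rw [← ball_prod_same]
      exact ⟨Metric.ball_subset_ball (min_le_right _ _) hs, Metric.ball_subset_ball (min_le_right _ _) ht⟩
    have hon : AnalyticOnNhd ℂ (fun y => F (ψ (A y), star (ψ (A (star y)))))
        (Metric.closedBall (0 : ℂ) (1 / 2)) := by
      intro y hy
      have a1 : ∀ y ∈ Metric.closedBall (0 : ℂ) (1 / 2), AnalyticAt ℂ (fun y => ψ (A y)) y :=
        fun y hy => (hb₁ _ (hball₁ (hAmem y hy))).1.fun_comp (hAa y)
      have a2 : AnalyticAt ℂ (fun y => star (ψ (A (star y)))) y := (a1 _ (hstar y hy)).star_comp_star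
      exact AnalyticAt.fun_comp (g := F) (hb₂ _ (hball₂ _ (hAmem y hy) _ (hAmem _ (hstar y hy))))
        ((a1 y hy).prod a2)
    have hfreq : ∃ᶠ y in 𝓝[≠] (0 : ℂ), F (ψ (A y), star (ψ (A (star y)))) = 0 := by
      refine (frequently_mem_range_ofReal.and_eventually (mem_nhdsWithin_of_mem_nhds
        (Metric.closedBall_mem_nhds (0 : ℂ) (by norm_num : (0 : ℝ) < 1 / 2)))).mono ?_
      rintro _ ⟨⟨t, rfl⟩, ht⟩
      have : star (t : ℂ) = t := Complex.conj_ofReal t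
      rw [this]
      exact (hb₁ _ (hball₁ (hAmem _ ht))).2
    have hI : I / 2 ∈ Metric.closedBall (0 : ℂ) (1 / 2) := by
      rw [mem_closedBall_zero_iff]; simp
    have h0 := hon.eqOn_zero_of_preconnected_of_frequently_eq_zero
      (convex_closedBall (0 : ℂ) (1 / 2)).isPreconnected
      (Metric.mem_closedBall_self (by norm_num)) hfreq hI
    have e1 : A (I / 2) = s₁ := by
      have : (1 / 2 + I * (I / 2) : ℂ) = 0 := by
        rw [mul_div_assoc', I_mul_I]; norm_num
      simp only [hA, this, zero_smul, add_zero]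
    have e2 : A (star (I / 2)) = s₂ := by
      have : (1 / 2 + I * star (I / 2) : ℂ) = 1 := by
        simp only [Complex.star_def, map_div₀, conj_I, map_ofNat]
        rw [mul_div_assoc', mul_neg, I_mul_I]; norm_num
      simp only [hA, this, one_smul, add_sub_cancel]
    have h0' : F (ψ (A (I / 2)), star (ψ (A (star (I / 2))))) = 0 := h0
    rwa [e1, e2] at h0'
  have hπ : ∀ᶠ z in 𝓝 w, π z ∈ Metric.ball (π w) (δ / 4) :=
    π.continuous.continuousAt.eventually (Metric.ball_mem_nhds _ (by positivity))
  refine ⟨{z | (z ∈ X → ψ (π z) = z) ∧ π z ∈ Metric.ball (π w) (δ / 4)}, ?_, ?_⟩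
  · filter_upwards [hX, hGΨ, hπ] with z h1 h2 h3
    refine ⟨fun hz => ?_, h3⟩
    have : (fun i => g i z) = 0 := funext (h1.mp hz)
    rw [this] at h2
    exact h2
  · rintro z ⟨hz, hz1, hz2⟩ u ⟨hu, hu1, hu2⟩
    rw [← hz1 hz, ← hu1 hu]
    exact hkey _ hz2 _ hu2

/-- A finite union of zero sets of finite families of analytic functions is the zero set of the
products of one function from each family. -/
theorem exists_equations_iUnion {E C : Type*} [NormedAddCommGroup E] [NormedSpace ℂ E] [Finite C]
    {κ : C → Type*} {S : ∀ c, Set (κ c)} (hS : ∀ c, (S c).Finite) {h : ∀ c, κ c → E → ℂ}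
    {V : Set E} (hV : ∀ c k, AnalyticOn ℂ (h c k) V) :
    ∃ (n : ℕ) (f : Fin n → E → ℂ), (∀ i, AnalyticOn ℂ (f i) V) ∧
      ∀ z, (∀ i, f i z = 0) ↔ ∃ c, ∀ k ∈ S c, h c k z = 0 := by
  have := Fintype.ofFinite C
  have : ∀ c, Finite (S c) := hS
  let e := Finite.equivFin (∀ c, S c)
  refine ⟨_, fun i z => ∏ c, h c (e.symm i c) z, fun i => ?_, fun z => ⟨fun hz => ?_, ?_⟩⟩
  · exact Finset.analyticOn_fun_prod _ fun c _ => hV c _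
  · by_contra! hne
    choose s hs hsz using hne
    have := hz (e fun c => ⟨s c, hs c⟩)
    simp only [Equiv.symm_apply_apply] at this
    exact Finset.prod_ne_zero_iff.mpr (fun c _ => hsz c) this
  · rintro ⟨c, hc⟩ i
    exact Finset.prod_eq_zero (Finset.mem_univ c) (hc _ (e.symm i c).2)

/-- Vanishing of `F (z, star u)` on pairs of points of a parametrized set propagates from a
neighbourhood of one point to the whole set. -/
theorem eq_zero_of_analytic_parametrization {N : ℕ} {E : Type*} [NormedAddCommGroup E]
    [NormedSpace ℝ E] {φ : E → Fin N → ℂ} (hφ : AnalyticOnNhd ℝ φ univ)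
    {F : (Fin N → ℂ) × (Fin N → ℂ) → ℂ}
    (hF : ∀ y y', AnalyticAt ℂ F (φ y, star (φ y'))) {y₀ : E}
    (h₀ : ∀ᶠ y in 𝓝 y₀, ∀ᶠ y' in 𝓝 y₀, F (φ y, star (φ y')) = 0) (y y' : E) :
    F (φ y, star (φ y')) = 0 := by
  have hφ' : ∀ y, AnalyticAt ℝ φ y := fun y => hφ y (mem_univ y)
  have hs : ∀ y, AnalyticAt ℝ (fun y => star (φ y)) y := fun y =>
    AnalyticAt.fun_comp (g := fun z : Fin N → ℂ => star z)
      (((starL' ℝ : (Fin N → ℂ) ≃L[ℝ] (Fin N → ℂ)) : (Fin N → ℂ) →L[ℝ] (Fin N → ℂ)).analyticAt _)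
      (hφ' y)
  have h1 : ∀ᶠ y in 𝓝 y₀, ∀ y', F (φ y, star (φ y')) = 0 := by
    filter_upwards [h₀] with y hy y'
    have hon : AnalyticOnNhd ℝ (fun y' => F (φ y, star (φ y'))) univ := fun y' _ =>
      AnalyticAt.fun_comp (g := F) (hF y y').restrictScalars (analyticAt_const.prod (hs y'))
    exact hon.eqOn_zero_of_preconnected_of_eventuallyEq_zero isPreconnected_univ
      (mem_univ y₀) hy (mem_univ y')
  have hon : AnalyticOnNhd ℝ (fun y => F (φ y, star (φ y'))) univ := fun y _ =>
    AnalyticAt.fun_comp (g := F) (hF y y').restrictScalars ((hφ' y).prod analyticAt_const)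
  exact hon.eqOn_zero_of_preconnected_of_eventuallyEq_zero isPreconnected_univ
    (mem_univ y₀) (h1.mono fun y hy => hy y') (mem_univ y)

/-- Near each of its points, a real-analytic set which is complex at all its regular points is
the zero set of finitely many holomorphic functions. -/
theorem exists_holomorphic_equations {N k : ℕ} {X V : Set (Fin N → ℂ)} (hV : IsOpen V)
    {p : Fin N → ℂ} (hp : p ∈ V) {f : Fin k → (Fin N → ℂ) → ℝ}
    (hf : ∀ i, ∀ z ∈ V, AnalyticAt ℝ (f i) z) (hXf : ∀ z ∈ V, z ∈ X ↔ ∀ i, f i z = 0)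
    (hreg : ∀ q ∈ X, ∀ r ≤ Module.finrank ℝ (Fin N → ℂ), ∀ g : Fin r → (Fin N → ℂ) → ℝ,
      (∀ i, AnalyticAt ℝ (g i) q) → (LinearIndependent ℝ fun i => fderiv ℝ (g i) q) →
      (∀ᶠ z in 𝓝 q, z ∈ X ↔ ∀ i, g i z = 0) →
      ∃ (m : ℕ) (g' : Fin m → (Fin N → ℂ) → ℂ), (∀ i, AnalyticAt ℂ (g' i) q) ∧
        (LinearIndependent ℂ fun i => fderiv ℂ (g' i) q) ∧
        ∀ᶠ z in 𝓝 q, z ∈ X ↔ ∀ i, g' i z = 0) :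
    ∃ V' : Set (Fin N → ℂ), IsOpen V' ∧ p ∈ V' ∧ V' ⊆ V ∧
      ∃ (n : ℕ) (h : Fin n → (Fin N → ℂ) → ℂ), (∀ i, AnalyticOn ℂ (h i) V') ∧
        X ∩ V' = {z ∈ V' | ∀ i, h i z = 0} := by
  choose F q R hF hFd hFs using fun i => exists_complexification (hf i p hp)
  choose r hr0 hr using fun i => exists_slice_radius (hF i)
  let ρ : ℝ≥0∞ := Finset.univ.inf fun i => min (r i) (R i)
  have hρ0 : 0 < ρ := (Finset.lt_inf_iff ENNReal.zero_lt_top).mpr fun i _ =>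
    lt_min (hr0 i) (hF i).r_pos
  have hρ : ∀ i, ρ ≤ min (r i) (R i) := fun i => Finset.inf_le (Finset.mem_univ i)
  let U : Set (Fin N → ℂ) := V ∩ Metric.eball p ρ
  have hUo : IsOpen U := hV.inter Metric.isOpen_eball
  have hpU : p ∈ U := ⟨hp, Metric.mem_eball_self hρ0⟩
  have hstar : ∀ u ∈ U, star u ∈ Metric.eball (star p) ρ := fun u hu => by
    rw [Metric.mem_eball, star_isometry.edist_eq]
    exact hu.2
  have hFa : ∀ i, ∀ z ∈ U, ∀ u ∈ U, AnalyticAt ℂ (F i) (z, star u) := fun i z hz u hu =>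
    (hF i).analyticAt_of_mem <| by
      rw [Metric.mem_eball, Prod.edist_eq]
      exact max_lt (hz.2.trans_le ((hρ i).trans (min_le_right _ _)))
        ((hstar u hu).trans_le ((hρ i).trans (min_le_right _ _)))
  have hslice : ∀ i, ∀ u ∈ U, ∃ s, HasFPowerSeriesOnBall (fun z => F i (z, star u)) s p ρ :=
    fun i u hu => by
      obtain ⟨s, hs⟩ := hr i (star u)
        (Metric.eball_subset_eball ((hρ i).trans (min_le_left _ _)) (hstar u hu))
      exact ⟨s, hs.mono hρ0 ((hρ i).trans (min_le_left _ _))⟩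
  have hsl : ∀ i, ∀ u ∈ U, ∀ z ∈ U, AnalyticAt ℂ (fun z => F i (z, star u)) z :=
    fun i u hu z hz => (hslice i u hu).choose_spec.analyticAt_of_mem hz.2
  have hdiag : ∀ i, ∀ z ∈ U, F i (z, star z) = f i z := fun i z hz =>
    hFd i z (Metric.eball_subset_eball ((hρ i).trans (min_le_right _ _)) hz.2)
  have hXU : ∀ z ∈ U, (∀ i, F i (z, star z) = 0) → z ∈ X := fun z hz h =>
    (hXf z hz.1).mpr fun i => by
      have := h i
      rw [hdiag i z hz] at this
      exact_mod_cast this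
  obtain ⟨C, _, φ, hφa, hφU, hφf, hφn⟩ := hasCells_of_finrank _ (Fin N → ℂ) rfl (Fin k)
    (fun i y => f i (p + y))
    (fun i => AnalyticAt.fun_comp_of_eq (hf i p hp) (analyticAt_const.add analyticAt_id)
      (add_zero p))
    ((p + ·) ⁻¹' U) ((continuous_const.add continuous_id).continuousAt.preimage_mem_nhds
      (by simpa using hUo.mem_nhds hpU))
  let Φ : C → (Fin N → ℂ) → Fin N → ℂ := fun c y => p + φ c y
  have hΦa : ∀ c, AnalyticOnNhd ℝ (Φ c) univ := fun c y hy => analyticAt_const.add (hφa c y hy)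
  have hΦU : ∀ c y, Φ c y ∈ U := hφU
  have hΦn : ∀ᶠ z in 𝓝 p, ∃ c y, Φ c y = z := by
    have h1 : Tendsto (fun z => z - p) (𝓝 p) (𝓝 0) := by
      have := (continuous_sub_right p).tendsto p
      rwa [sub_self] at this
    filter_upwards [h1 hφn] with z hz
    obtain ⟨c, y, hy⟩ := mem_iUnion.mp hz
    exact ⟨c, y, by simp [Φ, hy]⟩
  let A : C → Set (Fin N → ℂ) := fun c => {z ∈ U | ∀ i y, F i (z, star (Φ c y)) = 0}
  let κ : C → Type := fun c => Fin k × ↥(range (Φ c) ∪ A c)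
  let h : ∀ c, κ c → (Fin N → ℂ) → ℂ := fun c s z => F s.1 (z, star (s.2 : Fin N → ℂ))
  have hκU : ∀ c (s : κ c), (s.2 : Fin N → ℂ) ∈ U := fun c s => by
    rcases s.2.2 with ⟨y, hy⟩ | hs
    · exact hy ▸ hΦU c y
    · exact hs.1
  choose ε hε S hS hSz using fun c => exists_finite_common_zero (f := h c) (x := p) hρ0
    fun s => hslice s.1 s.2 (hκU c s)
  let G : Set C := {c | ∀ i y y', F i (Φ c y, star (Φ c y')) = 0}
  have hGX : ∀ c, ∀ z ∈ U, (∀ s, h c s z = 0) → z ∈ X := fun c z hz hs => by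
    have hzA : z ∈ A c := ⟨hz, fun i y => hs (i, ⟨Φ c y, Or.inl ⟨y, rfl⟩⟩)⟩
    exact hXU z hz fun i => hs (i, ⟨z, Or.inr hzA⟩)
  have hGK : ∀ c ∈ G, ∀ y s, h c s (Φ c y) = 0 := by
    rintro c hc y ⟨i, u, ⟨y', rfl⟩ | hu⟩
    · exact hc i y y'
    · change F i (Φ c y, star u) = 0
      rw [hFs i u (Φ c y), hu.2 i y, star_zero]
  obtain ⟨V₁, hV₁, hV₁o, hpV₁⟩ := eventually_nhds_iff.mp hΦn
  let V' : Set (Fin N → ℂ) := U ∩ V₁ ∩ ⋂ c, Metric.ball p (ε c)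
  have hV'o : IsOpen V' := (hUo.inter hV₁o).inter
    (isOpen_iInter_of_finite fun c => Metric.isOpen_ball)
  have hV'U : ∀ z ∈ V', z ∈ U := fun z hz => hz.1.1
  have hmain : ∀ z ∈ V', z ∈ X → ∃ c : G, ∀ s, h c s z = 0 := by
    by_contra! hcon
    obtain ⟨z, hz, hzX, hzne⟩ := hcon
    let O : Set (Fin N → ℂ) := {z ∈ V' | ∀ c : G, ∃ s, h c s z ≠ 0}
    have hO : IsOpen O := by
      refine isOpen_iff_mem_nhds.mpr fun z ⟨hz, hne⟩ => ?_
      refine inter_mem (hV'o.mem_nhds hz) (eventually_all.mpr fun c => ?_)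
      obtain ⟨s, hs⟩ := hne c
      filter_upwards [(hsl s.1 s.2 (hκU c s) z (hV'U z hz)).continuousAt.eventually_ne hs] with x hx
      exact ⟨s, hx⟩
    obtain ⟨w, ⟨hwX, hwO⟩, r, hr, g, hg, hli, hXg⟩ := exists_regular_point hO hzX ⟨hz, hzne⟩
      (fun i x hx => hf i x (hV'U x hx.1).1) (fun x hx => hXf x (hV'U x hx.1).1)
    have hwU := hV'U w hwO.1
    obtain ⟨m, g', hg', hli', hXg'⟩ := hreg w hwX r hr g hg hli hXg
    obtain ⟨c, y₀, rfl⟩ := hV₁ w hwO.1.1.2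
    have hcX : ∀ y, Φ c y ∈ X := fun y => (hXf _ (hΦU c y).1).mpr fun i =>
      (hφf c i).resolve_right (fun hne => hne y₀ ((hXf _ hwU.1).mp hwX i)) y
    have hcG : c ∈ G := fun i => by
      obtain ⟨W, hW, hWz⟩ := exists_polarization hg' hli' hwX hXg' (hFa i _ hwU _ hwU) (by
        filter_upwards [hUo.mem_nhds hwU] with x hx hxX
        rw [hdiag i x hx, (hXf x hx.1).mp hxX i, ofReal_zero])
      have hW' : ∀ᶠ y in 𝓝 y₀, Φ c y ∈ W :=
        (hΦa c y₀ (mem_univ _)).continuousAt.eventually hW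
      refine eq_zero_of_analytic_parametrization (hΦa c)
        (fun y y' => hFa i _ (hΦU c y) _ (hΦU c y')) (y₀ := y₀) ?_
      filter_upwards [hW'] with y hy
      filter_upwards [hW'] with y' hy'
      exact hWz _ ⟨hcX y, hy⟩ _ ⟨hcX y', hy'⟩
    obtain ⟨s, hs⟩ := hwO.2 ⟨c, hcG⟩
    exact hs (hGK c hcG y₀ s)
  obtain ⟨n, e, hea, he⟩ := exists_equations_iUnion (C := G) (S := fun c => S c)
    (fun c => hS c) (h := fun c => h c) (V := V')
    fun c s z hz => (hsl s.1 s.2 (hκU c s) z (hV'U z hz)).analyticWithinAt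
  refine ⟨V', hV'o, ⟨⟨hpU, hpV₁⟩, mem_iInter.mpr fun c => Metric.mem_ball_self (hε c)⟩,
    fun z hz => hz.1.1.1, n, e, hea, ?_⟩
  ext z
  refine ⟨fun ⟨hzX, hz⟩ => ⟨hz, (he z).mpr ?_⟩, fun ⟨hz, hez⟩ => ⟨?_, hz⟩⟩
  · obtain ⟨c, hc⟩ := hmain z hz hzX
    exact ⟨c, fun s _ => hc s⟩
  · obtain ⟨c, hc⟩ := (he z).mp hez
    exact hGX c z (hV'U z hz) (hSz c z (mem_iInter.mp hz.2 c) hc)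

/-- A set cut out near `q` by at most `2 * N` analytic functions with independent differentials
is a submanifold near `q`. -/
theorem mem_regPts {N r : ℕ} {X : Set (CN N)} {q : CN N} (hq : q ∈ X) (hr : r ≤ 2 * N)
    {g : Fin r → CN N → ℝ} (hg : ∀ i, AnalyticAt ℝ (g i) q)
    (hli : LinearIndependent ℝ fun i => fderiv ℝ (g i) q)
    (hX : ∀ᶠ z in 𝓝 q, z ∈ X ↔ ∀ i, g i z = 0) : q ∈ regPts N X := by
  obtain ⟨d, rfl⟩ : ∃ d, r = 2 * N - d := ⟨2 * N - r, by omega⟩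
  have hli' : ∀ᶠ z in 𝓝 q, LinearIndependent ℝ fun i => fderiv ℝ (g i) z :=
    (continuousAt_pi.mpr fun i => (hg i).fderiv.continuousAt).eventually
      (isOpen_setOfPred_linearIndependent.mem_nhds hli)
  obtain ⟨V, hV, hVo, hqV⟩ := eventually_nhds_iff.mp
    ((eventually_all.mpr fun i => (hg i).eventually_analyticAt).and (hli'.and hX))
  refine ⟨hq, d, V, g, hVo, hqV, fun i z hz => ((hV z hz).1 i).analyticWithinAt,
    fun z hz => (hV z hz).2.1, ?_⟩
  ext z
  exact ⟨fun ⟨hzX, hz⟩ => ⟨hz, (hV z hz).2.2.mp hzX⟩, fun ⟨hz, h⟩ => ⟨(hV z hz).2.2.mpr h, hz⟩⟩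

/-- a local real-analytic subvariety that is a complex manifold near each of
its regular points is a local complex analytic subvariety. -/
theorem stmt8 (N : ℕ) (Ω X : Set (CN N)) (hΩ : IsOpen Ω)
    (hX : IsRealSubvariety N Ω X)
    (hreg : ∀ p ∈ regPts N X, ∃ d, IsCxSubmanifoldAtDim N d X p) :
    IsComplexSubvariety N Ω X := by
  obtain ⟨hXΩ, hcl, hloc⟩ := hX
  refine ⟨hXΩ, hcl, fun p hp => ?_⟩
  obtain ⟨V, hV, hpV, hVΩ, k, f, hf, hXV⟩ := hloc p hp
  have hXf : ∀ z ∈ V, z ∈ X ↔ ∀ i, f i z = 0 := fun z hz =>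
    ⟨fun h => (hXV.subset ⟨h, hz⟩).2, fun h => (hXV.superset ⟨hz, h⟩).1⟩
  obtain ⟨V', hV', hpV', hVV', h⟩ := exists_holomorphic_equations hV hpV
    (fun i z hz => (hV.analyticOn_iff_analyticOnNhd.mp (hf i)) z hz) hXf <| by
      intro q hq r hr g hg hli hXg
      have hr' : r ≤ 2 * N := by
        simpa [Module.finrank_pi_fintype, mul_comm] using hr
      obtain ⟨d, W, g', hW, hqW, hg', hli', hXW⟩ := hreg q (mem_regPts hq hr' hg hli hXg)
      refine ⟨_, g', fun i => (hW.analyticOn_iff_analyticOnNhd.mp (hg' i)) q hqW, hli' q hqW, ?_⟩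
      filter_upwards [hW.mem_nhds hqW] with z hz
      exact ⟨fun h => (hXW.subset ⟨h, hz⟩).2, fun h => (hXW.superset ⟨hz, h⟩).1⟩
  exact ⟨V', hV', hpV', hVV'.trans hVΩ, h⟩
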